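/- For any constants a, b > 0 with a + b < 1/2 and any constant C₀ > 0, there exist ε > 0, C > 0 and N such that the following holds for all n ≥ N. Let d = (d_1,…,d_n) be a graphical degree sequence satisfying δ ≤ C₀ n^{1/2+ε} and min{d̄, n − d̄ − 1} ≥ n/(3a log n). Let H^{[r]} be a graph on vertex set {1,…,r} with m edges and degree sequence (h_1,…,h_r), where r ≤ C₀ n^{1/2+ε}, (δ³/(λ³(1−λ)³n³)) Σ_{j=1}^r |h_j − λ(r−1)|³ ≤ C₀ n^{−b}, and additionally r²(1 + δ²/n) ≤ C₀ λ²(1−λ)² n^{1−b}. Then the expected number of induced copies of H^{[r]} in G ∼ 𝒢_d equals (r!/|Aut(H^{[r]})|) C(n,r) λ^m (1−λ)^{C(r,2)−m} exp( Λ₀ + E ) for some real E with |E| ≤ C n^{−b}, where Λ₀ = −ω₂/(2λ(1−λ)n) + R ω₂/(2λ²(1−λ)²n²). -/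

import Mathlib

open scoped BigOperators Classical

namespace Stmt16

/-- The degree of vertex `j` in the graph `G`. -/
noncomputable def deg {n : ℕ} (G : SimpleGraph (Fin n)) (j : Fin n) : ℕ :=
  (Finset.univ.filter (fun k => G.Adj j k)).card

/-- The set of simple graphs on `{1,…,n}` with degree sequence `d`. -/
noncomputable def degFinset (n : ℕ) (d : Fin n → ℕ) : Finset (SimpleGraph (Fin n)) :=
  Finset.univ.filter (fun G => ∀ j, deg G j = d j)

/-- The average degree `d̄`. -/
noncomputable def dbar (n : ℕ) (d : Fin n → ℕ) : ℝ := (∑ j, (d j : ℝ)) / n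

/-- The edge density `λ = d̄ / (n-1)`. -/
noncomputable def lam (n : ℕ) (d : Fin n → ℕ) : ℝ := dbar n d / ((n : ℝ) - 1)

/-- `R = (1/n) Σ_j (d_j - d̄)²`. -/
noncomputable def Rpar (n : ℕ) (d : Fin n → ℕ) : ℝ :=
  (∑ j, ((d j : ℝ) - dbar n d) ^ 2) / n

/-- `δ = max_j |d_j - d̄|`. -/
noncomputable def deltaPar (n : ℕ) (d : Fin n → ℕ) : ℝ :=
  ⨆ j : Fin n, |(d j : ℝ) - dbar n d|

/-- The number of automorphisms of `H`: permutations of the vertices preserving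
the edge set. -/
noncomputable def autCard {k : ℕ} (H : SimpleGraph (Fin k)) : ℕ :=
  (Finset.univ.filter
    (fun π : Equiv.Perm (Fin k) => ∀ i j, H.Adj (π i) (π j) ↔ H.Adj i j)).card

/-- The number of induced copies of `H` (a graph on `Fin r`) in `G` (a graph on
`Fin n`): the number of `r`-subsets of vertices inducing a subgraph isomorphic to `H`. -/
noncomputable def indCount {n r : ℕ} (H : SimpleGraph (Fin r))
    (G : SimpleGraph (Fin n)) : ℕ :=
  (Finset.univ.filter (fun S : Finset (Fin n) =>
    S.card = r ∧ Nonempty ((G.induce (S : Set (Fin n))) ≃g H))).card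

/-- The expected number of induced copies of `H` in a uniformly random graph with
degree sequence `d`. -/
noncomputable def expInd (n : ℕ) (d : Fin n → ℕ) {r : ℕ}
    (H : SimpleGraph (Fin r)) : ℝ :=
  (∑ G ∈ degFinset n d, (indCount H G : ℝ)) / ((degFinset n d).card : ℝ)

/-- `ω_t = Σ_{j=1}^r (h_j - λ(r-1))^t`. -/
noncomputable def omega (n : ℕ) (d : Fin n → ℕ) {r : ℕ} (H : SimpleGraph (Fin r))
    (t : ℕ) : ℝ :=
  ∑ j : Fin r, ((deg H j : ℝ) - lam n d * ((r : ℝ) - 1)) ^ t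

/-- `ab` is one of the four pairs between `{u, w}` and `{p, q}`. -/
def IsCross {n : ℕ} (u w p q a b : Fin n) : Prop :=
  ((a = u ∨ a = w) ∧ (b = p ∨ b = q)) ∨ ((b = u ∨ b = w) ∧ (a = p ∨ a = q))

lemma isCross_comm {n : ℕ} {u w p q a b : Fin n} : IsCross u w p q b a ↔ IsCross u w p q a b :=
  or_comm

/-- Toggle the four pairs between `{u, w}` and `{p, q}`. -/
def toggle {n : ℕ} (G : SimpleGraph (Fin n)) (u w p q : Fin n) : SimpleGraph (Fin n) where
  Adj a b := a ≠ b ∧ ¬ (G.Adj a b ↔ IsCross u w p q a b)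
  symm := by
    constructor
    intro a b h
    refine ⟨h.1.symm, ?_⟩
    have := h.2
    rwa [G.adj_comm, ← isCross_comm] at this
  loopless := ⟨fun a h => h.1 rfl⟩

/-- `u p w q` is an alternating cycle: `up` and `wq` are edges, `uq` and `wp` are not. -/
def Alternates {n : ℕ} (G : SimpleGraph (Fin n)) (u w p q : Fin n) : Prop :=
  G.Adj u p ∧ G.Adj w q ∧ ¬ G.Adj u q ∧ ¬ G.Adj w p

lemma toggle_adj_of_not {n : ℕ} (G : SimpleGraph (Fin n)) {u w p q a b : Fin n}
    (h : ¬IsCross u w p q a b) :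
    (toggle G u w p q).Adj a b ↔ G.Adj a b := by
  simp only [toggle, h, iff_false, not_not]
  exact ⟨fun h => h.2, fun h => ⟨h.ne, h⟩⟩

lemma toggle_adj_of {n : ℕ} (G : SimpleGraph (Fin n)) {u w p q a b : Fin n} (hab : a ≠ b)
    (h : IsCross u w p q a b) :
    (toggle G u w p q).Adj a b ↔ ¬ G.Adj a b := by
  simp only [toggle, h, iff_true]
  exact ⟨fun h => h.2, fun h => ⟨hab, h⟩⟩

lemma toggle_toggle {n : ℕ} (G : SimpleGraph (Fin n)) (u w p q : Fin n) :
    toggle (toggle G u w p q) u w p q = G := by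
  ext a b
  have := @SimpleGraph.Adj.ne _ G a b
  simp only [toggle]
  by_cases h : IsCross u w p q a b <;> simp only [h] <;> tauto

lemma toggle_swap {n : ℕ} (G : SimpleGraph (Fin n)) (u w p q : Fin n) :
    toggle G w u p q = toggle G u w p q := by
  ext a b
  simp only [toggle, IsCross, or_comm (a := _ = w)]

lemma Alternates.toggle_alternates {n : ℕ} {G : SimpleGraph (Fin n)} {u w p q : Fin n}
    (h : Alternates G u w p q) (hup : u ≠ p) (huq : u ≠ q) (hwp : w ≠ p) (hwq : w ≠ q) :
    Alternates (toggle G u w p q) w u p q := by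
  obtain ⟨h1, h2, h3, h4⟩ := h
  refine ⟨?_, ?_, ?_, ?_⟩
  · rw [toggle_adj_of _ hwp (by simp [IsCross])]; exact h4
  · rw [toggle_adj_of _ huq (by simp [IsCross])]; exact h3
  · rw [toggle_adj_of _ hwq (by simp [IsCross])]; simpa using h2
  · rw [toggle_adj_of _ hup (by simp [IsCross])]; simpa using h1

lemma deg_eq_of_equiv {n : ℕ} {G G' : SimpleGraph (Fin n)} {v : Fin n} (σ : Equiv.Perm (Fin n))
    (h : ∀ b, G'.Adj v b ↔ G.Adj v (σ b)) : deg G' v = deg G v := by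
  unfold deg
  refine Finset.card_bij (fun b _ => σ b) ?_ ?_ ?_
  · intro b hb
    simpa [h] using hb
  · intro b _ c _ hbc
    exact σ.injective hbc
  · intro c hc
    exact ⟨σ.symm c, by simpa [h] using hc, by simp⟩

lemma Alternates.deg_toggle {n : ℕ} {G : SimpleGraph (Fin n)} {u w p q : Fin n}
    (h : Alternates G u w p q) (hup : u ≠ p) (huq : u ≠ q) (hwp : w ≠ p) (hwq : w ≠ q)
    (huw : u ≠ w) (hpq : p ≠ q) (v : Fin n) : deg (toggle G u w p q) v = deg G v := by
  obtain ⟨h1, h2, h3, h4⟩ := h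
  by_cases hv : v = u ∨ v = w
  · have hne : ∀ {c}, c = p ∨ c = q → v ≠ c := by
      rintro c (rfl | rfl) <;> rcases hv with rfl | rfl <;> assumption
    refine deg_eq_of_equiv (Equiv.swap p q) fun b => ?_
    by_cases hbp : b = p
    · subst hbp
      rw [Equiv.swap_apply_left, toggle_adj_of _ (hne (by simp)) (by simp [IsCross, hv])]
      rcases hv with rfl | rfl <;> tauto
    by_cases hbq : b = q
    · subst hbq
      rw [Equiv.swap_apply_right, toggle_adj_of _ (hne (by simp)) (by simp [IsCross, hv])]
      rcases hv with rfl | rfl <;> tauto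
    · rw [Equiv.swap_apply_of_ne_of_ne hbp hbq, toggle_adj_of_not]
      unfold IsCross
      rcases hv with rfl | rfl <;> tauto
  by_cases hv' : v = p ∨ v = q
  · have hne : ∀ {c}, c = u ∨ c = w → v ≠ c := by
      rintro c (rfl | rfl) <;> rcases hv' with rfl | rfl <;> simp_all [eq_comm]
    refine deg_eq_of_equiv (Equiv.swap u w) fun b => ?_
    have h1' := h1.symm
    have h2' := h2.symm
    rw [G.adj_comm] at h3 h4
    by_cases hbp : b = u
    · subst hbp
      rw [Equiv.swap_apply_left, toggle_adj_of _ (hne (by simp)) (by simp [IsCross, hv'])]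
      rcases hv' with rfl | rfl <;> tauto
    by_cases hbq : b = w
    · subst hbq
      rw [Equiv.swap_apply_right, toggle_adj_of _ (hne (by simp)) (by simp [IsCross, hv'])]
      rcases hv' with rfl | rfl <;> tauto
    · rw [Equiv.swap_apply_of_ne_of_ne hbp hbq, toggle_adj_of_not]
      unfold IsCross
      tauto
  · refine deg_eq_of_equiv (Equiv.refl _) fun b => ?_
    rw [Equiv.refl_apply, toggle_adj_of_not]
    unfold IsCross
    tauto

/-- Double counting over an alternating cycle switching. -/
lemma sum_alternates_eq {n : ℕ} {Ω : Finset (SimpleGraph (Fin n))} {u w p q : Fin n}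
    (hup : u ≠ p) (huq : u ≠ q) (hwp : w ≠ p) (hwq : w ≠ q)
    (h1 : ∀ G ∈ Ω, Alternates G u w p q → toggle G u w p q ∈ Ω)
    (h2 : ∀ G ∈ Ω, Alternates G w u p q → toggle G u w p q ∈ Ω)
    (f g : SimpleGraph (Fin n) → ℝ)
    (hfg : ∀ G ∈ Ω, Alternates G u w p q → f G = g (toggle G u w p q)) :
    ∑ G ∈ Ω, (if Alternates G u w p q then f G else 0) =
      ∑ G ∈ Ω, (if Alternates G w u p q then g G else 0) := by
  rw [← Finset.sum_filter, ← Finset.sum_filter]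
  refine Finset.sum_bij' (fun G _ => toggle G u w p q) (fun G _ => toggle G u w p q)
    ?_ ?_ ?_ ?_ ?_
  · intro G hG
    rw [Finset.mem_filter] at hG ⊢
    exact ⟨h1 G hG.1 hG.2, hG.2.toggle_alternates hup huq hwp hwq⟩
  · intro G hG
    rw [Finset.mem_filter] at hG ⊢
    refine ⟨h2 G hG.1 hG.2, ?_⟩
    rw [← toggle_swap]
    exact hG.2.toggle_alternates hwp hwq hup huq
  · intro G _
    exact toggle_toggle G u w p q
  · intro G _
    exact toggle_toggle G u w p q
  · intro G hG
    rw [Finset.mem_filter] at hG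
    exact hfg G hG.1 hG.2

/-- The number of vertices of `Z` adjacent to `u` but not to `w`. -/
noncomputable def excess {n : ℕ} (Z : Finset (Fin n)) (G : SimpleGraph (Fin n)) (u w : Fin n) :
    ℝ :=
  ∑ q ∈ Z, if G.Adj u q ∧ ¬ G.Adj w q then 1 else 0

/-- The number of vertices of `Z` adjacent to exactly one of `u` and `w`. -/
noncomputable def disc {n : ℕ} (Z : Finset (Fin n)) (G : SimpleGraph (Fin n)) (u w : Fin n) :
    ℝ :=
  ∑ q ∈ Z, if (G.Adj u q ↔ G.Adj w q) then 0 else 1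

lemma disc_nonneg {n : ℕ} (Z : Finset (Fin n)) (G : SimpleGraph (Fin n)) (u w : Fin n) :
    0 ≤ disc Z G u w :=
  Finset.sum_nonneg fun _ _ => by split_ifs <;> norm_num

lemma excess_add_excess {n : ℕ} (Z : Finset (Fin n)) (G : SimpleGraph (Fin n)) (u w : Fin n) :
    excess Z G u w + excess Z G w u = disc Z G u w := by
  unfold excess disc
  rw [← Finset.sum_add_distrib]
  refine Finset.sum_congr rfl fun q _ => ?_
  by_cases h1 : G.Adj u q <;> by_cases h2 : G.Adj w q <;> simp [h1, h2]

/-- `Ω` is closed under the switchings on alternating cycles `u p w q` with `q ∈ Z`. -/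
def SwitchClosed {n : ℕ} (Ω : Finset (SimpleGraph (Fin n))) (u w p : Fin n)
    (Z : Finset (Fin n)) : Prop :=
  ∀ q ∈ Z, ∀ G ∈ Ω, (Alternates G u w p q ∨ Alternates G w u p q) → toggle G u w p q ∈ Ω

lemma disc_toggle {n : ℕ} {Z : Finset (Fin n)} (G : SimpleGraph (Fin n)) {u w p q : Fin n}
    (huZ : u ∉ Z) (hwZ : w ∉ Z) (hpZ : p ∉ Z) (hup : u ≠ p) (hwp : w ≠ p) (hq : q ∈ Z) :
    disc Z (toggle G u w p q) u w = disc Z G u w := by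
  unfold disc
  have huq : u ≠ q := fun h => huZ (h ▸ hq)
  have hwq : w ≠ q := fun h => hwZ (h ▸ hq)
  refine Finset.sum_congr rfl fun v hv => ?_
  have hvp : v ≠ p := fun h => hpZ (h ▸ hv)
  by_cases hvq : v = q
  · subst hvq
    simp only [toggle_adj_of _ huq (show IsCross u w p v u v by simp [IsCross]),
      toggle_adj_of _ hwq (show IsCross u w p v w v by simp [IsCross]), not_iff_not]
  · rw [toggle_adj_of_not _ (by unfold IsCross; tauto),
      toggle_adj_of_not _ (by unfold IsCross; tauto)]

lemma exchange {n : ℕ} {Ω : Finset (SimpleGraph (Fin n))} {u w p : Fin n} {Z : Finset (Fin n)}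
    (hΩ : SwitchClosed Ω u w p Z) (huZ : u ∉ Z) (hwZ : w ∉ Z) (hup : u ≠ p) (hwp : w ≠ p)
    (φ : SimpleGraph (Fin n) → ℝ) (hφ : ∀ q ∈ Z, ∀ G, φ (toggle G u w p q) = φ G) :
    ∑ G ∈ Ω, (if G.Adj u p ∧ ¬ G.Adj w p then excess Z G w u * φ G else 0) =
      ∑ G ∈ Ω, (if G.Adj w p ∧ ¬ G.Adj u p then excess Z G u w * φ G else 0) := by
  have key : ∀ u w : Fin n, ∀ G : SimpleGraph (Fin n),
      (if G.Adj u p ∧ ¬ G.Adj w p then excess Z G w u * φ G else 0) =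
        ∑ q ∈ Z, if Alternates G u w p q then φ G else 0 := by
    intro u w G
    split_ifs with h
    · rw [excess, Finset.sum_mul]
      refine Finset.sum_congr rfl fun q _ => ?_
      by_cases h2 : G.Adj w q <;> by_cases h3 : G.Adj u q <;> simp [Alternates, h, h2, h3]
    · rw [Finset.sum_eq_zero]
      intro q _
      rw [if_neg]
      exact fun h' => h ⟨h'.1, h'.2.2.2⟩
  simp only [key]
  rw [Finset.sum_comm, Finset.sum_comm (s := Ω)]
  refine Finset.sum_congr rfl fun q hq => ?_
  refine sum_alternates_eq hup (fun h => huZ (h ▸ hq)) hwp (fun h => hwZ (h ▸ hq))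
    (fun G hG h => hΩ q hq G hG (Or.inl h)) (fun G hG h => hΩ q hq G hG (Or.inr h)) _ _ ?_
  intro G _ _
  rw [hφ q hq]

lemma near_symm {n : ℕ} {Ω : Finset (SimpleGraph (Fin n))} {u w p : Fin n} {Z : Finset (Fin n)}
    (hΩ : SwitchClosed Ω u w p Z) (huZ : u ∉ Z) (hwZ : w ∉ Z) (hpZ : p ∉ Z)
    (hup : u ≠ p) (hwp : w ≠ p)
    (φ : SimpleGraph (Fin n) → ℝ) (hφ : ∀ q ∈ Z, ∀ G, φ (toggle G u w p q) = φ G)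
    (hφ0 : ∀ G, 0 ≤ φ G) {t D : ℝ} (ht : 0 < t)
    (hD : ∀ G ∈ Ω, |excess Z G u w - excess Z G w u| ≤ D) :
    |∑ G ∈ Ω, (if G.Adj u p ∧ ¬ G.Adj w p then φ G else 0) -
        ∑ G ∈ Ω, (if G.Adj w p ∧ ¬ G.Adj u p then φ G else 0)| ≤
      D / t * (∑ G ∈ Ω, (if G.Adj u p ∧ ¬ G.Adj w p then φ G else 0) +
        ∑ G ∈ Ω, (if G.Adj w p ∧ ¬ G.Adj u p then φ G else 0)) +
      ∑ G ∈ Ω, (if disc Z G u w < t then φ G else 0) := by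
  set ψ : SimpleGraph (Fin n) → ℝ :=
    fun G => if disc Z G u w < t then 0 else φ G / disc Z G u w with hψ
  have hex := exchange hΩ huZ hwZ hup hwp ψ (by
    intro q hq G
    simp only [hψ, disc_toggle G huZ hwZ hpZ hup hwp hq, hφ q hq])
  have h0 : ∑ G ∈ Ω, (if G.Adj u p ∧ ¬ G.Adj w p then φ G else 0) -
        ∑ G ∈ Ω, (if G.Adj w p ∧ ¬ G.Adj u p then φ G else 0) =
      ∑ G ∈ Ω, ((if G.Adj u p ∧ ¬ G.Adj w p then φ G else 0) -
        (if G.Adj w p ∧ ¬ G.Adj u p then φ G else 0) -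
        2 * ((if G.Adj u p ∧ ¬ G.Adj w p then excess Z G w u * ψ G else 0) -
          (if G.Adj w p ∧ ¬ G.Adj u p then excess Z G u w * ψ G else 0))) := by
    simp only [Finset.sum_sub_distrib, ← Finset.mul_sum]
    rw [hex]
    ring
  rw [h0, ← Finset.sum_add_distrib, Finset.mul_sum, ← Finset.sum_add_distrib]
  refine (Finset.abs_sum_le_sum_abs _ _).trans (Finset.sum_le_sum fun G hG => ?_)
  have hφG := hφ0 G
  have hDG := hD G hG
  have hD0 : 0 ≤ D := (abs_nonneg _).trans hDG
  by_cases hbad : disc Z G u w < t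
  · have h1 : ψ G = 0 := by simp [hψ, hbad]
    simp only [h1, mul_zero, ite_self, sub_zero, hbad, if_true]
    have : 0 ≤ D / t := by positivity
    have h2 : 0 ≤ D / t * φ G := by positivity
    by_cases a : G.Adj u p <;> by_cases b : G.Adj w p <;> simp [a, b, abs_of_nonneg hφG, hφG, h2]
  · have hpos : 0 < disc Z G u w := ht.trans_le (not_lt.mp hbad)
    have h1 : ψ G = φ G / disc Z G u w := by simp [hψ, hbad]
    have hsum := excess_add_excess Z G u w
    have hratio : |(excess Z G u w - excess Z G w u) / disc Z G u w| * φ G ≤ D / t * φ G := by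
      refine mul_le_mul_of_nonneg_right ?_ hφG
      rw [abs_div, abs_of_pos hpos]
      exact div_le_div₀ hD0 hDG ht (not_lt.mp hbad)
    have e1 : φ G - 2 * (excess Z G w u * (φ G / disc Z G u w)) =
        (excess Z G u w - excess Z G w u) / disc Z G u w * φ G := by
      field_simp
      rw [← hsum]; ring
    have e2 : -φ G - 2 * (0 - excess Z G u w * (φ G / disc Z G u w)) =
        (excess Z G u w - excess Z G w u) / disc Z G u w * φ G := by
      field_simp
      rw [← hsum]; ring
    simp only [h1, hbad, if_false, add_zero]
    by_cases a : G.Adj u p <;> by_cases b : G.Adj w p <;>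
      simp only [a, b, not_true_eq_false, not_false_eq_true, and_true, and_false, if_true, if_false,
        sub_zero, zero_sub, add_zero, zero_add, mul_zero, abs_zero, le_refl]
    · rw [e1, abs_mul, abs_of_nonneg hφG]; exact hratio
    · rw [zero_sub] at e2
      rw [e2, abs_mul, abs_of_nonneg hφG]; exact hratio

/-- Graphs with degree sequence `d` that agree with `H` inside `X`, except possibly at `jk`. -/
noncomputable def patternSet {n : ℕ} (d : Fin n → ℕ) (X : Finset (Fin n))
    (H : SimpleGraph (Fin n)) (j k : Fin n) : Finset (SimpleGraph (Fin n)) :=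
  Finset.univ.filter fun G => (∀ v, deg G v = d v) ∧
    ∀ a ∈ X, ∀ b ∈ X, ¬(a = j ∧ b = k) → ¬(a = k ∧ b = j) → (G.Adj a b ↔ H.Adj a b)

section pattern

variable {n : ℕ} {d : Fin n → ℕ} {X : Finset (Fin n)} {H : SimpleGraph (Fin n)} {j k : Fin n}

lemma toggle_mem_patternSet {G : SimpleGraph (Fin n)} (hG : G ∈ patternSet d X H j k)
    {u w p q : Fin n} (hup : u ≠ p) (huq : u ≠ q) (hwp : w ≠ p) (hwq : w ≠ q)
    (huw : u ≠ w) (hpq : p ≠ q) (h : Alternates G u w p q ∨ Alternates G w u p q)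
    (hX : ∀ a ∈ X, ∀ b ∈ X, IsCross u w p q a b → (a = j ∧ b = k) ∨ (a = k ∧ b = j)) :
    toggle G u w p q ∈ patternSet d X H j k := by
  rw [patternSet, Finset.mem_filter] at hG ⊢
  refine ⟨Finset.mem_univ _, fun v => ?_, fun a ha b hb h1 h2 => ?_⟩
  · rcases h with h | h
    · rw [h.deg_toggle hup huq hwp hwq huw hpq, hG.2.1]
    · rw [← toggle_swap, h.deg_toggle hwp hwq hup huq huw.symm hpq, hG.2.1]
  · rw [toggle_adj_of_not, hG.2.2 a ha b hb h1 h2]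
    intro hc
    rcases hX a ha b hb hc with h | h
    · exact h1 h
    · exact h2 h

lemma switchClosed_patternSet {u w p : Fin n} {Z : Finset (Fin n)} (hup : u ≠ p) (hwp : w ≠ p)
    (huw : u ≠ w) (huZ : u ∉ Z) (hwZ : w ∉ Z) (hpZ : p ∉ Z)
    (hX : ∀ q ∈ Z, ∀ a ∈ X, ∀ b ∈ X, IsCross u w p q a b →
      (a = j ∧ b = k) ∨ (a = k ∧ b = j)) :
    SwitchClosed (patternSet d X H j k) u w p Z := by
  intro q hq G hG h
  exact toggle_mem_patternSet hG hup (fun h => huZ (h ▸ hq)) hwp (fun h => hwZ (h ▸ hq)) huw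
    (fun h => hpZ (h ▸ hq)) h (hX q hq)

end pattern

lemma sum_eq_add_add_sum_erase {n : ℕ} {Z : Finset (Fin n)} {p q : Fin n} (hp : p ∈ Z)
    (hq : q ∈ Z) (hpq : p ≠ q) (f : Fin n → ℝ) :
    ∑ v ∈ Z, f v = f p + (f q + ∑ v ∈ (Z.erase p).erase q, f v) := by
  rw [Finset.add_sum_erase _ _ (Finset.mem_erase.mpr ⟨hpq.symm, hq⟩), Finset.add_sum_erase _ _ hp]

lemma disc_eq_card {n : ℕ} (Z : Finset (Fin n)) (G : SimpleGraph (Fin n)) (u w : Fin n) :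
    disc Z G u w = ((Z.filter fun q => ¬(G.Adj u q ↔ G.Adj w q)).card : ℝ) := by
  rw [disc, Finset.card_filter]
  push_cast
  refine Finset.sum_congr rfl fun q _ => ?_
  by_cases h : G.Adj u q ↔ G.Adj w q <;> simp [h]

lemma level_decay {α : Type*} (Ω : Finset α) (l : α → ℕ) (s : ℕ)
    (h : ∀ m, m + 2 ≤ 4 * s →
      9 * ((Ω.filter fun x => l x = m).card : ℝ) ≤ (Ω.filter fun x => l x = m + 2).card) :
    9 ^ s * ((Ω.filter fun x => l x ≤ 2 * s).card : ℝ) ≤ (2 * s + 1) * Ω.card := by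
  have step : ∀ i m, m + 2 * i ≤ 4 * s → 9 ^ i * ((Ω.filter fun x => l x = m).card : ℝ) ≤
      (Ω.filter fun x => l x = m + 2 * i).card := by
    intro i
    induction i with
    | zero => intro m _; simp
    | succ i ih =>
      intro m hm
      have h1 := ih m (by omega)
      have h2 := h (m + 2 * i) (by omega)
      rw [show m + 2 * (i + 1) = m + 2 * i + 2 by ring]
      rw [pow_succ]
      linarith
  have h1 : Ω.filter (fun x => l x ≤ 2 * s) =
      (Finset.range (2 * s + 1)).biUnion fun m => Ω.filter fun x => l x = m := by
    ext x
    simp only [Finset.mem_filter, Finset.mem_biUnion, Finset.mem_range]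
    constructor
    · rintro ⟨hx, hl⟩
      exact ⟨l x, by omega, hx, rfl⟩
    · rintro ⟨m, hm, hx, rfl⟩
      exact ⟨hx, by omega⟩
  have h2 : ((Ω.filter fun x => l x ≤ 2 * s).card : ℝ) ≤
      ∑ m ∈ Finset.range (2 * s + 1), ((Ω.filter fun x => l x = m).card : ℝ) := by
    rw [h1]
    exact_mod_cast Finset.card_biUnion_le
  calc 9 ^ s * ((Ω.filter fun x => l x ≤ 2 * s).card : ℝ)
      ≤ 9 ^ s * ∑ m ∈ Finset.range (2 * s + 1), ((Ω.filter fun x => l x = m).card : ℝ) := by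
        gcongr
    _ = ∑ m ∈ Finset.range (2 * s + 1), 9 ^ s * ((Ω.filter fun x => l x = m).card : ℝ) := by
        rw [Finset.mul_sum]
    _ ≤ ∑ m ∈ Finset.range (2 * s + 1), (Ω.card : ℝ) := by
        refine Finset.sum_le_sum fun m hm => ?_
        rw [Finset.mem_range] at hm
        refine (step s m (by omega)).trans ?_
        exact_mod_cast Finset.card_filter_le _ _
    _ = (2 * s + 1) * Ω.card := by simp

lemma Alternates.excess_toggle {n : ℕ} {Z : Finset (Fin n)} {G : SimpleGraph (Fin n)}
    {u w p q : Fin n} (h : Alternates G u w p q) (hp : p ∈ Z) (hq : q ∈ Z) (hpq : p ≠ q)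
    (huZ : u ∉ Z) (hwZ : w ∉ Z) :
    excess Z (toggle G u w p q) u w = excess Z G u w := by
  have hup : u ≠ p := fun h => huZ (h ▸ hp)
  have huq : u ≠ q := fun h => huZ (h ▸ hq)
  have hwp : w ≠ p := fun h => hwZ (h ▸ hp)
  have hwq : w ≠ q := fun h => hwZ (h ▸ hq)
  obtain ⟨a1, a2, a3, a4⟩ := h.toggle_alternates hup huq hwp hwq
  obtain ⟨h1, h2, h3, h4⟩ := h
  have e : ∀ v ∈ (Z.erase p).erase q, ∀ x, x = u ∨ x = w →
      ((toggle G u w p q).Adj x v ↔ G.Adj x v) := by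
    intro v hv x hx
    simp only [Finset.mem_erase] at hv
    refine toggle_adj_of_not _ ?_
    unfold IsCross
    rcases hx with rfl | rfl <;> tauto
  unfold excess
  rw [sum_eq_add_add_sum_erase hp hq hpq, sum_eq_add_add_sum_erase hp hq hpq]
  have hrest : ∀ v ∈ (Z.erase p).erase q,
      (if (toggle G u w p q).Adj u v ∧ ¬ (toggle G u w p q).Adj w v then (1 : ℝ) else 0) =
        if G.Adj u v ∧ ¬ G.Adj w v then 1 else 0 := by
    intro v hv
    simp only [e v hv u (Or.inl rfl), e v hv w (Or.inr rfl)]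
  rw [Finset.sum_congr rfl hrest]
  simp [a1, a2, a3, a4, h1, h2, h3, h4]

lemma Alternates.disc_toggle_add_two {n : ℕ} {Z : Finset (Fin n)} {G : SimpleGraph (Fin n)}
    {u w p q i : Fin n} (h : Alternates G u w p q) (hp : p ∈ Z) (hq : q ∈ Z) (hpq : p ≠ q)
    (huZ : u ∉ Z) (hwZ : w ∉ Z) (hiZ : i ∉ Z) (hiu : i ≠ u) (hiw : i ≠ w)
    (h1 : G.Adj i p) (h2 : ¬ G.Adj i q) :
    disc Z (toggle G u w p q) i u = disc Z G i u + 2 := by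
  have hup : u ≠ p := fun h => huZ (h ▸ hp)
  have huq : u ≠ q := fun h => huZ (h ▸ hq)
  have hwp : w ≠ p := fun h => hwZ (h ▸ hp)
  have hwq : w ≠ q := fun h => hwZ (h ▸ hq)
  have hip : i ≠ p := fun h => hiZ (h ▸ hp)
  have hiq : i ≠ q := fun h => hiZ (h ▸ hq)
  obtain ⟨a1, a2, a3, a4⟩ := h.toggle_alternates hup huq hwp hwq
  obtain ⟨b1, b2, b3, b4⟩ := h
  have ei : ∀ v, (toggle G u w p q).Adj i v ↔ G.Adj i v := by
    intro v
    refine toggle_adj_of_not _ ?_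
    unfold IsCross
    tauto
  have e : ∀ v ∈ (Z.erase p).erase q, ((toggle G u w p q).Adj u v ↔ G.Adj u v) := by
    intro v hv
    simp only [Finset.mem_erase] at hv
    refine toggle_adj_of_not _ ?_
    unfold IsCross
    tauto
  unfold disc
  rw [sum_eq_add_add_sum_erase hp hq hpq, sum_eq_add_add_sum_erase hp hq hpq]
  have hrest : ∀ v ∈ (Z.erase p).erase q,
      (if ((toggle G u w p q).Adj i v ↔ (toggle G u w p q).Adj u v) then (0 : ℝ) else 1) =
        if (G.Adj i v ↔ G.Adj u v) then 0 else 1 := by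
    intro v hv
    simp only [e v hv, ei]
  rw [Finset.sum_congr rfl hrest]
  simp [a2, a4, b1, b3, ei, h1, h2]
  ring

lemma toggle_swap_right {n : ℕ} (G : SimpleGraph (Fin n)) (u w p q : Fin n) :
    toggle G u w q p = toggle G u w p q := by
  ext a b
  simp only [toggle, IsCross, or_comm (a := _ = q)]

lemma alternates_swap_both {n : ℕ} {G : SimpleGraph (Fin n)} {u w p q : Fin n} :
    Alternates G w u q p ↔ Alternates G u w p q := by
  unfold Alternates; tauto

lemma Alternates.excess_toggle' {n : ℕ} {Z : Finset (Fin n)} {G : SimpleGraph (Fin n)}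
    {u w p q : Fin n} (h : Alternates G u w p q) (hp : p ∈ Z) (hq : q ∈ Z) (hpq : p ≠ q)
    (huZ : u ∉ Z) (hwZ : w ∉ Z) :
    excess Z (toggle G u w p q) w u = excess Z G w u := by
  rw [← toggle_swap, ← toggle_swap_right]
  exact (alternates_swap_both.mpr h).excess_toggle hq hp hpq.symm hwZ huZ

/-- Sizes of the level sets of the discrepancy of `i` and `z`. -/
lemma level_step {n : ℕ} {Ω : Finset (SimpleGraph (Fin n))} {Z : Finset (Fin n)}
    {z w i : Fin n} (hzZ : z ∉ Z) (hwZ : w ∉ Z) (hiZ : i ∉ Z) (hiz : i ≠ z) (hiw : i ≠ w)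
    (hΩ : ∀ p ∈ Z, ∀ q ∈ Z, p ≠ q → ∀ G ∈ Ω, (Alternates G z w p q ∨ Alternates G w z p q) →
      toggle G z w p q ∈ Ω)
    {s : ℕ} (h1 : ∀ G ∈ Ω, (16 * s : ℝ) ≤ excess Z G z w)
    (h2 : ∀ G ∈ Ω, (16 * s : ℝ) ≤ excess Z G w z) {m : ℕ} (hm : m + 2 ≤ 4 * s) :
    9 * ((Ω.filter fun G => disc Z G i z = (m : ℝ)).card : ℝ) ≤
      (Ω.filter fun G => disc Z G i z = (m : ℝ) + 2).card := by
  have hs : (0 : ℝ) < s := by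
    have : 0 < s := by omega
    exact_mod_cast this
  have hm' : (m : ℝ) + 2 ≤ 4 * s := by exact_mod_cast hm
  have key : ∑ p ∈ Z, ∑ q ∈ Z, ∑ G ∈ Ω, (if Alternates G z w p q then
        (if G.Adj i p ∧ ¬ G.Adj i q ∧ disc Z G i z = m then (1 : ℝ) else 0) else 0) =
      ∑ p ∈ Z, ∑ q ∈ Z, ∑ G ∈ Ω, (if Alternates G w z p q then
        (if G.Adj i p ∧ ¬ G.Adj i q ∧ disc Z G i z = (m : ℝ) + 2 then (1 : ℝ) else 0) else 0) := by
    refine Finset.sum_congr rfl fun p hp => Finset.sum_congr rfl fun q hq => ?_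
    have hzp : z ≠ p := fun h => hzZ (h ▸ hp)
    have hzq : z ≠ q := fun h => hzZ (h ▸ hq)
    have hwp : w ≠ p := fun h => hwZ (h ▸ hp)
    have hwq : w ≠ q := fun h => hwZ (h ▸ hq)
    have hne : ∀ {G : SimpleGraph (Fin n)} {u v : Fin n}, Alternates G u v p q → p ≠ q := by
      rintro G u v ⟨a, _, b, _⟩ rfl
      exact b a
    refine sum_alternates_eq hzp hzq hwp hwq
      (fun G hG h => hΩ p hp q hq (hne h) G hG (Or.inl h))
      (fun G hG h => hΩ p hp q hq (hne h) G hG (Or.inr h)) _ _ ?_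
    intro G hG h
    have ei : ∀ v, (toggle G z w p q).Adj i v ↔ G.Adj i v := by
      intro v
      refine toggle_adj_of_not _ ?_
      have hip : i ≠ p := fun h => hiZ (h ▸ hp)
      have hiq : i ≠ q := fun h => hiZ (h ▸ hq)
      unfold IsCross
      tauto
    simp only [ei]
    by_cases a1 : G.Adj i p
    · by_cases a2 : G.Adj i q
      · simp [a2]
      · rw [h.disc_toggle_add_two hp hq (hne h) hzZ hwZ hiZ hiz hiw a1 a2]
        simp
    · simp [a1]
  have swap : ∀ F : Fin n → Fin n → SimpleGraph (Fin n) → ℝ,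
      ∑ p ∈ Z, ∑ q ∈ Z, ∑ G ∈ Ω, F p q G = ∑ G ∈ Ω, ∑ p ∈ Z, ∑ q ∈ Z, F p q G := by
    intro F
    rw [Finset.sum_congr rfl fun p _ => Finset.sum_comm, Finset.sum_comm]
  rw [swap, swap] at key
  have fac : ∀ (G : SimpleGraph (Fin n)) (u v : Fin n) (c : ℝ),
      ∑ p ∈ Z, ∑ q ∈ Z, (if Alternates G u v p q then
        (if G.Adj i p ∧ ¬ G.Adj i q ∧ disc Z G i z = c then (1 : ℝ) else 0) else 0) =
      if disc Z G i z = c then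
        (∑ p ∈ Z, if G.Adj u p ∧ ¬ G.Adj v p ∧ G.Adj i p then (1 : ℝ) else 0) *
        (∑ q ∈ Z, if G.Adj v q ∧ ¬ G.Adj u q ∧ ¬ G.Adj i q then (1 : ℝ) else 0) else 0 := by
    intro G u v c
    split_ifs with hc
    · rw [Finset.sum_mul_sum]
      refine Finset.sum_congr rfl fun p hp => Finset.sum_congr rfl fun q hq => ?_
      rw [← ite_and, ite_zero_mul_ite_zero, mul_one]
      refine if_congr ?_ rfl rfl
      unfold Alternates
      constructor
      · rintro ⟨⟨_, _, _, _⟩, _, _, _⟩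
        refine ⟨⟨?_, ?_, ?_⟩, ?_, ?_, ?_⟩ <;> assumption
      · rintro ⟨⟨_, _, _⟩, _, _, _⟩
        refine ⟨⟨?_, ?_, ?_, ?_⟩, ?_, ?_, ?_⟩ <;> assumption
    · refine Finset.sum_eq_zero fun p _ => Finset.sum_eq_zero fun q _ => ?_
      simp [hc]
  simp only [fac] at key
  have hlow : ∑ G ∈ Ω, (if disc Z G i z = (m : ℝ) then (12 * s : ℝ) * (12 * s) else 0) ≤
      ∑ G ∈ Ω, (if disc Z G i z = (m : ℝ) then
        (∑ p ∈ Z, if G.Adj z p ∧ ¬ G.Adj w p ∧ G.Adj i p then (1 : ℝ) else 0) *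
        (∑ q ∈ Z, if G.Adj w q ∧ ¬ G.Adj z q ∧ ¬ G.Adj i q then (1 : ℝ) else 0) else 0) := by
    refine Finset.sum_le_sum fun G hG => ?_
    split_ifs with hc
    · refine mul_le_mul ?_ ?_ (by positivity) (Finset.sum_nonneg fun _ _ => by split_ifs <;> norm_num)
      · have : excess Z G z w ≤ (∑ p ∈ Z, if G.Adj z p ∧ ¬ G.Adj w p ∧ G.Adj i p then (1 : ℝ) else 0)
            + disc Z G i z := by
          unfold excess disc
          rw [← Finset.sum_add_distrib]
          refine Finset.sum_le_sum fun v _ => ?_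
          by_cases a : G.Adj z v <;> by_cases b : G.Adj i v <;> by_cases c : G.Adj w v <;>
            simp [a, b, c]
        have := h1 G hG
        linarith
      · have : excess Z G w z ≤ (∑ q ∈ Z, if G.Adj w q ∧ ¬ G.Adj z q ∧ ¬ G.Adj i q then (1 : ℝ) else 0)
            + disc Z G i z := by
          unfold excess disc
          rw [← Finset.sum_add_distrib]
          refine Finset.sum_le_sum fun v _ => ?_
          by_cases a : G.Adj z v <;> by_cases b : G.Adj i v <;> by_cases c : G.Adj w v <;>
            simp [a, b, c]
        have := h2 G hG
        linarith
    · exact le_rfl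
  have hup : ∑ G ∈ Ω, (if disc Z G i z = (m : ℝ) + 2 then
        (∑ p ∈ Z, if G.Adj w p ∧ ¬ G.Adj z p ∧ G.Adj i p then (1 : ℝ) else 0) *
        (∑ q ∈ Z, if G.Adj z q ∧ ¬ G.Adj w q ∧ ¬ G.Adj i q then (1 : ℝ) else 0) else 0) ≤
      ∑ G ∈ Ω, (if disc Z G i z = (m : ℝ) + 2 then (4 * s : ℝ) * (4 * s) else 0) := by
    refine Finset.sum_le_sum fun G hG => ?_
    split_ifs with hc
    · refine mul_le_mul ?_ ?_ (Finset.sum_nonneg fun _ _ => by split_ifs <;> norm_num)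
        (by positivity)
      · refine le_trans ?_ (hc.le.trans hm')
        unfold disc
        refine Finset.sum_le_sum fun v _ => ?_
        by_cases a : G.Adj z v <;> by_cases b : G.Adj i v <;> by_cases c : G.Adj w v <;>
            simp [a, b, c]
      · refine le_trans ?_ (hc.le.trans hm')
        unfold disc
        refine Finset.sum_le_sum fun v _ => ?_
        by_cases a : G.Adj z v <;> by_cases b : G.Adj i v <;> by_cases c : G.Adj w v <;>
            simp [a, b, c]
    · exact le_rfl
  rw [key] at hlow
  have := hlow.trans hup
  rw [← Finset.sum_filter, ← Finset.sum_filter, Finset.sum_const, Finset.sum_const, nsmul_eq_mul,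
    nsmul_eq_mul] at this
  have hs2 : (0 : ℝ) < s * s := by positivity
  refine le_of_mul_le_mul_right ?_ (show (0 : ℝ) < 16 * (s * s) by positivity)
  linarith

lemma disc_small {n : ℕ} {Ω : Finset (SimpleGraph (Fin n))} {Z : Finset (Fin n)}
    {z w i : Fin n} (hzZ : z ∉ Z) (hwZ : w ∉ Z) (hiZ : i ∉ Z) (hiz : i ≠ z) (hiw : i ≠ w)
    (hΩ : ∀ p ∈ Z, ∀ q ∈ Z, p ≠ q → ∀ G ∈ Ω, (Alternates G z w p q ∨ Alternates G w z p q) →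
      toggle G z w p q ∈ Ω)
    {s : ℕ} (h1 : ∀ G ∈ Ω, (16 * s : ℝ) ≤ excess Z G z w)
    (h2 : ∀ G ∈ Ω, (16 * s : ℝ) ≤ excess Z G w z) :
    9 ^ s * ((Ω.filter fun G => disc Z G i z < 2 * s + 1).card : ℝ) ≤ (2 * s + 1) * Ω.card := by
  have := level_decay Ω (fun G => (Z.filter fun q => ¬(G.Adj i q ↔ G.Adj z q)).card) s (by
    intro m hm
    have := level_step hzZ hwZ hiZ hiz hiw hΩ h1 h2 hm
    simp only [disc_eq_card] at this
    exact_mod_cast this)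
  refine le_trans (le_of_eq ?_) this
  congr 3
  ext G
  simp only [Finset.mem_filter, disc_eq_card]
  norm_cast
  simp only [Nat.lt_succ_iff]

lemma patternSet_disc_small {n : ℕ} {d : Fin n → ℕ} {X : Finset (Fin n)}
    {H : SimpleGraph (Fin n)} {j k i z : Fin n} (hi : i ∈ X) (hz : z ∉ X) {s : ℕ}
    (hw : ∀ G ∈ patternSet d X H j k, ∃ w ∈ Xᶜ.erase z,
      (16 * s : ℝ) ≤ excess ((Xᶜ.erase z).erase w) G z w ∧
      (16 * s : ℝ) ≤ excess ((Xᶜ.erase z).erase w) G w z) :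
    9 ^ s * (((patternSet d X H j k).filter
        fun G => disc (Xᶜ.erase z) G i z < 2 * s + 1).card : ℝ) ≤
      n * (2 * s + 1) * (patternSet d X H j k).card := by
  set Ω := patternSet d X H j k with hΩdef
  have hsub : Ω.filter (fun G => disc (Xᶜ.erase z) G i z < 2 * s + 1) ⊆
      (Xᶜ.erase z).biUnion fun w => (Ω.filter fun G =>
        (16 * s : ℝ) ≤ excess ((Xᶜ.erase z).erase w) G z w ∧
        (16 * s : ℝ) ≤ excess ((Xᶜ.erase z).erase w) G w z).filter
          fun G => disc ((Xᶜ.erase z).erase w) G i z < 2 * s + 1 := by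
    intro G hG
    rw [Finset.mem_filter] at hG
    obtain ⟨w, hwm, hw1, hw2⟩ := hw G hG.1
    simp only [Finset.mem_biUnion, Finset.mem_filter]
    refine ⟨w, hwm, ⟨hG.1, hw1, hw2⟩, lt_of_le_of_lt ?_ hG.2⟩
    exact Finset.sum_le_sum_of_subset_of_nonneg (Finset.erase_subset _ _)
      fun _ _ _ => by split_ifs <;> norm_num
  have hcard : ((Ω.filter fun G => disc (Xᶜ.erase z) G i z < 2 * s + 1).card : ℝ) ≤
      ∑ w ∈ Xᶜ.erase z, (((Ω.filter fun G =>
        (16 * s : ℝ) ≤ excess ((Xᶜ.erase z).erase w) G z w ∧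
        (16 * s : ℝ) ≤ excess ((Xᶜ.erase z).erase w) G w z).filter
          fun G => disc ((Xᶜ.erase z).erase w) G i z < 2 * s + 1).card : ℝ) := by
    rw [← Nat.cast_sum]
    exact Nat.cast_le.mpr ((Finset.card_le_card hsub).trans Finset.card_biUnion_le)
  have hterm : ∀ w ∈ Xᶜ.erase z, 9 ^ s * (((Ω.filter fun G =>
        (16 * s : ℝ) ≤ excess ((Xᶜ.erase z).erase w) G z w ∧
        (16 * s : ℝ) ≤ excess ((Xᶜ.erase z).erase w) G w z).filter
          fun G => disc ((Xᶜ.erase z).erase w) G i z < 2 * s + 1).card : ℝ) ≤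
      (2 * s + 1) * Ω.card := by
    intro w hwm
    have hwX : w ∉ X := by simpa using (Finset.mem_erase.mp hwm).2
    have hwz : w ≠ z := (Finset.mem_erase.mp hwm).1
    have hzZ : z ∉ (Xᶜ.erase z).erase w := by simp
    have hwZ : w ∉ (Xᶜ.erase z).erase w := by simp
    refine (disc_small (z := z) (w := w) (i := i) hzZ hwZ
      (by simp [hi]) (fun h => hz (h ▸ hi)) (fun h => hwX (h ▸ hi)) ?_ ?_ ?_).trans ?_
    · intro p hp q hq hpq G hG h
      have hzp : z ≠ p := fun h => hzZ (h ▸ hp)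
      have hzq : z ≠ q := fun h => hzZ (h ▸ hq)
      have hwp : w ≠ p := fun h => hwZ (h ▸ hp)
      have hwq : w ≠ q := fun h => hwZ (h ▸ hq)
      rw [Finset.mem_filter] at hG ⊢
      refine ⟨toggle_mem_patternSet hG.1 hzp hzq hwp hwq hwz.symm hpq h ?_, ?_⟩
      · intro a ha b hb hc
        exfalso
        rcases hc with ⟨h1 | h1, _⟩ | ⟨h1 | h1, _⟩
        · exact hz (h1 ▸ ha)
        · exact hwX (h1 ▸ ha)
        · exact hz (h1 ▸ hb)
        · exact hwX (h1 ▸ hb)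
      · rcases h with h | h
        · rw [h.excess_toggle hp hq hpq hzZ hwZ, h.excess_toggle' hp hq hpq hzZ hwZ]
          exact hG.2
        · rw [← toggle_swap, h.excess_toggle hp hq hpq hwZ hzZ,
            h.excess_toggle' hp hq hpq hwZ hzZ]
          exact hG.2
    · intro G hG
      exact (Finset.mem_filter.mp hG).2.1
    · intro G hG
      exact (Finset.mem_filter.mp hG).2.2
    · gcongr
      exact Finset.filter_subset _ _
  calc 9 ^ s * ((Ω.filter fun G => disc (Xᶜ.erase z) G i z < 2 * s + 1).card : ℝ)
      ≤ 9 ^ s * _ := by gcongr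
    _ = _ := Finset.mul_sum _ _ _
    _ ≤ ∑ w ∈ Xᶜ.erase z, (2 * s + 1) * (Ω.card : ℝ) := Finset.sum_le_sum hterm
    _ = (Xᶜ.erase z).card * ((2 * s + 1) * (Ω.card : ℝ)) := by
        rw [Finset.sum_const, nsmul_eq_mul]
    _ ≤ n * ((2 * s + 1) * (Ω.card : ℝ)) := by
        gcongr
        exact_mod_cast (Finset.card_le_univ _).trans_eq (Fintype.card_fin n)
    _ = _ := by ring

/-- The number of neighbours of `u` in `Z`. -/
noncomputable def cnt {n : ℕ} (Z : Finset (Fin n)) (G : SimpleGraph (Fin n)) (u : Fin n) : ℝ :=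
  ∑ q ∈ Z, if G.Adj u q then 1 else 0

lemma cnt_nonneg {n : ℕ} (Z : Finset (Fin n)) (G : SimpleGraph (Fin n)) (u : Fin n) :
    0 ≤ cnt Z G u :=
  Finset.sum_nonneg fun _ _ => by split_ifs <;> norm_num

lemma cnt_le_card {n : ℕ} (Z : Finset (Fin n)) (G : SimpleGraph (Fin n)) (u : Fin n) :
    cnt Z G u ≤ Z.card := by
  unfold cnt
  calc _ ≤ ∑ q ∈ Z, (1 : ℝ) := Finset.sum_le_sum fun _ _ => by split_ifs <;> norm_num
    _ = _ := by simp

lemma excess_sub_excess {n : ℕ} (Z : Finset (Fin n)) (G : SimpleGraph (Fin n)) (u w : Fin n) :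
    excess Z G u w - excess Z G w u = cnt Z G u - cnt Z G w := by
  unfold excess cnt
  rw [← Finset.sum_sub_distrib, ← Finset.sum_sub_distrib]
  refine Finset.sum_congr rfl fun q _ => ?_
  by_cases h1 : G.Adj u q <;> by_cases h2 : G.Adj w q <;> simp [h1, h2]

lemma deg_eq_cnt_add_cnt_compl {n : ℕ} (Z : Finset (Fin n)) (G : SimpleGraph (Fin n))
    (u : Fin n) : (deg G u : ℝ) = cnt Z G u + cnt Zᶜ G u := by
  unfold cnt
  rw [Finset.sum_add_sum_compl, deg, Finset.card_filter]
  push_cast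
  rfl

lemma cnt_eq_add_erase {n : ℕ} {Z : Finset (Fin n)} {y : Fin n} (hy : y ∈ Z)
    (G : SimpleGraph (Fin n)) (u : Fin n) :
    cnt Z G u = (if G.Adj u y then 1 else 0) + cnt (Z.erase y) G u := by
  exact (Finset.add_sum_erase _ _ hy).symm

lemma abs_excess_sub_le {n : ℕ} {G : SimpleGraph (Fin n)} {D δ : ℝ}
    (hd : ∀ v, |(deg G v : ℝ) - D| ≤ δ) (Z : Finset (Fin n)) (u w : Fin n) :
    |excess Z G u w - excess Z G w u| ≤ 2 * δ + (Zᶜ).card := by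
  rw [excess_sub_excess]
  have h1 := deg_eq_cnt_add_cnt_compl Z G u
  have h2 := deg_eq_cnt_add_cnt_compl Z G w
  have h3 := abs_le.mp (hd u)
  have h4 := abs_le.mp (hd w)
  have := cnt_nonneg Zᶜ G u
  have := cnt_nonneg Zᶜ G w
  have := cnt_le_card Zᶜ G u
  have := cnt_le_card Zᶜ G w
  rw [abs_le]
  constructor <;> linarith

lemma sum_excess_ge {n : ℕ} {G : SimpleGraph (Fin n)} {D δ : ℝ}
    (hd : ∀ v, |(deg G v : ℝ) - D| ≤ δ) {X : Finset (Fin n)} (z : Fin n) (hz : z ∉ X)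
    (h0 : 0 ≤ (n : ℝ) - 1 - D - (δ + X.card)) :
    (D - (δ + X.card)) * (n - 1 - D - (δ + X.card)) ≤
      ∑ w ∈ Xᶜ.erase z, excess (Xᶜ.erase z) G z w := by
  have hzm : z ∈ Xᶜ := by simpa using hz
  unfold excess
  rw [Finset.sum_comm]
  have hcard : ((Xᶜ.erase z).card : ℝ) = n - X.card - 1 := by
    have h1 := Finset.card_erase_add_one hzm
    have h2 := Finset.card_compl_add_card X
    rw [Fintype.card_fin] at h2
    have h1' : ((Xᶜ.erase z).card : ℝ) + 1 = (Xᶜ.card : ℝ) := by exact_mod_cast h1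
    have h2' : (Xᶜ.card : ℝ) + X.card = n := by exact_mod_cast h2
    linarith
  have hin : ∀ q ∈ Xᶜ.erase z, (if G.Adj z q then (n - 1 - D - (δ + X.card) : ℝ) else 0) ≤
      ∑ w ∈ Xᶜ.erase z, if G.Adj z q ∧ ¬ G.Adj w q then (1 : ℝ) else 0 := by
    intro q _
    split_ifs with h
    · have h1 : ∑ w ∈ Xᶜ.erase z, (if G.Adj z q ∧ ¬ G.Adj w q then (1 : ℝ) else 0) =
          (Xᶜ.erase z).card - cnt (Xᶜ.erase z) G q := by
        unfold cnt
        rw [Finset.card_eq_sum_ones]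
        push_cast
        rw [← Finset.sum_sub_distrib]
        refine Finset.sum_congr rfl fun w _ => ?_
        by_cases h2 : G.Adj w q
        · simp [h2, G.adj_comm q w]
        · simp [h, h2, G.adj_comm q w]
      rw [h1, hcard]
      have h3 := deg_eq_cnt_add_cnt_compl (Xᶜ.erase z) G q
      have h4 := cnt_nonneg (Xᶜ.erase z)ᶜ G q
      have h5 := (abs_le.mp (hd q)).2
      linarith
    · simp [h]
  refine le_trans ?_ (Finset.sum_le_sum hin)
  have h1 : ∑ q ∈ Xᶜ.erase z, (if G.Adj z q then (n - 1 - D - (δ + X.card) : ℝ) else 0) =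
      cnt (Xᶜ.erase z) G z * (n - 1 - D - (δ + X.card)) := by
    unfold cnt
    rw [Finset.sum_mul]
    refine Finset.sum_congr rfl fun w _ => ?_
    split_ifs <;> simp
  rw [h1]
  refine mul_le_mul_of_nonneg_right ?_ h0
  have h3 := deg_eq_cnt_add_cnt_compl X G z
  have h4 := cnt_eq_add_erase hzm G z
  rw [if_neg (G.loopless.irrefl z)] at h4
  have h5 := (abs_le.mp (hd z)).1
  have h6 := cnt_le_card X G z
  linarith

lemma exists_excess {n : ℕ} {G : SimpleGraph (Fin n)} {D δ : ℝ}
    (hd : ∀ v, |(deg G v : ℝ) - D| ≤ δ) {X : Finset (Fin n)} (hX : 2 ≤ X.card)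
    {z : Fin n} (hz : z ∉ X) {s : ℕ}
    (h0 : 0 ≤ (n : ℝ) - 1 - D - (δ + X.card))
    (hs : n * (16 * s + 3 * (δ + X.card)) < (D - (δ + X.card)) * (n - 1 - D - (δ + X.card))) :
    ∃ w ∈ Xᶜ.erase z,
      (16 * s : ℝ) ≤ excess ((Xᶜ.erase z).erase w) G z w ∧
      (16 * s : ℝ) ≤ excess ((Xᶜ.erase z).erase w) G w z := by
  by_contra! hcon
  have hX' : (2 : ℝ) ≤ X.card := by exact_mod_cast hX
  have hδ : 0 ≤ δ := (abs_nonneg _).trans (hd z)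
  have hzm : z ∈ Xᶜ := by simpa using hz
  have hle : ∀ w ∈ Xᶜ.erase z, excess (Xᶜ.erase z) G z w ≤ 16 * s + 3 * (δ + X.card) := by
    intro w hw
    have h1 : excess (Xᶜ.erase z) G z w ≤ 1 + excess ((Xᶜ.erase z).erase w) G z w := by
      unfold excess
      rw [← Finset.add_sum_erase _ _ hw]
      gcongr
      split_ifs <;> norm_num
    have h2 := abs_le.mp (abs_excess_sub_le hd ((Xᶜ.erase z).erase w) z w)
    have h3 : ((((Xᶜ.erase z).erase w)ᶜ).card : ℝ) = X.card + 2 := by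
      have a1 := Finset.card_erase_add_one hzm
      have a2 := Finset.card_compl_add_card X
      have a3 := Finset.card_compl_add_card ((Xᶜ.erase z).erase w)
      have a4 := Finset.card_erase_add_one hw
      exact_mod_cast (show (((Xᶜ.erase z).erase w)ᶜ).card = X.card + 2 by omega)
    rw [h3] at h2
    by_cases h4 : 16 * s ≤ excess ((Xᶜ.erase z).erase w) G z w
    · have := hcon w hw h4
      linarith
    · push Not at h4
      linarith
  have h1 := (sum_excess_ge hd z hz h0).trans (Finset.sum_le_sum hle)
  rw [Finset.sum_const, nsmul_eq_mul] at h1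
  have h2 : ((Xᶜ.erase z).card : ℝ) ≤ n := by
    exact_mod_cast (Finset.card_le_univ _).trans_eq (Fintype.card_fin n)
  have h3 : ((Xᶜ.erase z).card : ℝ) * (16 * s + 3 * (δ + X.card)) ≤
      n * (16 * s + 3 * (δ + X.card)) := by
    gcongr
  linarith

/-- `1 / |S|` if `v ∈ S` and `0` otherwise, where `S` is the set of vertices of `Xᶜ \ {y} ∪ {j}`
adjacent to exactly one of `k` and `y`. -/
noncomputable def shareOf {n : ℕ} (X : Finset (Fin n)) (j k y : Fin n)
    (G : SimpleGraph (Fin n)) (v : Fin n) : ℝ :=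
  (if (G.Adj k v ↔ G.Adj y v) then 0 else 1) / disc (insert j (Xᶜ.erase y)) G k y

lemma shareOf_nonneg {n : ℕ} (X : Finset (Fin n)) (j k y : Fin n)
    (G : SimpleGraph (Fin n)) (v : Fin n) : 0 ≤ shareOf X j k y G v :=
  div_nonneg (by split_ifs <;> norm_num) (disc_nonneg _ _ _ _)

section core

variable {n : ℕ} {d : Fin n → ℕ} {X : Finset (Fin n)} {H : SimpleGraph (Fin n)} {j k : Fin n}

lemma disc_insert {Z : Finset (Fin n)} (hj : j ∉ Z) (G : SimpleGraph (Fin n)) (u w : Fin n) :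
    disc (insert j Z) G u w = (if (G.Adj u j ↔ G.Adj w j) then 0 else 1) + disc Z G u w := by
  unfold disc
  rw [Finset.sum_insert hj]

lemma patternSet_cnt_left (hj : j ∈ X) (hk : k ∈ X) (hjk : j ≠ k) (hH : ¬ H.Adj j k)
    {G : SimpleGraph (Fin n)} (hG : G ∈ patternSet d X H j k) :
    cnt X G k = cnt X H k + if G.Adj k j then 1 else 0 := by
  rw [patternSet, Finset.mem_filter] at hG
  have hH' : ¬ H.Adj k j := fun h => hH h.symm
  rw [cnt_eq_add_erase hj G, cnt_eq_add_erase hj H, if_neg hH', zero_add, add_comm]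
  congr 1
  refine Finset.sum_congr rfl fun q hq => ?_
  rw [Finset.mem_erase] at hq
  have := hG.2.2 k hk q hq.2 (fun h => hjk h.1.symm) (fun h => hq.1 h.2)
  simp only [this]

lemma patternSet_comm : patternSet d X H k j = patternSet d X H j k := by
  unfold patternSet
  congr 1
  ext G
  refine and_congr Iff.rfl ?_
  exact forall₂_congr fun a _ => forall₂_congr fun b _ => ⟨fun h h1 h2 => h h2 h1,
    fun h h1 h2 => h h2 h1⟩

lemma edge_sub_eq_sum_share (hj : j ∈ X) (hk : k ∈ X) (hjk : j ≠ k) (hH : ¬ H.Adj j k)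
    {y : Fin n} (hy : y ∉ X) :
    ∑ G ∈ patternSet d X H j k, (if G.Adj k j then (1 : ℝ) else 0) -
      ∑ G ∈ patternSet d X H j k, (if G.Adj y j then (1 : ℝ) else 0) =
    ∑ G ∈ patternSet d X H j k,
      (((d k : ℝ) - cnt X H k) - d y + cnt ((X.erase j).erase k) G y) * shareOf X j k y G j := by
  have hky : k ≠ y := fun h => hy (h ▸ hk)
  have hjy : j ≠ y := fun h => hy (h ▸ hj)
  have hkZ : k ∉ Xᶜ.erase y := by simp [hk]
  have hjZ : j ∉ Xᶜ.erase y := by simp [hj]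
  have hyZ : y ∉ Xᶜ.erase y := by simp
  have hΩ : SwitchClosed (patternSet d X H j k) k y j (Xᶜ.erase y) := by
    refine switchClosed_patternSet hjk.symm hjy.symm hky hkZ hyZ hjZ ?_
    intro q hq a ha b hb hc
    have hqX : q ∉ X := by simpa using (Finset.mem_erase.mp hq).2
    rcases hc with ⟨rfl | rfl, rfl | rfl⟩ | ⟨rfl | rfl, rfl | rfl⟩ <;> tauto
  have hex := exchange hΩ hkZ hyZ hjk.symm hjy.symm
    (fun G => 1 / (disc (Xᶜ.erase y) G k y + 1)) (by
      intro q hq G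
      simp only [disc_toggle G hkZ hyZ hjZ hjk.symm hjy.symm hq])
  rw [← Finset.sum_sub_distrib, ← sub_eq_zero, ← Finset.sum_sub_distrib]
  rw [← sub_eq_zero, ← Finset.sum_sub_distrib] at hex
  have : ∀ G ∈ patternSet d X H j k,
      ((if G.Adj k j then (1 : ℝ) else 0) - (if G.Adj y j then (1 : ℝ) else 0)) -
      (((d k : ℝ) - cnt X H k) - d y + cnt ((X.erase j).erase k) G y) * shareOf X j k y G j =
      2 * ((if G.Adj k j ∧ ¬ G.Adj y j then
          excess (Xᶜ.erase y) G y k * (1 / (disc (Xᶜ.erase y) G k y + 1)) else 0) -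
        (if G.Adj y j ∧ ¬ G.Adj k j then
          excess (Xᶜ.erase y) G k y * (1 / (disc (Xᶜ.erase y) G k y + 1)) else 0)) := by
    intro G hG
    have h1 := patternSet_cnt_left hj hk hjk hH hG
    rw [patternSet, Finset.mem_filter] at hG
    have hdk := deg_eq_cnt_add_cnt_compl X G k
    have hdy := deg_eq_cnt_add_cnt_compl X G y
    rw [hG.2.1] at hdk hdy
    have hym : y ∈ Xᶜ := by simpa using hy
    have h2 := cnt_eq_add_erase hym G k
    have h3 := cnt_eq_add_erase hym G y
    rw [if_neg (G.loopless.irrefl y)] at h3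
    have h4 := cnt_eq_add_erase hj G y
    have h5 := cnt_eq_add_erase (Finset.mem_erase.mpr ⟨hjk.symm, hk⟩) G y
    have h6 := excess_sub_excess (Xᶜ.erase y) G k y
    have h7 := excess_add_excess (Xᶜ.erase y) G k y
    have h8 := disc_nonneg (Xᶜ.erase y) G k y
    have h9 : (if G.Adj k y then (1 : ℝ) else 0) = if G.Adj y k then 1 else 0 := by
      simp only [G.adj_comm]
    unfold shareOf
    rw [disc_insert hjZ]
    set a := excess (Xᶜ.erase y) G k y
    set b := excess (Xᶜ.erase y) G y k
    set E := disc (Xᶜ.erase y) G k y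
    have hE : (1 : ℝ) + E ≠ 0 := by positivity
    have hE' : E + 1 ≠ 0 := by positivity
    have hΔ : ((d k : ℝ) - cnt X H k) - d y + cnt ((X.erase j).erase k) G y =
        a - b + (if G.Adj k j then (1 : ℝ) else 0) - (if G.Adj y j then (1 : ℝ) else 0) := by
      linarith
    rw [hΔ]
    by_cases c1 : G.Adj k j <;> by_cases c2 : G.Adj y j <;> simp [c1, c2]
    · field_simp
      rw [← h7]
      ring
    · field_simp
      rw [← h7]
      ring
  rw [Finset.sum_congr rfl this, ← Finset.mul_sum, hex, mul_zero]

end core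

section core

variable {n : ℕ} {d : Fin n → ℕ} {X : Finset (Fin n)} {H : SimpleGraph (Fin n)} {j k : Fin n}

lemma abs_sum_sub_le_of_disc {D δ : ℝ} (hd : ∀ v, |(d v : ℝ) - D| ≤ δ) (hX : 2 ≤ X.card)
    (hj : j ∈ X) {s : ℕ} (hs : 0 < s) {B M : ℝ} {y z p : Fin n} (hy : y ∉ X)
    (hz : z ∈ Xᶜ.erase y)
    (hB : ((patternSet d X H j k).filter fun G => disc (Xᶜ.erase z) G j z < 2 * s + 1).card ≤ B)
    (hp : j ≠ p) (hzp : z ≠ p) (hp' : p ∉ (Xᶜ.erase y).erase z)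
    (hcl : SwitchClosed (patternSet d X H j k) j z p ((Xᶜ.erase y).erase z))
    {φ : SimpleGraph (Fin n) → ℝ} (hφ0 : ∀ G, 0 ≤ φ G) (hφM : ∀ G, φ G ≤ M)
    (hφ : ∀ q ∈ (Xᶜ.erase y).erase z, ∀ G, φ (toggle G j z p q) = φ G) :
    |∑ G ∈ patternSet d X H j k, (if G.Adj j p ∧ ¬ G.Adj z p then φ G else 0) -
        ∑ G ∈ patternSet d X H j k, (if G.Adj z p ∧ ¬ G.Adj j p then φ G else 0)| ≤
      (δ + X.card) / s *
        (∑ G ∈ patternSet d X H j k, (if G.Adj j p ∧ ¬ G.Adj z p then φ G else 0) +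
        ∑ G ∈ patternSet d X H j k, (if G.Adj z p ∧ ¬ G.Adj j p then φ G else 0)) + B * M := by
  have hjZ : j ∉ (Xᶜ.erase y).erase z := by simp [hj]
  have hzZ : z ∉ (Xᶜ.erase y).erase z := by simp
  have hX' : (2 : ℝ) ≤ X.card := by exact_mod_cast hX
  have hM : 0 ≤ M := (hφ0 ⊥).trans (hφM ⊥)
  have hym : y ∈ Xᶜ := by simpa using hy
  have hs' : (0 : ℝ) < s := by exact_mod_cast hs
  have hcard : ((((Xᶜ.erase y).erase z)ᶜ).card : ℝ) = X.card + 2 := by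
    have a1 := Finset.card_erase_add_one hym
    have a2 := Finset.card_compl_add_card X
    have a3 := Finset.card_compl_add_card ((Xᶜ.erase y).erase z)
    have a4 := Finset.card_erase_add_one hz
    exact_mod_cast (show (((Xᶜ.erase y).erase z)ᶜ).card = X.card + 2 by omega)
  have h := near_symm hcl hjZ hzZ hp' hp hzp φ hφ hφ0 (t := 2 * s) (D := 2 * (δ + X.card))
    (by positivity) (by
      intro G hG
      rw [patternSet, Finset.mem_filter] at hG
      have := abs_excess_sub_le (G := G) (D := D) (δ := δ)
        (fun v => by rw [hG.2.1]; exact hd v) ((Xᶜ.erase y).erase z) j z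
      rw [hcard] at this
      linarith)
  rw [mul_div_mul_left _ _ (by norm_num)] at h
  refine h.trans (add_le_add le_rfl ?_)
  calc ∑ G ∈ patternSet d X H j k,
        (if disc ((Xᶜ.erase y).erase z) G j z < 2 * (s : ℝ) then φ G else 0)
      ≤ ∑ G ∈ patternSet d X H j k,
        (if disc (Xᶜ.erase z) G j z < 2 * (s : ℝ) + 1 then M else 0) := by
        refine Finset.sum_le_sum fun G _ => ?_
        have hzy : y ∈ Xᶜ.erase z :=
          Finset.mem_erase.mpr ⟨fun h => (Finset.mem_erase.mp hz).1 h.symm, hym⟩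
        have : disc (Xᶜ.erase z) G j z ≤ 1 + disc ((Xᶜ.erase y).erase z) G j z := by
          unfold disc
          rw [← Finset.add_sum_erase _ _ hzy, Finset.erase_right_comm]
          gcongr
          split_ifs <;> norm_num
        split_ifs with h1 h2
        · exact hφM G
        · exact absurd (by linarith) h2
        · exact hM
        · exact le_rfl
    _ = _ * M := by rw [← Finset.sum_filter, Finset.sum_const, nsmul_eq_mul]
    _ ≤ B * M := by gcongr

lemma share_compare {D δ : ℝ} (hd : ∀ v, |(d v : ℝ) - D| ≤ δ) (hX : 2 ≤ X.card)
    (hj : j ∈ X) (hk : k ∈ X) (hjk : j ≠ k) {s : ℕ} (hs : 0 < s) {B M : ℝ} {y z : Fin n}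
    (hy : y ∉ X) (hz : z ∈ Xᶜ.erase y)
    (hB : ((patternSet d X H j k).filter fun G => disc (Xᶜ.erase z) G j z < 2 * s + 1).card ≤ B)
    {Y : SimpleGraph (Fin n) → ℝ} (hY0 : ∀ G, 0 ≤ Y G) (hYM : ∀ G, Y G ≤ M)
    (hYk : ∀ q ∈ (Xᶜ.erase y).erase z, ∀ G, Y (toggle G j z k q) = Y G)
    (hYy : ∀ q ∈ (Xᶜ.erase y).erase z, ∀ G, Y (toggle G j z y q) = Y G) :
    |∑ G ∈ patternSet d X H j k, Y G * shareOf X j k y G j -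
        ∑ G ∈ patternSet d X H j k, Y G * shareOf X j k y G z| ≤
      (δ + X.card) / s * (∑ G ∈ patternSet d X H j k, Y G * shareOf X j k y G j +
        ∑ G ∈ patternSet d X H j k, Y G * shareOf X j k y G z) + 4 * (B * M) := by
  set Z := (Xᶜ.erase y).erase z with hZ
  have hzy : z ≠ y := (Finset.mem_erase.mp hz).1
  have hzX : z ∉ X := by simpa using (Finset.mem_erase.mp hz).2
  have hjy : j ≠ y := fun h => hy (h ▸ hj)
  have hky : k ≠ y := fun h => hy (h ▸ hk)
  have hjz : j ≠ z := fun h => hzX (h ▸ hj)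
  have hkz : k ≠ z := fun h => hzX (h ▸ hk)
  have hkZ : k ∉ Z := by simp [hZ, hk]
  have hyZ : y ∉ Z := by simp [hZ]
  have hjZ : j ∉ Z := by simp [hZ, hj]
  have hzZ : z ∉ Z := by simp [hZ]
  have hZX : ∀ q ∈ Z, q ∉ X := by
    intro q hq
    simpa using (Finset.mem_erase.mp (Finset.mem_erase.mp hq).2).2
  have hδ : 0 ≤ δ := (abs_nonneg _).trans (hd j)
  have hclk : SwitchClosed (patternSet d X H j k) j z k Z := by
    refine switchClosed_patternSet hjk hkz.symm hjz hjZ hzZ hkZ ?_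
    intro q hq a ha b hb hc
    have := hZX q hq
    rcases hc with ⟨rfl | rfl, rfl | rfl⟩ | ⟨rfl | rfl, rfl | rfl⟩ <;> tauto
  have hcly : SwitchClosed (patternSet d X H j k) j z y Z := by
    refine switchClosed_patternSet hjy hzy hjz hjZ hzZ hyZ ?_
    intro q hq a ha b hb hc
    have := hZX q hq
    rcases hc with ⟨rfl | rfl, rfl | rfl⟩ | ⟨rfl | rfl, rfl | rfl⟩ <;> tauto
  have ek : ∀ q ∈ Z, ∀ G : SimpleGraph (Fin n), ∀ v, v ≠ y →
      ((toggle G j z k q).Adj y v ↔ G.Adj y v) := by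
    intro q hq G v hv
    have hqy : q ≠ y := fun h => hyZ (h ▸ hq)
    refine toggle_adj_of_not _ ?_
    rintro (⟨h | h, _⟩ | ⟨_, h | h⟩)
    exacts [hjy h.symm, hzy h.symm, hky h.symm, hqy h.symm]
  have ekk : ∀ q ∈ Z, ∀ G : SimpleGraph (Fin n), ∀ v ∈ Z,
      ((toggle G j z k q).Adj k v ↔ G.Adj k v) := by
    intro q hq G v hv
    have hqk : q ≠ k := fun h => hkZ (h ▸ hq)
    refine toggle_adj_of_not _ ?_
    rintro (⟨h | h, _⟩ | ⟨h | h, _⟩)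
    exacts [hjk h.symm, hkz h, hjZ (h ▸ hv), hzZ (h ▸ hv)]
  have ey : ∀ q ∈ Z, ∀ G : SimpleGraph (Fin n), ∀ v,
      ((toggle G j z y q).Adj k v ↔ G.Adj k v) := by
    intro q hq G v
    have hqk : q ≠ k := fun h => hkZ (h ▸ hq)
    refine toggle_adj_of_not _ ?_
    rintro (⟨h | h, _⟩ | ⟨_, h | h⟩)
    exacts [hjk h.symm, hkz h, hky h, hqk h.symm]
  have eyy : ∀ q ∈ Z, ∀ G : SimpleGraph (Fin n), ∀ v ∈ Z,
      ((toggle G j z y q).Adj y v ↔ G.Adj y v) := by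
    intro q hq G v hv
    refine toggle_adj_of_not _ ?_
    rintro (⟨h | h, _⟩ | ⟨h | h, _⟩)
    exacts [hjy h.symm, hzy h.symm, hjZ (h ▸ hv), hzZ (h ▸ hv)]
  have hσk : ∀ q ∈ Z, ∀ G, disc Z (toggle G j z k q) k y = disc Z G k y := by
    intro q hq G
    refine Finset.sum_congr rfl fun v hv => ?_
    simp only [ekk q hq G v hv, ek q hq G v (fun h => hyZ (h ▸ hv))]
  have hσy : ∀ q ∈ Z, ∀ G, disc Z (toggle G j z y q) k y = disc Z G k y := by
    intro q hq G
    refine Finset.sum_congr rfl fun v hv => ?_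
    simp only [ey q hq G v, eyy q hq G v hv]
  have hbase0 : ∀ G, 0 ≤ Y G / (disc Z G k y + 1) := fun G => by
    have := disc_nonneg Z G k y
    have := hY0 G
    positivity
  have hM : 0 ≤ M := (hY0 ⊥).trans (hYM ⊥)
  have hbaseM : ∀ G, Y G / (disc Z G k y + 1) ≤ M := fun G => by
    have h1 := disc_nonneg Z G k y
    rw [div_le_iff₀ (by linarith)]
    nlinarith [hYM G]
  have main : ∀ (P : SimpleGraph (Fin n) → Prop) [DecidablePred P] (p : Fin n), (p = k ∨ p = y) →
      (∀ q ∈ Z, ∀ G, (P (toggle G j z p q) ↔ P G)) → _ :=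
    fun P _ p hpp hP => abs_sum_sub_le_of_disc hd hX hj hs hy hz hB
      (p := p) (by rcases hpp with rfl | rfl <;> assumption)
      (by rcases hpp with rfl | rfl; exacts [hkz.symm, hzy])
      (by rcases hpp with rfl | rfl <;> assumption)
      (by rcases hpp with rfl | rfl <;> assumption)
      (φ := fun G => if P G then Y G / (disc Z G k y + 1) else 0)
      (fun G => by
        show 0 ≤ ite _ _ _
        split_ifs
        exacts [hbase0 G, le_rfl])
      (fun G => by
        show ite _ _ _ ≤ _
        split_ifs
        exacts [hbaseM G, hM])
      (fun q hq G => by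
        show ite _ _ _ = ite _ _ _
        simp only [hP q hq G]
        rcases hpp with rfl | rfl
        · rw [hYk q hq, hσk q hq]
        · rw [hYy q hq, hσy q hq])
  have A0 := main (fun G => ¬ G.Adj y j ∧ ¬ G.Adj y z) k (Or.inl rfl)
    (fun q hq G => by simp only [ek q hq G j hjy, ek q hq G z hzy])
  have A1 := main (fun G => G.Adj y j ∧ G.Adj y z) k (Or.inl rfl)
    (fun q hq G => by simp only [ek q hq G j hjy, ek q hq G z hzy])
  have B0 := main (fun G => ¬ G.Adj k j ∧ ¬ G.Adj k z) y (Or.inr rfl)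
    (fun q hq G => by simp only [ey q hq G])
  have B1 := main (fun G => G.Adj k j ∧ G.Adj k z) y (Or.inr rfl)
    (fun q hq G => by simp only [ey q hq G])
  have hT : ∀ G, disc (insert j (Xᶜ.erase y)) G k y =
      (if (G.Adj k j ↔ G.Adj y j) then 0 else 1) +
      ((if (G.Adj k z ↔ G.Adj y z) then 0 else 1) + disc Z G k y) := by
    intro G
    rw [disc_insert (by simp [hj])]
    congr 1
    unfold disc
    rw [← Finset.add_sum_erase _ _ hz]
  clear main
  rw [abs_le] at A0 A1 B0 B1
  set Ω := patternSet d X H j k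
  have e1 : ∑ G ∈ Ω, Y G * shareOf X j k y G j - ∑ G ∈ Ω, Y G * shareOf X j k y G z =
      (∑ G ∈ Ω, (if G.Adj j k ∧ ¬ G.Adj z k then
          (if ¬ G.Adj y j ∧ ¬ G.Adj y z then Y G / (disc Z G k y + 1) else 0) else 0) -
        ∑ G ∈ Ω, (if G.Adj z k ∧ ¬ G.Adj j k then
          (if ¬ G.Adj y j ∧ ¬ G.Adj y z then Y G / (disc Z G k y + 1) else 0) else 0)) -
      (∑ G ∈ Ω, (if G.Adj j k ∧ ¬ G.Adj z k then
          (if G.Adj y j ∧ G.Adj y z then Y G / (disc Z G k y + 1) else 0) else 0) -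
        ∑ G ∈ Ω, (if G.Adj z k ∧ ¬ G.Adj j k then
          (if G.Adj y j ∧ G.Adj y z then Y G / (disc Z G k y + 1) else 0) else 0)) +
      (∑ G ∈ Ω, (if G.Adj j y ∧ ¬ G.Adj z y then
          (if ¬ G.Adj k j ∧ ¬ G.Adj k z then Y G / (disc Z G k y + 1) else 0) else 0) -
        ∑ G ∈ Ω, (if G.Adj z y ∧ ¬ G.Adj j y then
          (if ¬ G.Adj k j ∧ ¬ G.Adj k z then Y G / (disc Z G k y + 1) else 0) else 0)) -
      (∑ G ∈ Ω, (if G.Adj j y ∧ ¬ G.Adj z y then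
          (if G.Adj k j ∧ G.Adj k z then Y G / (disc Z G k y + 1) else 0) else 0) -
        ∑ G ∈ Ω, (if G.Adj z y ∧ ¬ G.Adj j y then
          (if G.Adj k j ∧ G.Adj k z then Y G / (disc Z G k y + 1) else 0) else 0)) := by
    simp only [← Finset.sum_sub_distrib, ← Finset.sum_add_distrib]
    refine Finset.sum_congr rfl fun G _ => ?_
    rw [shareOf, shareOf, hT, G.adj_comm j k, G.adj_comm z k, G.adj_comm j y, G.adj_comm z y]
    by_cases c1 : G.Adj k j <;> by_cases c2 : G.Adj y j <;> by_cases c3 : G.Adj k z <;>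
      by_cases c4 : G.Adj y z <;> simp [c1, c2, c3, c4, div_eq_mul_inv, add_comm]
  have e2 : 
      (∑ G ∈ Ω, (if G.Adj j k ∧ ¬ G.Adj z k then
          (if ¬ G.Adj y j ∧ ¬ G.Adj y z then Y G / (disc Z G k y + 1) else 0) else 0) +
        ∑ G ∈ Ω, (if G.Adj z k ∧ ¬ G.Adj j k then
          (if ¬ G.Adj y j ∧ ¬ G.Adj y z then Y G / (disc Z G k y + 1) else 0) else 0)) +
      (∑ G ∈ Ω, (if G.Adj j k ∧ ¬ G.Adj z k then
          (if G.Adj y j ∧ G.Adj y z then Y G / (disc Z G k y + 1) else 0) else 0) +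
        ∑ G ∈ Ω, (if G.Adj z k ∧ ¬ G.Adj j k then
          (if G.Adj y j ∧ G.Adj y z then Y G / (disc Z G k y + 1) else 0) else 0)) +
      (∑ G ∈ Ω, (if G.Adj j y ∧ ¬ G.Adj z y then
          (if ¬ G.Adj k j ∧ ¬ G.Adj k z then Y G / (disc Z G k y + 1) else 0) else 0) +
        ∑ G ∈ Ω, (if G.Adj z y ∧ ¬ G.Adj j y then
          (if ¬ G.Adj k j ∧ ¬ G.Adj k z then Y G / (disc Z G k y + 1) else 0) else 0)) +
      (∑ G ∈ Ω, (if G.Adj j y ∧ ¬ G.Adj z y then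
          (if G.Adj k j ∧ G.Adj k z then Y G / (disc Z G k y + 1) else 0) else 0) +
        ∑ G ∈ Ω, (if G.Adj z y ∧ ¬ G.Adj j y then
          (if G.Adj k j ∧ G.Adj k z then Y G / (disc Z G k y + 1) else 0) else 0)) ≤
      ∑ G ∈ Ω, Y G * shareOf X j k y G j + ∑ G ∈ Ω, Y G * shareOf X j k y G z := by
    simp only [← Finset.sum_add_distrib]
    refine Finset.sum_le_sum fun G _ => ?_
    have h1 := mul_nonneg (hY0 G) (shareOf_nonneg X j k y G j)
    have h2 := mul_nonneg (hY0 G) (shareOf_nonneg X j k y G z)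
    have h3 := add_nonneg h1 h2
    revert h3
    rw [shareOf, shareOf, hT, G.adj_comm j k, G.adj_comm z k, G.adj_comm j y, G.adj_comm z y]
    by_cases c1 : G.Adj k j <;> by_cases c2 : G.Adj y j <;> by_cases c3 : G.Adj k z <;>
      by_cases c4 : G.Adj y z <;> simp [c1, c2, c3, c4, div_eq_mul_inv, add_comm]
  have hκ : 0 ≤ (δ + X.card) / s := by positivity
  have e3 := mul_le_mul_of_nonneg_left e2 hκ
  rw [e1, abs_le]
  simp only [mul_add] at e3 A0 A1 B0 B1 ⊢
  constructor <;> linarith [A0.1, A0.2, A1.1, A1.2, B0.1, B0.2, B1.1, B1.2]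

end core

section core

variable {n : ℕ} {d : Fin n → ℕ} {X : Finset (Fin n)} {H : SimpleGraph (Fin n)} {j k : Fin n}

lemma share_average {D δ : ℝ} (hd : ∀ v, |(d v : ℝ) - D| ≤ δ) (hX : 2 ≤ X.card)
    (hj : j ∈ X) (hk : k ∈ X) (hjk : j ≠ k) {s : ℕ} (hs : 0 < s) {B M : ℝ} {y : Fin n}
    (hy : y ∉ X) (hκ : 2 * (δ + X.card) ≤ s)
    (hB : ∀ i ∈ X, ∀ z ∉ X,
      ((patternSet d X H j k).filter fun G => disc (Xᶜ.erase z) G i z < 2 * s + 1).card ≤ B)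
    {Y : SimpleGraph (Fin n) → ℝ} (hY0 : ∀ G, 0 ≤ Y G) (hYM : ∀ G, Y G ≤ M)
    (hYk : ∀ z ∈ Xᶜ.erase y, ∀ q ∈ (Xᶜ.erase y).erase z, ∀ G, Y (toggle G j z k q) = Y G)
    (hYy : ∀ z ∈ Xᶜ.erase y, ∀ q ∈ (Xᶜ.erase y).erase z, ∀ G, Y (toggle G j z y q) = Y G) :
    |Xᶜ.card * ∑ G ∈ patternSet d X H j k, Y G * shareOf X j k y G j -
        ∑ G ∈ patternSet d X H j k, Y G| ≤
      4 * ((δ + X.card) / s) * (∑ G ∈ patternSet d X H j k, Y G) + 10 * (n * (B * M)) := by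
  set Ω := patternSet d X H j k with hΩ
  set Z := Xᶜ.erase y with hZ
  set κ := (δ + X.card) / s with hκdef
  have hs' : (0 : ℝ) < s := by exact_mod_cast hs
  have hδ : 0 ≤ δ := (abs_nonneg _).trans (hd j)
  have hκ0 : 0 ≤ κ := by positivity
  have hκ1 : κ ≤ 1 / 2 := by
    rw [hκdef, div_le_iff₀ hs']
    linarith
  have hM : 0 ≤ M := (hY0 ⊥).trans (hYM ⊥)
  have hB0 : 0 ≤ B := le_trans (Nat.cast_nonneg _) (hB j hj y hy)
  have hjZ : j ∉ Z := by simp [hZ, hj]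
  have hym : y ∈ Xᶜ := by simpa using hy
  have hcard : (Xᶜ.card : ℝ) = Z.card + 1 := by
    have := Finset.card_erase_add_one hym
    exact_mod_cast this.symm
  have hn : (1 : ℝ) ≤ n := by exact_mod_cast (Nat.succ_le_of_lt (Fin.pos j))
  have hZn : (Z.card : ℝ) ≤ n := by
    exact_mod_cast (Finset.card_le_univ _).trans_eq (Fintype.card_fin n)
  set E : Fin n → ℝ := fun v => ∑ G ∈ Ω, Y G * shareOf X j k y G v with hE
  have hcmp : ∀ z ∈ Z, |E j - E z| ≤ κ * (E j + E z) + 4 * (B * M) := fun z hz =>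
    share_compare hd hX hj hk hjk hs hy hz
      (hB j hj z (by simpa using (Finset.mem_erase.mp hz).2)) hY0 hYM (hYk z hz) (hYy z hz)
  have htot : ∀ G, ∑ v ∈ insert j Z, shareOf X j k y G v =
      if disc (insert j Z) G k y = 0 then 0 else 1 := by
    intro G
    unfold shareOf
    rw [← Finset.sum_div]
    split_ifs with h
    · rw [h, div_zero]
    · exact div_self h
  have hS : E j + ∑ z ∈ Z, E z = ∑ G ∈ Ω, Y G * (if disc (insert j Z) G k y = 0 then 0 else 1) := by
    rw [← Finset.sum_insert hjZ, hE, Finset.sum_comm]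
    refine Finset.sum_congr rfl fun G _ => ?_
    rw [← Finset.mul_sum, htot]
  have hSle : E j + ∑ z ∈ Z, E z ≤ ∑ G ∈ Ω, Y G := by
    rw [hS]
    refine Finset.sum_le_sum fun G _ => ?_
    split_ifs
    · simpa using hY0 G
    · simp
  have hSge : ∑ G ∈ Ω, Y G - B * M ≤ E j + ∑ z ∈ Z, E z := by
    rw [hS, sub_le_iff_le_add]
    calc ∑ G ∈ Ω, Y G ≤ ∑ G ∈ Ω, (Y G * (if disc (insert j Z) G k y = 0 then 0 else 1) +
          if disc Z G k y < 2 * s + 1 then M else 0) := by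
          refine Finset.sum_le_sum fun G _ => ?_
          split_ifs with h1 h2
          · simpa using hYM G
          · exfalso
            rw [disc_insert hjZ] at h1
            have : (0 : ℝ) ≤ if (G.Adj k j ↔ G.Adj y j) then 0 else 1 := by
              split_ifs <;> norm_num
            linarith
          · simpa using hM
          · simp
      _ = _ + _ * M := by
          rw [Finset.sum_add_distrib]
          congr 1
          rw [← Finset.sum_filter, Finset.sum_const, nsmul_eq_mul]
      _ ≤ _ := by
          gcongr
          exact hB k hk y hy
  have hdiff : |Xᶜ.card * E j - (E j + ∑ z ∈ Z, E z)| ≤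
      κ * (Xᶜ.card * E j + (E j + ∑ z ∈ Z, E z)) + 4 * (n * (B * M)) := by
    have h1 : Xᶜ.card * E j - (E j + ∑ z ∈ Z, E z) = ∑ z ∈ Z, (E j - E z) := by
      rw [Finset.sum_sub_distrib, Finset.sum_const, nsmul_eq_mul, hcard]
      ring
    rw [h1]
    refine (Finset.abs_sum_le_sum_abs _ _).trans ((Finset.sum_le_sum hcmp).trans ?_)
    rw [Finset.sum_add_distrib, ← Finset.mul_sum, Finset.sum_add_distrib, Finset.sum_const,
      Finset.sum_const, nsmul_eq_mul, nsmul_eq_mul, hcard]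
    have hEj : 0 ≤ E j := Finset.sum_nonneg fun G _ =>
      mul_nonneg (hY0 G) (shareOf_nonneg X j k y G j)
    have : (Z.card : ℝ) * (4 * (B * M)) ≤ 4 * (n * (B * M)) := by
      have : (Z.card : ℝ) * (B * M) ≤ n * (B * M) := by gcongr
      linarith
    nlinarith [mul_nonneg hκ0 hEj]
  change |Xᶜ.card * E j - ∑ G ∈ Ω, Y G| ≤ _
  set A := Xᶜ.card * E j
  set e := ∑ G ∈ Ω, Y G
  set S := E j + ∑ z ∈ Z, E z
  have hBM : B * M ≤ n * (B * M) := by nlinarith [mul_nonneg hB0 hM]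
  set β := n * (B * M)
  have hβ : 0 ≤ β := by positivity
  have hA0 : 0 ≤ A := mul_nonneg (Nat.cast_nonneg _) (Finset.sum_nonneg fun G _ =>
      mul_nonneg (hY0 G) (shareOf_nonneg X j k y G j))
  have he0 : 0 ≤ e := Finset.sum_nonneg fun G _ => hY0 G
  rw [abs_le] at hdiff
  have hκS : κ * S ≤ κ * e := by gcongr
  have hd1 : A - e ≤ κ * (A + e) + 4 * β := by nlinarith [hdiff.2]
  have hd2 : e - A ≤ κ * (A + e) + 5 * β := by nlinarith [hdiff.1]
  have hA : A ≤ 3 * e + 8 * β := by nlinarith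
  have hκA : κ * A ≤ κ * (3 * e) + 4 * β := by nlinarith
  rw [abs_le]
  constructor <;> nlinarith

end core

section core

variable {n : ℕ} {d : Fin n → ℕ} {X : Finset (Fin n)} {H : SimpleGraph (Fin n)} {j k : Fin n}

lemma patternSet_cnt_other {i : Fin n} (hi : i ∈ (X.erase j).erase k)
    {G : SimpleGraph (Fin n)} (hG : G ∈ patternSet d X H j k) : cnt X G i = cnt X H i := by
  rw [patternSet, Finset.mem_filter] at hG
  simp only [Finset.mem_erase] at hi
  refine Finset.sum_congr rfl fun q hq => ?_
  have := hG.2.2 i hi.2.2 q hq (fun h => hi.2.1 h.1) (fun h => hi.1 h.1)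
  simp only [this]

lemma sum_cnt_compl_left (hj : j ∈ X) (hk : k ∈ X) (hjk : j ≠ k) (hH : ¬ H.Adj j k) :
    ∑ y ∈ Xᶜ, ∑ G ∈ patternSet d X H j k, (if G.Adj y j then (1 : ℝ) else 0) =
      ((d j : ℝ) - cnt X H j) * (patternSet d X H j k).card -
        ∑ G ∈ patternSet d X H j k, (if G.Adj k j then (1 : ℝ) else 0) := by
  rw [Finset.sum_comm, mul_comm, ← nsmul_eq_mul, ← Finset.sum_const, ← Finset.sum_sub_distrib]
  refine Finset.sum_congr rfl fun G hG => ?_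
  have hG' : G ∈ patternSet d X H k j := by rwa [patternSet_comm]
  have h1 := patternSet_cnt_left hk hj hjk.symm (fun h => hH h.symm) hG'
  rw [patternSet, Finset.mem_filter] at hG
  have h2 := deg_eq_cnt_add_cnt_compl X G j
  rw [hG.2.1] at h2
  have h3 : ∑ y ∈ Xᶜ, (if G.Adj y j then (1 : ℝ) else 0) = cnt Xᶜ G j := by
    simp only [cnt, G.adj_comm]
  rw [h3, G.adj_comm k j]
  linarith

lemma sum_cnt_compl_other :
    ∑ y ∈ Xᶜ, ∑ G ∈ patternSet d X H j k, cnt ((X.erase j).erase k) G y =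
      (∑ i ∈ (X.erase j).erase k, ((d i : ℝ) - cnt X H i)) * (patternSet d X H j k).card := by
  rw [Finset.sum_comm, mul_comm, ← nsmul_eq_mul, ← Finset.sum_const]
  refine Finset.sum_congr rfl fun G hG => ?_
  unfold cnt
  rw [Finset.sum_comm]
  refine Finset.sum_congr rfl fun i hi => ?_
  have h1 := patternSet_cnt_other hi hG
  rw [patternSet, Finset.mem_filter] at hG
  have h2 := deg_eq_cnt_add_cnt_compl X G i
  rw [hG.2.1] at h2
  have h3 : ∑ y ∈ Xᶜ, (if G.Adj y i then (1 : ℝ) else 0) = cnt Xᶜ G i := by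
    simp only [cnt, G.adj_comm]
  rw [h3]
  change _ = _ - cnt X H i
  linarith

lemma edge_estimate_of_bad {D δ : ℝ} (hd : ∀ v, |(d v : ℝ) - D| ≤ δ) (hX : 2 ≤ X.card)
    (hj : j ∈ X) (hk : k ∈ X) (hjk : j ≠ k) (hH : ¬ H.Adj j k) {s : ℕ} (hs : 0 < s) {B : ℝ}
    (hκ : 2 * (δ + X.card) ≤ s) (hHk : cnt X H k ≤ X.card)
    (hB : ∀ i ∈ X, ∀ z ∉ X,
      ((patternSet d X H j k).filter fun G => disc (Xᶜ.erase z) G i z < 2 * s + 1).card ≤ B) :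
    |(Xᶜ.card : ℝ) * ((Xᶜ.card + 1) *
          (∑ G ∈ patternSet d X H j k, if G.Adj k j then (1 : ℝ) else 0) -
          ((d j : ℝ) - cnt X H j) * (patternSet d X H j k).card) -
        (Xᶜ.card * ((d k : ℝ) - cnt X H k) - ∑ v ∈ Xᶜ, (d v : ℝ) +
          ∑ i ∈ (X.erase j).erase k, ((d i : ℝ) - cnt X H i)) * (patternSet d X H j k).card| ≤
      Xᶜ.card * (2 * (δ + X.card) *
        (4 * ((δ + X.card) / s) * (patternSet d X H j k).card + 10 * (n * B))) := by
  set Ω := patternSet d X H j k with hΩ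
  set N : ℝ := (Xᶜ.card : ℝ)
  set κ := (δ + X.card) / s with hκdef
  set Pi := ∑ G ∈ Ω, if G.Adj k j then (1 : ℝ) else 0 with hPi
  have hδ : 0 ≤ δ := (abs_nonneg _).trans (hd j)
  have hκ0 : 0 ≤ κ := by positivity
  set c := (d k : ℝ) - cnt X H k with hc
  set E1 : Fin n → ℝ := fun y => ∑ G ∈ Ω, 1 * shareOf X j k y G j with hE1
  set EZ : Fin n → ℝ := fun y => ∑ G ∈ Ω, cnt ((X.erase j).erase k) G y * shareOf X j k y G j
    with hEZ
  have hid : ∀ y ∈ Xᶜ, Pi - ∑ G ∈ Ω, (if G.Adj y j then (1 : ℝ) else 0) =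
      (c - d y) * E1 y + EZ y := by
    intro y hy
    rw [hPi, edge_sub_eq_sum_share hj hk hjk hH (by simpa using hy), hE1, hEZ]
    simp only
    rw [Finset.mul_sum, ← Finset.sum_add_distrib]
    refine Finset.sum_congr rfl fun G _ => ?_
    rw [← hc]
    ring
  have hsum : N * Pi - (((d j : ℝ) - cnt X H j) * Ω.card - Pi) =
      ∑ y ∈ Xᶜ, ((c - d y) * E1 y + EZ y) := by
    rw [← Finset.sum_congr rfl hid, Finset.sum_sub_distrib, sum_cnt_compl_left hj hk hjk hH,
      Finset.sum_const, nsmul_eq_mul]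
  have hr : ((X.erase j).erase k).card ≤ (X.card : ℝ) := by
    exact_mod_cast (Finset.card_le_card ((Finset.erase_subset _ _).trans (Finset.erase_subset _ _)))
  have htog : ∀ y ∉ X, ∀ z ∈ Xᶜ.erase y, ∀ p, p = k ∨ p = y → ∀ q ∈ (Xᶜ.erase y).erase z,
      ∀ G : SimpleGraph (Fin n), cnt ((X.erase j).erase k) (toggle G j z p q) y =
        cnt ((X.erase j).erase k) G y := by
    intro y hy z hz p hp q hq G
    have hzX : z ∉ X := by simpa using (Finset.mem_erase.mp hz).2
    have hqX : q ∉ X := by simpa using (Finset.mem_erase.mp (Finset.mem_erase.mp hq).2).2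
    refine Finset.sum_congr rfl fun i hi => ?_
    simp only [Finset.mem_erase] at hi
    have : (toggle G j z p q).Adj y i ↔ G.Adj y i := by
      refine toggle_adj_of_not _ ?_
      rintro (⟨_, h | h⟩ | ⟨h | h, _⟩)
      · rcases hp with hp | hp
        · exact hi.1 (h.trans hp)
        · exact hy (hp ▸ h ▸ hi.2.2)
      · exact hqX (h ▸ hi.2.2)
      · exact hi.2.1 h
      · exact hzX (h ▸ hi.2.2)
    simp only [this]
  have b1 : ∀ y ∈ Xᶜ, |N * E1 y - Ω.card| ≤ 4 * κ * Ω.card + 10 * (n * B) := by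
    intro y hy
    have := share_average (Y := fun _ => 1) (M := 1) hd hX hj hk hjk hs (by simpa using hy) hκ hB
      (fun _ => zero_le_one) (fun _ => le_rfl) (fun _ _ _ _ _ => rfl) (fun _ _ _ _ _ => rfl)
    simpa [hE1] using this
  have b2 : ∀ y ∈ Xᶜ, |N * EZ y - ∑ G ∈ Ω, cnt ((X.erase j).erase k) G y| ≤
      4 * κ * (X.card * Ω.card) + 10 * (n * (B * X.card)) := by
    intro y hy
    have hy' : y ∉ X := by simpa using hy
    have := share_average (Y := fun G => cnt ((X.erase j).erase k) G y) (M := X.card)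
      hd hX hj hk hjk hs hy' hκ hB
      (fun _ => cnt_nonneg _ _ _) (fun G => (cnt_le_card _ G y).trans hr)
      (fun z hz q hq G => htog y hy' z hz k (Or.inl rfl) q hq G)
      (fun z hz q hq G => htog y hy' z hz y (Or.inr rfl) q hq G)
    refine this.trans ?_
    have h1 : ∑ G ∈ Ω, cnt ((X.erase j).erase k) G y ≤ X.card * Ω.card := by
      calc _ ≤ ∑ G ∈ Ω, (X.card : ℝ) := Finset.sum_le_sum fun G _ => (cnt_le_card _ G y).trans hr
        _ = _ := by rw [Finset.sum_const, nsmul_eq_mul, mul_comm]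
    gcongr
  have b3 : ∀ y, |c - d y| ≤ 2 * δ + X.card := by
    intro y
    have h1 := abs_le.mp (hd k)
    have h2 := abs_le.mp (hd y)
    have h3 := cnt_nonneg X H k
    rw [abs_le]
    constructor <;> linarith
  have hfin : N * ((N + 1) * Pi - ((d j : ℝ) - cnt X H j) * Ω.card) -
        (N * c - ∑ v ∈ Xᶜ, (d v : ℝ) +
          ∑ i ∈ (X.erase j).erase k, ((d i : ℝ) - cnt X H i)) * Ω.card =
      ∑ y ∈ Xᶜ, ((c - d y) * (N * E1 y - Ω.card) +
        (N * EZ y - ∑ G ∈ Ω, cnt ((X.erase j).erase k) G y)) := by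
    have h1 : ∑ y ∈ Xᶜ, ((c - d y) * (N * E1 y - Ω.card) +
        (N * EZ y - ∑ G ∈ Ω, cnt ((X.erase j).erase k) G y)) =
      N * ∑ y ∈ Xᶜ, ((c - d y) * E1 y + EZ y) - (∑ y ∈ Xᶜ, (c - d y)) * Ω.card -
        ∑ y ∈ Xᶜ, ∑ G ∈ Ω, cnt ((X.erase j).erase k) G y := by
      rw [Finset.mul_sum, Finset.sum_mul, ← Finset.sum_sub_distrib, ← Finset.sum_sub_distrib]
      refine Finset.sum_congr rfl fun y _ => ?_
      ring
    have h2 : ∑ y ∈ Xᶜ, (c - (d y : ℝ)) = N * c - ∑ v ∈ Xᶜ, (d v : ℝ) := by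
      rw [Finset.sum_sub_distrib, Finset.sum_const, nsmul_eq_mul]
    rw [h1, ← hsum, sum_cnt_compl_other, h2]
    ring
  rw [hfin]
  calc _ ≤ ∑ y ∈ Xᶜ, (2 * (δ + X.card) * (4 * κ * Ω.card + 10 * (n * B))) := by
        refine (Finset.abs_sum_le_sum_abs _ _).trans (Finset.sum_le_sum fun y hy => ?_)
        refine (abs_add_le _ _).trans ?_
        rw [abs_mul]
        have h1 := mul_le_mul (b3 y) (b1 y hy) (abs_nonneg _) (by positivity)
        have h2 := b2 y hy
        nlinarith
    _ = _ := by rw [Finset.sum_const, nsmul_eq_mul]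

lemma edge_estimate {D δ : ℝ} (hd : ∀ v, |(d v : ℝ) - D| ≤ δ) (hX : 2 ≤ X.card)
    (hj : j ∈ X) (hk : k ∈ X) (hjk : j ≠ k) (hH : ¬ H.Adj j k) {s : ℕ} (hs : 0 < s)
    (hκ : 2 * (δ + X.card) ≤ s) (h0 : 0 ≤ (n : ℝ) - 1 - D - (δ + X.card))
    (hsn : n * (16 * s + 3 * (δ + X.card)) <
      (D - (δ + X.card)) * (n - 1 - D - (δ + X.card))) :
    |(Xᶜ.card : ℝ) * ((Xᶜ.card + 1) *
          (∑ G ∈ patternSet d X H j k, if G.Adj k j then (1 : ℝ) else 0) -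
          ((d j : ℝ) - cnt X H j) * (patternSet d X H j k).card) -
        (Xᶜ.card * ((d k : ℝ) - cnt X H k) - ∑ v ∈ Xᶜ, (d v : ℝ) +
          ∑ i ∈ (X.erase j).erase k, ((d i : ℝ) - cnt X H i)) * (patternSet d X H j k).card| ≤
      Xᶜ.card * (2 * (δ + X.card) *
        (4 * ((δ + X.card) / s) + 10 * (n ^ 2 * (2 * s + 1) / 9 ^ s))) *
          (patternSet d X H j k).card := by
  have := edge_estimate_of_bad (d := d) (H := H)
    (B := n * (2 * s + 1) / 9 ^ s * (patternSet d X H j k).card)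
    hd hX hj hk hjk hH hs hκ (cnt_le_card _ _ _) (by
      intro i hi z hz
      have h1 := patternSet_disc_small (d := d) (H := H) (j := j) (k := k) hi hz (s := s) (by
        intro G hG
        rw [patternSet, Finset.mem_filter] at hG
        exact exists_excess (D := D) (δ := δ) (fun v => by rw [hG.2.1]; exact hd v) hX hz h0 hsn)
      rw [div_mul_eq_mul_div, le_div_iff₀ (by positivity)]
      linarith)
  refine this.trans (le_of_eq ?_)
  ring

end core

/-- The number of graphs with degree sequence `d` inducing `H` along `φ`. -/
noncomputable def inducedCount {n r : ℕ} (d : Fin n → ℕ) (φ : Fin r ↪ Fin n)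
    (H : SimpleGraph (Fin r)) : ℝ :=
  ((degFinset n d).filter fun G => G.comap φ = H).card

section embed

variable {n r : ℕ} {d : Fin n → ℕ} {φ : Fin r ↪ Fin n} {H : SimpleGraph (Fin r)} {a b : Fin r}

lemma comap_eq_or_iff (hab : a ≠ b) (hH : ¬ H.Adj a b) {G : SimpleGraph (Fin n)} :
    (∀ x y, ¬(x = a ∧ y = b) → ¬(x = b ∧ y = a) → (G.Adj (φ x) (φ y) ↔ H.Adj x y)) ↔
      (G.comap φ = H ∧ ¬ G.Adj (φ b) (φ a)) ∨
        (G.comap φ = H ⊔ SimpleGraph.edge a b ∧ G.Adj (φ b) (φ a)) := by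
  constructor
  · intro h
    by_cases hG : G.Adj (φ b) (φ a)
    · right
      refine ⟨?_, hG⟩
      ext x y
      rw [SimpleGraph.comap_adj, SimpleGraph.sup_adj, SimpleGraph.edge_adj]
      by_cases h1 : x = a ∧ y = b
      · obtain ⟨rfl, rfl⟩ := h1
        simp [hG.symm, hab]
      · by_cases h2 : x = b ∧ y = a
        · obtain ⟨rfl, rfl⟩ := h2
          simp [hG, hab.symm]
        · rw [h x y h1 h2]
          constructor
          · exact Or.inl
          · rintro (h3 | ⟨⟨rfl, rfl⟩ | ⟨rfl, rfl⟩, _⟩)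
            · exact h3
            · exact absurd ⟨rfl, rfl⟩ h1
            · exact absurd ⟨rfl, rfl⟩ h2
    · left
      refine ⟨?_, hG⟩
      ext x y
      rw [SimpleGraph.comap_adj]
      by_cases h1 : x = a ∧ y = b
      · obtain ⟨rfl, rfl⟩ := h1
        exact iff_of_false (fun h => hG h.symm) hH
      · by_cases h2 : x = b ∧ y = a
        · obtain ⟨rfl, rfl⟩ := h2
          exact iff_of_false hG fun h => hH h.symm
        · exact h x y h1 h2
  · rintro (⟨h, _⟩ | ⟨h, _⟩) x y h1 h2
    · rw [← h, SimpleGraph.comap_adj]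
    · rw [← SimpleGraph.comap_adj, h, SimpleGraph.sup_adj, SimpleGraph.edge_adj]
      constructor
      · rintro (h3 | ⟨⟨rfl, rfl⟩ | ⟨rfl, rfl⟩, _⟩)
        · exact h3
        · exact absurd ⟨rfl, rfl⟩ h1
        · exact absurd ⟨rfl, rfl⟩ h2
      · exact Or.inl

lemma mem_patternSet_map (hab : a ≠ b) (hH : ¬ H.Adj a b) {G : SimpleGraph (Fin n)} :
    G ∈ patternSet d (Finset.univ.map φ) (H.map φ) (φ a) (φ b) ↔
      G ∈ degFinset n d ∧ ((G.comap φ = H ∧ ¬ G.Adj (φ b) (φ a)) ∨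
        (G.comap φ = H ⊔ SimpleGraph.edge a b ∧ G.Adj (φ b) (φ a))) := by
  rw [← comap_eq_or_iff hab hH]
  simp only [patternSet, degFinset, Finset.mem_filter]
  simp [φ.injective.eq_iff]

lemma comap_eq_imp (hH : ¬ H.Adj a b) {G : SimpleGraph (Fin n)} (h : G.comap φ = H) :
    ¬ G.Adj (φ b) (φ a) := by
  rw [← h] at hH
  exact fun h' => hH h'.symm

lemma comap_eq_sup_imp (hab : a ≠ b) {G : SimpleGraph (Fin n)}
    (h : G.comap φ = H ⊔ SimpleGraph.edge a b) : G.Adj (φ b) (φ a) := by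
  have : (G.comap φ).Adj b a := by
    rw [h, SimpleGraph.sup_adj, SimpleGraph.edge_adj]
    exact Or.inr ⟨Or.inr ⟨rfl, rfl⟩, hab.symm⟩
  exact this

lemma sum_patternSet_map (hab : a ≠ b) (hH : ¬ H.Adj a b) :
    ∑ G ∈ patternSet d (Finset.univ.map φ) (H.map φ) (φ a) (φ b),
      (if G.Adj (φ b) (φ a) then (1 : ℝ) else 0) =
      inducedCount d φ (H ⊔ SimpleGraph.edge a b) := by
  rw [inducedCount, ← Finset.sum_filter, Finset.sum_const, nsmul_eq_mul, mul_one]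
  congr 2
  ext G
  rw [Finset.mem_filter, Finset.mem_filter, mem_patternSet_map hab hH]
  constructor
  · rintro ⟨⟨h1, ⟨_, h2⟩ | ⟨h2, _⟩⟩, h3⟩
    · exact absurd h3 h2
    · exact ⟨h1, h2⟩
  · rintro ⟨h1, h2⟩
    have := comap_eq_sup_imp hab h2
    exact ⟨⟨h1, Or.inr ⟨h2, this⟩⟩, this⟩

lemma card_patternSet_map (hab : a ≠ b) (hH : ¬ H.Adj a b) :
    ((patternSet d (Finset.univ.map φ) (H.map φ) (φ a) (φ b)).card : ℝ) =
      inducedCount d φ H + inducedCount d φ (H ⊔ SimpleGraph.edge a b) := by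
  rw [inducedCount, inducedCount, ← Nat.cast_add, ← Finset.card_union_of_disjoint]
  · congr 2
    ext G
    rw [Finset.mem_union, Finset.mem_filter, Finset.mem_filter, mem_patternSet_map hab hH]
    constructor
    · rintro ⟨h1, ⟨h2, _⟩ | ⟨h2, _⟩⟩
      · exact Or.inl ⟨h1, h2⟩
      · exact Or.inr ⟨h1, h2⟩
    · rintro (⟨h1, h2⟩ | ⟨h1, h2⟩)
      · exact ⟨h1, Or.inl ⟨h2, comap_eq_imp hH h2⟩⟩
      · exact ⟨h1, Or.inr ⟨h2, comap_eq_sup_imp hab h2⟩⟩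
  · rw [Finset.disjoint_left]
    intro G h1 h2
    rw [Finset.mem_filter] at h1 h2
    exact comap_eq_imp hH h1.2 (comap_eq_sup_imp hab h2.2)

lemma cnt_map (x : Fin r) : cnt (Finset.univ.map φ) (H.map φ) (φ x) = deg H x := by
  rw [cnt, Finset.sum_map, deg, Finset.card_filter]
  push_cast
  simp

lemma sum_erase_map (f : Fin n → ℝ) : ∑ i ∈ ((Finset.univ.map φ).erase (φ a)).erase (φ b), f i =
    ∑ i ∈ (Finset.univ.erase a).erase b, f (φ i) := by
  rw [← Finset.map_erase, ← Finset.map_erase, Finset.sum_map]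

end embed

lemma deg_le_sub_one {r : ℕ} (H : SimpleGraph (Fin r)) (x : Fin r) : (deg H x : ℝ) ≤ r - 1 := by
  have h : deg H x ≤ (Finset.univ.erase x).card := by
    refine Finset.card_le_card fun y hy => ?_
    rw [Finset.mem_filter] at hy
    exact Finset.mem_erase.2 ⟨hy.2.ne', Finset.mem_univ _⟩
  rw [Finset.card_erase_of_mem (Finset.mem_univ _), Finset.card_univ, Fintype.card_fin] at h
  have hr : 1 ≤ r := Fin.pos x
  have : (deg H x : ℝ) ≤ ((r - 1 : ℕ) : ℝ) := by exact_mod_cast h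
  rwa [Nat.cast_sub hr, Nat.cast_one] at this

lemma abs_deg_sub_le {r : ℕ} (H : SimpleGraph (Fin r)) (x : Fin r) {l : ℝ} (h0 : 0 ≤ l)
    (h1 : l ≤ 1) : |(deg H x : ℝ) - l * (r - 1)| ≤ r := by
  have h := deg_le_sub_one H x
  have h2 : (0 : ℝ) ≤ deg H x := by positivity
  rw [abs_le]
  constructor <;> nlinarith

lemma div_estimate {N n P T F S y l u s β : ℝ} (hN0 : 0 < N) (hN : n / 2 ≤ N) (hn : 0 < n)
    (hT : 0 ≤ T) {r : ℝ} (hr : 1 ≤ r) (hru : r ≤ u) (hNr : N = n - r) (hs : 0 < s)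
    (hsn : s ≤ n) (hl0 : 0 ≤ l) (hl1 : l ≤ 1) (hS : |S| ≤ 2 * u ^ 2) (hy : |y| ≤ 2 * u / n)
    (hβ : 2 * u * (10 * β) ≤ 1)
    (hF : N * F = N * (l * (N - 1) + n * y) + S)
    (h : |N * ((N + 1) * P) - N * F * T| ≤ N * (2 * u * (4 * (u / s) + 10 * β)) * T) :
    |P - (l + y) * T| ≤ (6 + 28 * u ^ 2 / s) / n * T := by
  have hu : 0 ≤ u := by linarith
  have h1 : |(N + 1) * P - F * T| ≤ (8 * u ^ 2 / s + 1) * T := by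
    have e1 : N * ((N + 1) * P) - N * F * T = N * ((N + 1) * P - F * T) := by ring
    rw [e1, abs_mul, abs_of_pos hN0, mul_assoc] at h
    have h2 := le_of_mul_le_mul_left h hN0
    refine h2.trans (mul_le_mul_of_nonneg_right ?_ hT)
    have e2 : 2 * u * (4 * (u / s) + 10 * β) = 8 * u ^ 2 / s + 2 * u * (10 * β) := by ring
    rw [e2]
    linarith
  have h2 : (N + 1) * (P - (l + y) * T) =
      ((N + 1) * P - F * T) + (-(2 * l) + (r - 1) * y + S / N) * T := by
    have : F = (l * (N - 1) + n * y) + S / N := by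
      field_simp
      linarith
    rw [this, hNr]
    ring
  have h3 : |S / N| ≤ 4 * u ^ 2 / s := by
    rw [abs_div, abs_of_pos hN0, div_le_div_iff₀ hN0 hs]
    have : |S| * s ≤ 2 * u ^ 2 * s := by gcongr
    have h4 : s ≤ 2 * N := by linarith
    nlinarith [mul_nonneg (sq_nonneg u) (sub_nonneg.2 h4)]
  have h4 : |(r - 1) * y| ≤ 2 * u ^ 2 / s := by
    rw [abs_mul, abs_of_nonneg (by linarith)]
    calc (r - 1) * |y| ≤ u * (2 * u / n) := by
          apply mul_le_mul (by linarith) hy (abs_nonneg _) hu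
      _ = 2 * u ^ 2 / n := by ring
      _ ≤ _ := by gcongr
  have h5 : |(-(2 * l) + (r - 1) * y + S / N) * T| ≤ (2 + 6 * u ^ 2 / s) * T := by
    rw [abs_mul, abs_of_nonneg hT]
    gcongr
    have e : 6 * u ^ 2 / s = 2 * u ^ 2 / s + 4 * u ^ 2 / s := by ring
    rw [e]
    rw [abs_le] at h3 h4 ⊢
    constructor <;> linarith
  have h6 : (N + 1) * |P - (l + y) * T| ≤ (3 + 14 * u ^ 2 / s) * T := by
    rw [← abs_of_pos (show (0 : ℝ) < N + 1 by linarith), ← abs_mul, h2]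
    refine (abs_add_le _ _).trans ?_
    have e : (3 + 14 * u ^ 2 / s) * T = (8 * u ^ 2 / s + 1) * T + (2 + 6 * u ^ 2 / s) * T := by
      ring
    linarith
  rw [div_mul_eq_mul_div, le_div_iff₀ hn]
  have h7 : n / 2 * |P - (l + y) * T| ≤ (N + 1) * |P - (l + y) * T| := by
    gcongr
    linarith
  have e : (6 + 28 * u ^ 2 / s) * T = 2 * ((3 + 14 * u ^ 2 / s) * T) := by ring
  rw [e]
  linarith

section ratio

variable {n r : ℕ} {d : Fin n → ℕ} {φ : Fin r ↪ Fin n} {H : SimpleGraph (Fin r)} {a b : Fin r}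

lemma induced_edge_estimate {D δ l : ℝ} (hd : ∀ v, |(d v : ℝ) - D| ≤ δ)
    (hD : ∑ v, (d v : ℝ) = n * D) (hl : D = l * (n - 1)) (hl0 : 0 ≤ l) (hl1 : l ≤ 1)
    (hrn : 2 * (r : ℝ) ≤ n) (hab : a ≠ b) (hH : ¬ H.Adj a b) {s : ℕ} (hs : 0 < s)
    (hsn' : (s : ℝ) ≤ n) (hκ : 2 * (δ + r) ≤ s) (h0 : 0 ≤ (n : ℝ) - 1 - D - (δ + r))
    (hsn : n * (16 * s + 3 * (δ + r)) < (D - (δ + r)) * (n - 1 - D - (δ + r)))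
    (hβ : 2 * (δ + r) * (10 * ((n : ℝ) ^ 2 * (2 * s + 1) / 9 ^ s)) ≤ 1) :
    |inducedCount d φ (H ⊔ SimpleGraph.edge a b) -
        (l + (((d (φ a) : ℝ) - D) + ((d (φ b) : ℝ) - D) - ((deg H a : ℝ) - l * (r - 1)) -
          ((deg H b : ℝ) - l * (r - 1))) / n) *
          (inducedCount d φ H + inducedCount d φ (H ⊔ SimpleGraph.edge a b))| ≤
      (6 + 28 * (δ + r) ^ 2 / s) / n *
        (inducedCount d φ H + inducedCount d φ (H ⊔ SimpleGraph.edge a b)) := by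
  set X : Finset (Fin n) := Finset.univ.map φ with hXdef
  have hX : X.card = r := by simp [hXdef]
  have hδ : 0 ≤ δ := (abs_nonneg _).trans (hd (φ a))
  have hr2 : 2 ≤ r := by
    have := a.2; have := b.2; have : a.1 ≠ b.1 := fun h => hab (Fin.ext h)
    omega
  have hr2' : (2 : ℝ) ≤ r := by exact_mod_cast hr2
  have hXc : (Xᶜ.card : ℝ) = n - r := by
    rw [Finset.card_compl, hX, Fintype.card_fin, Nat.cast_sub]
    have : (r : ℝ) ≤ n := by linarith
    exact_mod_cast this
  have hn : (0 : ℝ) < n := by linarith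
  have hmem : ∀ x, φ x ∈ X := fun x => Finset.mem_map.2 ⟨x, Finset.mem_univ _, rfl⟩
  have key := edge_estimate (d := d) (H := H.map φ) (X := X) (j := φ a) (k := φ b) hd
    (by rw [hX]; exact hr2) (hmem a) (hmem b) (fun h => hab (φ.injective h))
    (by rwa [SimpleGraph.map_adj_apply]) hs (by rw [hX]; exact hκ) (by rw [hX]; exact h0)
    (by rw [hX]; exact hsn)
  rw [sum_patternSet_map hab hH, card_patternSet_map hab hH, cnt_map, cnt_map, sum_erase_map,
    hX, hXc] at key
  simp only [hXdef, cnt_map] at key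
  rw [← hXdef] at key
  set T := inducedCount d φ H + inducedCount d φ (H ⊔ SimpleGraph.edge a b)
  set P := inducedCount d φ (H ⊔ SimpleGraph.edge a b)
  have hT : 0 ≤ T := by
    have : ∀ K, 0 ≤ inducedCount d φ K := fun K => by rw [inducedCount]; positivity
    exact add_nonneg (this _) (this _)
  have hsumX : ∑ v ∈ Xᶜ, (d v : ℝ) = (n - r) * D - ∑ x, ((d (φ x) : ℝ) - D) := by
    have h1 : ∑ v ∈ X, (d v : ℝ) = ∑ x, (d (φ x) : ℝ) := by rw [hXdef, Finset.sum_map]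
    have h2 := Finset.sum_add_sum_compl X fun v => (d v : ℝ)
    rw [hD, h1] at h2
    rw [Finset.sum_sub_distrib, Finset.sum_const, Finset.card_univ, Fintype.card_fin, nsmul_eq_mul]
    linarith
  have hsumR : ∑ i ∈ (Finset.univ.erase a).erase b, ((d (φ i) : ℝ) - deg H i) =
      (r - 2) * (l * (n - r)) + ∑ i ∈ (Finset.univ.erase a).erase b,
        (((d (φ i) : ℝ) - D) - ((deg H i : ℝ) - l * (r - 1))) := by
    have h1 : ((Finset.univ.erase a).erase b).card = r - 2 := by
      rw [Finset.card_erase_of_mem (by simp [hab.symm]), Finset.card_erase_of_mem (by simp)]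
      simp
      omega
    have h2 : (((Finset.univ.erase a).erase b).card : ℝ) = r - 2 := by
      rw [h1, Nat.cast_sub hr2]; norm_num
    rw [← h2, ← nsmul_eq_mul, ← Finset.sum_const, ← Finset.sum_add_distrib]
    refine Finset.sum_congr rfl fun i _ => ?_
    rw [hl]; ring
  rw [hsumX, hsumR] at key
  set S1 := ∑ x, ((d (φ x) : ℝ) - D)
  set S2 := ∑ i ∈ (Finset.univ.erase a).erase b,
        (((d (φ i) : ℝ) - D) - ((deg H i : ℝ) - l * (r - 1)))
  set y := (((d (φ a) : ℝ) - D) + ((d (φ b) : ℝ) - D) - ((deg H a : ℝ) - l * (r - 1)) -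
          ((deg H b : ℝ) - l * (r - 1))) / n with hy
  have hη := fun x => abs_deg_sub_le H x hl0 hl1
  have hS1 : |S1| ≤ r * δ := by
    refine (Finset.abs_sum_le_sum_abs _ _).trans ((Finset.sum_le_sum fun i _ => hd _).trans ?_)
    simp
  have hS2 : |S2| ≤ r * (δ + r) := by
    refine (Finset.abs_sum_le_sum_abs _ _).trans ?_
    calc _ ≤ ∑ i ∈ (Finset.univ.erase a).erase b, (δ + r) := by
          refine Finset.sum_le_sum fun i _ => (abs_sub _ _).trans (add_le_add (hd _) (hη _))
      _ ≤ ∑ i : Fin r, (δ + r) :=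
          Finset.sum_le_sum_of_subset_of_nonneg (Finset.subset_univ _) fun _ _ _ => by positivity
      _ = _ := by simp; ring
  refine div_estimate (N := n - r) (S := S1 + S2) (r := r)
    (F := (((d (φ a) : ℝ) - deg H a) + ((d (φ b) : ℝ) - deg H b)) - D + (S1 + S2) / (n - r) +
      (r - 2) * l) (β := (n : ℝ) ^ 2 * (2 * s + 1) / 9 ^ s) (by linarith) (by linarith) hn hT
    (by linarith) (by linarith) rfl (by exact_mod_cast hs) hsn' hl0 hl1 ?_ ?_ hβ ?_ ?_
  · refine (abs_add_le _ _).trans ((add_le_add hS1 hS2).trans ?_)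
    nlinarith [mul_nonneg hδ hδ, mul_nonneg hδ (show (0 : ℝ) ≤ r by positivity)]
  · rw [hy, abs_div, abs_of_pos hn]
    gcongr
    have h1 := abs_le.1 (hd (φ a))
    have h2 := abs_le.1 (hd (φ b))
    have h3 := abs_le.1 (hη a)
    have h4 := abs_le.1 (hη b)
    rw [abs_le]
    constructor <;> linarith
  · have h1 : ((n : ℝ) - r) ≠ 0 := by
      have : (0 : ℝ) < n - r := by linarith
      exact this.ne'
    have h2 : n * y = (((d (φ a) : ℝ) - D) + ((d (φ b) : ℝ) - D) - ((deg H a : ℝ) - l * (r - 1)) -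
          ((deg H b : ℝ) - l * (r - 1))) := by
      rw [hy]; field_simp
    rw [h2, hl]
    field_simp
    ring
  · convert key using 2
    have h1 : ((n : ℝ) - r) ≠ 0 := by
      have : (0 : ℝ) < n - r := by linarith
      exact this.ne'
    rw [hl]
    field_simp
    ring

end ratio

lemma exp_le_one_add {x : ℝ} (hx : |x| ≤ 1 / 2) : Real.exp (x - 2 * x ^ 2) ≤ 1 + x := by
  have h := abs_le.1 hx
  have h0 : 0 < 1 + x := by linarith
  rw [← Real.le_log_iff_exp_le h0]
  refine le_trans ?_ (Real.one_sub_inv_le_log_of_pos h0)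
  rw [← sub_nonneg]
  have : 1 - (1 + x)⁻¹ - (x - 2 * x ^ 2) = x ^ 2 * (1 + 2 * x) / (1 + x) := by
    field_simp
    ring
  rw [this]
  have : 0 ≤ 1 + 2 * x := by linarith
  positivity

lemma odds_le {P Q T l y θ z g ξ : ℝ} (hPQ : Q + P = T) (hT : 0 ≤ T) (hl0 : 0 < l) (hl1 : l < 1)
    (h : |P - (l + y) * T| ≤ θ * T) (hz : (|y| + θ) / (l * (1 - l)) ≤ z) (hz2 : z ≤ 1 / 2)
    (hg : |g - y / (l * (1 - l))| + θ / (l * (1 - l)) + 2 * z ^ 2 ≤ ξ) :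
    P * (1 - l) ≤ Real.exp (ξ + g) * (Q * l) ∧
      Real.exp (-ξ + g) * (Q * l) ≤ P * (1 - l) := by
  rcases hT.eq_or_lt with hT0 | hT0
  · rw [← hT0] at h
    have hP : P = 0 := by simpa using h
    have hQ : Q = 0 := by linarith
    simp [hP, hQ]
  have hm : 0 < 1 - l := by linarith
  obtain ⟨τ, hP⟩ : ∃ τ, P = (l + y + τ) * T := ⟨P / T - (l + y), by field_simp; ring⟩
  have hτ : |τ| ≤ θ := by
    have : P - (l + y) * T = τ * T := by rw [hP]; ring
    rw [this, abs_mul, abs_of_pos hT0] at h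
    exact le_of_mul_le_mul_right h hT0
  have hw : |y + τ| ≤ |y| + θ := (abs_add_le _ _).trans (by linarith)
  have hμ : 0 < l * (1 - l) := by positivity
  have hzw : |y + τ| ≤ z * (l * (1 - l)) := by
    rw [div_le_iff₀ hμ] at hz
    linarith
  have hz0 : 0 ≤ z := by
    by_contra hneg
    have := abs_nonneg (y + τ)
    nlinarith
  have hx : |(y + τ) / l| ≤ z := by
    rw [abs_div, abs_of_pos hl0, div_le_iff₀ hl0]
    refine hzw.trans ?_
    nlinarith [mul_nonneg hz0 (mul_nonneg hl0.le hl0.le)]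
  have hx' : |(-(y + τ)) / (1 - l)| ≤ z := by
    rw [abs_div, abs_neg, abs_of_pos hm, div_le_iff₀ hm]
    refine hzw.trans ?_
    nlinarith [mul_nonneg hz0 (mul_nonneg hm.le hm.le)]
  have e1 : P * (1 - l) = (1 + (y + τ) / l) * (l * (1 - l) * T) := by
    rw [hP]; field_simp; ring
  have e2 : Q * l = (1 + (-(y + τ)) / (1 - l)) * (l * (1 - l) * T) := by
    have : Q = T - P := by linarith
    rw [this, hP]; field_simp; ring
  have hdiff : (y + τ) / l - (-(y + τ)) / (1 - l) = y / (l * (1 - l)) + τ / (l * (1 - l)) := by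
    field_simp; ring
  have hτμ : |τ / (l * (1 - l))| ≤ θ / (l * (1 - l)) := by
    rw [abs_div, abs_of_pos hμ]
    gcongr
  have hA := abs_le.1 hτμ
  have hB := neg_le_of_abs_le (le_refl |g - y / (l * (1 - l))|)
  have hB' := le_abs_self (g - y / (l * (1 - l)))
  have hlT : 0 ≤ l * (1 - l) * T := by positivity
  have hsq : ∀ x, |x| ≤ z → x ^ 2 ≤ z ^ 2 := fun x hx => sq_le_sq' (abs_le.1 hx).1 (abs_le.1 hx).2
  rw [e1, e2, ← mul_assoc (Real.exp (ξ + g)), ← mul_assoc (Real.exp (-ξ + g))]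
  constructor
  · refine mul_le_mul_of_nonneg_right ?_ hlT
    have h1 := exp_le_one_add (hx'.trans hz2)
    calc 1 + (y + τ) / l ≤ Real.exp ((y + τ) / l) := by
          rw [add_comm]; exact Real.add_one_le_exp _
      _ ≤ Real.exp (ξ + g) * Real.exp (-(y + τ) / (1 - l) - 2 * (-(y + τ) / (1 - l)) ^ 2) := by
          rw [← Real.exp_add, Real.exp_le_exp]
          have := hsq _ hx'
          linarith
      _ ≤ _ := by gcongr
  · refine mul_le_mul_of_nonneg_right ?_ hlT
    have h1 := exp_le_one_add (hx.trans hz2)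
    calc Real.exp (-ξ + g) * (1 + -(y + τ) / (1 - l)) ≤
        Real.exp (-ξ + g) * Real.exp (-(y + τ) / (1 - l)) := by
          gcongr
          rw [add_comm]; exact Real.add_one_le_exp _
      _ ≤ Real.exp ((y + τ) / l - 2 * ((y + τ) / l) ^ 2) := by
          rw [← Real.exp_add, Real.exp_le_exp]
          have := hsq _ hx
          linarith
      _ ≤ _ := h1

/-- The centred degree of the vertex `x` of `H`. -/
noncomputable def cdeg {r : ℕ} (l : ℝ) (H : SimpleGraph (Fin r)) (x : Fin r) : ℝ :=
  (deg H x : ℝ) - l * (r - 1)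

/-- The number of edges of `H`. -/
noncomputable def numEdges {r : ℕ} (H : SimpleGraph (Fin r)) : ℕ := H.edgeFinset.card

/-- The binomial random graph weight. -/
noncomputable def binWeight {r : ℕ} (l : ℝ) (H : SimpleGraph (Fin r)) : ℝ :=
  l ^ numEdges H * (1 - l) ^ (r.choose 2 - numEdges H)

/-- The approximate weight of `H` as an induced subgraph on vertices with degree excess `e`. -/
noncomputable def approxWeight {r : ℕ} (l κ : ℝ) (e : Fin r → ℝ) (H : SimpleGraph (Fin r)) : ℝ :=
  binWeight l H * Real.exp (∑ x, (e x * cdeg l H x - cdeg l H x ^ 2 / 2) / κ)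

section weight

variable {r : ℕ} {l κ : ℝ} {e : Fin r → ℝ} {H : SimpleGraph (Fin r)} {a b : Fin r}

lemma binWeight_pos (hl0 : 0 < l) (hl1 : l < 1) : 0 < binWeight l H := by
  have : 0 < 1 - l := by linarith
  rw [binWeight]; positivity

lemma approxWeight_pos (hl0 : 0 < l) (hl1 : l < 1) : 0 < approxWeight l κ e H :=
  mul_pos (binWeight_pos hl0 hl1) (Real.exp_pos _)

lemma numEdges_le_choose_two (H : SimpleGraph (Fin r)) : numEdges H ≤ r.choose 2 := by
  simpa [numEdges] using H.card_edgeFinset_le_card_choose_two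

lemma numEdges_sup_edge (hab : a ≠ b) (hH : ¬ H.Adj a b) :
    numEdges (H ⊔ SimpleGraph.edge a b) = numEdges H + 1 := by
  rw [numEdges, numEdges]
  convert H.card_edgeFinset_sup_edge hH hab using 2
  ext x
  simp only [SimpleGraph.mem_edgeFinset]

lemma numEdges_eq_zero : numEdges H = 0 ↔ H = ⊥ := by
  rw [numEdges, Finset.card_eq_zero, SimpleGraph.edgeFinset_eq_empty]

lemma binWeight_sup_edge (hab : a ≠ b) (hH : ¬ H.Adj a b) :
    binWeight l (H ⊔ SimpleGraph.edge a b) * (1 - l) = binWeight l H * l := by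
  have h1 := numEdges_sup_edge hab hH
  have h2 := numEdges_le_choose_two (H ⊔ SimpleGraph.edge a b)
  rw [binWeight, binWeight]
  rw [h1] at h2 ⊢
  obtain ⟨k, hk⟩ := Nat.exists_eq_add_of_le h2
  rw [hk, show numEdges H + 1 + k - (numEdges H + 1) = k by omega,
    show numEdges H + 1 + k - numEdges H = k + 1 by omega]
  ring

lemma cdeg_sup_edge (hab : a ≠ b) (hH : ¬ H.Adj a b) (x : Fin r) :
    cdeg l (H ⊔ SimpleGraph.edge a b) x =
      cdeg l H x + ((if x = a then 1 else 0) + if x = b then 1 else 0) := by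
  have h : (deg (H ⊔ SimpleGraph.edge a b) x : ℝ) =
      deg H x + ((if x = a then 1 else 0) + if x = b then 1 else 0) := by
    rw [deg, deg, Finset.card_filter, Finset.card_filter]
    push_cast
    have h1 : ((if x = a then 1 else 0) + if x = b then (1 : ℝ) else 0) =
        ∑ k, ((if x = a then if k = b then (1 : ℝ) else 0 else 0) +
          if x = b then if k = a then (1 : ℝ) else 0 else 0) := by
      rw [Finset.sum_add_distrib]
      congr 1
      · split_ifs <;> simp
      · split_ifs <;> simp
    rw [h1, ← Finset.sum_add_distrib]
    refine Finset.sum_congr rfl fun k _ => ?_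
    simp only [SimpleGraph.sup_adj, SimpleGraph.edge_adj]
    by_cases h2 : x = a ∧ k = b
    · obtain ⟨rfl, rfl⟩ := h2
      simp [hab, hH]
    · by_cases h3 : x = b ∧ k = a
      · obtain ⟨rfl, rfl⟩ := h3
        have h4 : ¬ H.Adj x k := fun h => hH h.symm
        simp [hab, hab.symm, h4]
      · have h4 : ¬((x = a ∧ k = b ∨ x = b ∧ k = a) ∧ x ≠ k) := by tauto
        rw [← ite_and, ← ite_and, if_neg h2, if_neg h3]
        simp [h4]
  rw [cdeg, cdeg, h]
  ring

lemma approxWeight_sup_edge (hab : a ≠ b) (hH : ¬ H.Adj a b) :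
    approxWeight l κ e (H ⊔ SimpleGraph.edge a b) * (1 - l) =
      approxWeight l κ e H * l * Real.exp ((e a + e b - cdeg l H a - cdeg l H b - 1) / κ) := by
  have h : ∑ x, (e x * cdeg l (H ⊔ SimpleGraph.edge a b) x -
        cdeg l (H ⊔ SimpleGraph.edge a b) x ^ 2 / 2) / κ =
      ∑ x, (e x * cdeg l H x - cdeg l H x ^ 2 / 2) / κ +
        (e a + e b - cdeg l H a - cdeg l H b - 1) / κ := by
    have h1 : ∀ x, (e x * cdeg l (H ⊔ SimpleGraph.edge a b) x -
        cdeg l (H ⊔ SimpleGraph.edge a b) x ^ 2 / 2) / κ =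
        (e x * cdeg l H x - cdeg l H x ^ 2 / 2) / κ +
          ((if x = a then (e x - cdeg l H x - 1 / 2) / κ else 0) +
            if x = b then (e x - cdeg l H x - 1 / 2) / κ else 0) := by
      intro x
      rw [cdeg_sup_edge hab hH]
      by_cases h2 : x = a
      · have h3 : x ≠ b := fun h => hab (h2.symm.trans h)
        simp only [h2, hab, if_true, if_false]
        ring
      · by_cases h3 : x = b
        · simp only [h3, hab.symm, if_true, if_false]
          ring
        · simp only [h2, h3, if_false]
          ring
    rw [Finset.sum_congr rfl fun x _ => h1 x, Finset.sum_add_distrib, Finset.sum_add_distrib,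
      Finset.sum_ite_eq' , Finset.sum_ite_eq']
    simp only [Finset.mem_univ, if_true]
    ring
  rw [approxWeight, approxWeight, h, Real.exp_add]
  linear_combination (Real.exp (∑ x, (e x * cdeg l H x - cdeg l H x ^ 2 / 2) / κ) *
    Real.exp ((e a + e b - cdeg l H a - cdeg l H b - 1) / κ)) * binWeight_sup_edge (l := l) hab hH

end weight

lemma exists_eq_sup_edge {r : ℕ} {H : SimpleGraph (Fin r)} (h : H ≠ ⊥) :
    ∃ (K : SimpleGraph (Fin r)) (a b : Fin r), a ≠ b ∧ ¬ K.Adj a b ∧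
      H = K ⊔ SimpleGraph.edge a b := by
  obtain ⟨a, b, hadj⟩ := SimpleGraph.ne_bot_iff_exists_adj.1 h
  have hab := hadj.ne
  refine ⟨H \ SimpleGraph.edge a b, a, b, hab, ?_, ?_⟩
  · rw [SimpleGraph.sdiff_adj, SimpleGraph.edge_adj]
    tauto
  · rw [sdiff_sup_cancel]
    exact (SimpleGraph.edge_le_iff H).2 (Or.inr hadj)

lemma chain_le {r : ℕ} {W N : SimpleGraph (Fin r) → ℝ} {ξ : ℝ} (hW : ∀ H, 0 < W H)
    (h : ∀ K a b, a ≠ b → ¬ SimpleGraph.Adj K a b →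
      N (K ⊔ SimpleGraph.edge a b) * W K ≤
        Real.exp ξ * (N K * W (K ⊔ SimpleGraph.edge a b)) ∧
      Real.exp (-ξ) * (N K * W (K ⊔ SimpleGraph.edge a b)) ≤
        N (K ⊔ SimpleGraph.edge a b) * W K) (H : SimpleGraph (Fin r)) :
    N H * W ⊥ ≤ Real.exp (numEdges H * ξ) * (N ⊥ * W H) ∧
      Real.exp (-(numEdges H * ξ)) * (N ⊥ * W H) ≤ N H * W ⊥ := by
  induction hm : numEdges H generalizing H with
  | zero =>
    obtain rfl := numEdges_eq_zero.1 hm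
    simp
  | succ m ih =>
    have hne : H ≠ ⊥ := by
      rintro rfl
      rw [numEdges_eq_zero.2 rfl] at hm
      exact absurd hm (Nat.succ_ne_zero m).symm
    obtain ⟨K, a, b, hab, hK, rfl⟩ := exists_eq_sup_edge hne
    have hKm : numEdges K = m := by
      rw [numEdges_sup_edge hab hK] at hm
      omega
    obtain ⟨h1, h2⟩ := ih K hKm
    obtain ⟨h3, h4⟩ := h K a b hab hK
    have hWK := hW K
    have hWb := hW ⊥
    have hWp := hW (K ⊔ SimpleGraph.edge a b)
    generalize W (K ⊔ SimpleGraph.edge a b) = Wp at *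
    generalize N (K ⊔ SimpleGraph.edge a b) = Np at *
    push_cast
    rw [add_mul, one_mul, neg_add, Real.exp_add, Real.exp_add]
    constructor
    · refine le_of_mul_le_mul_right (?_ : _ * W K ≤ _ * W K) hWK
      calc Np * W ⊥ * W K = (Np * W K) * W ⊥ := by ring
        _ ≤ (Real.exp ξ * (N K * Wp)) * W ⊥ := by gcongr
        _ = Real.exp ξ * Wp * (N K * W ⊥) := by ring
        _ ≤ Real.exp ξ * Wp * (Real.exp (m * ξ) * (N ⊥ * W K)) := by gcongr
        _ = _ := by ring
    · refine le_of_mul_le_mul_right (?_ : _ * W K ≤ _ * W K) hWK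
      calc Real.exp (-(m * ξ)) * Real.exp (-ξ) * (N ⊥ * Wp) * W K
          = Real.exp (-ξ) * Wp * (Real.exp (-(m * ξ)) * (N ⊥ * W K)) := by ring
        _ ≤ Real.exp (-ξ) * Wp * (N K * W ⊥) := by gcongr
        _ = (Real.exp (-ξ) * (N K * Wp)) * W ⊥ := by ring
        _ ≤ (Np * W K) * W ⊥ := by gcongr
        _ = _ := by ring

lemma sum_inducedCount {n r : ℕ} (d : Fin n → ℕ) (φ : Fin r ↪ Fin n) :
    ∑ H : SimpleGraph (Fin r), inducedCount d φ H = (degFinset n d).card := by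
  simp only [inducedCount]
  rw [← Nat.cast_sum]
  congr 1
  exact (Finset.card_eq_sum_card_fiberwise fun _ _ => Finset.mem_coe.2 (Finset.mem_univ _)).symm

/-- If the counts `N` are, up to a constant factor, within `exp (±β)` of `W`, then normalized
counts are within `exp (±2β)` of the normalized weights. -/
lemma normalize_le {ι : Type*} [Fintype ι] [Nonempty ι] {W N : ι → ℝ} {α c β : ℝ}
    (hW : ∀ H, 0 < W H) (hc : 0 < c)
    (h : ∀ H, N H * c ≤ Real.exp β * (α * W H) ∧ Real.exp (-β) * (α * W H) ≤ N H * c)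
    (hN : 0 < ∑ H, N H) (H : ι) :
    N H / ∑ K, N K ≤ Real.exp (2 * β) * (W H / ∑ K, W K) ∧
      Real.exp (-(2 * β)) * (W H / ∑ K, W K) ≤ N H / ∑ K, N K := by
  have hS : 0 < ∑ K, W K := Finset.sum_pos (fun K _ => hW K) Finset.univ_nonempty
  have h1 : (∑ K, N K) * c ≤ Real.exp β * (α * ∑ K, W K) := by
    rw [Finset.sum_mul, Finset.mul_sum, Finset.mul_sum]
    exact Finset.sum_le_sum fun K _ => (h K).1
  have h2 : Real.exp (-β) * (α * ∑ K, W K) ≤ (∑ K, N K) * c := by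
    rw [Finset.sum_mul, Finset.mul_sum, Finset.mul_sum]
    exact Finset.sum_le_sum fun K _ => (h K).2
  have hWH := hW H
  obtain ⟨h3, h4⟩ := h H
  set A := ∑ K, N K
  set S := ∑ K, W K
  have e : Real.exp β * Real.exp (-β) = 1 := by rw [← Real.exp_add]; simp
  have e2 : Real.exp (2 * β) = Real.exp β * Real.exp β := by rw [← Real.exp_add]; ring_nf
  have e3 : Real.exp (-(2 * β)) = Real.exp (-β) * Real.exp (-β) := by
    rw [← Real.exp_add]; ring_nf
  rw [mul_div_assoc', mul_div_assoc', div_le_div_iff₀ hN hS, div_le_div_iff₀ hS hN]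
  constructor
  · refine le_of_mul_le_mul_right (?_ : _ * c ≤ _ * c) hc
    calc N H * S * c = N H * c * S := by ring
      _ ≤ Real.exp β * (α * W H) * S := by gcongr
      _ = Real.exp (2 * β) * W H * (Real.exp (-β) * (α * S)) := by
        rw [e2]; linear_combination (-(Real.exp β) * α * W H * S) * e
      _ ≤ Real.exp (2 * β) * W H * (A * c) := by gcongr
      _ = _ := by ring
  · refine le_of_mul_le_mul_right (?_ : _ * c ≤ _ * c) hc
    calc Real.exp (-(2 * β)) * W H * A * c = Real.exp (-(2 * β)) * W H * (A * c) := by ring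
      _ ≤ Real.exp (-(2 * β)) * W H * (Real.exp β * (α * S)) := by gcongr
      _ = Real.exp (-β) * (α * W H) * S := by
        rw [e3]; linear_combination (Real.exp (-β) * α * W H * S) * e
      _ ≤ N H * c * S := by gcongr
      _ = _ := by ring

/-- The set of all potential edges on `Fin r`. -/
noncomputable def allPairs (r : ℕ) : Finset (Sym2 (Fin r)) := (⊤ : SimpleGraph (Fin r)).edgeFinset

/-- The sum of a vertex weight over the endpoints of a pair. -/
noncomputable def pairSum {r : ℕ} (t : Fin r → ℝ) (e : Sym2 (Fin r)) : ℝ :=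
  ∑ x, if x ∈ e then t x else 0

section mgf

variable {r : ℕ} {l : ℝ} {t : Fin r → ℝ}

lemma card_allPairs : (allPairs r).card = r.choose 2 := by
  rw [allPairs, SimpleGraph.card_edgeFinset_top_eq_card_choose_two, Fintype.card_fin]

lemma card_filter_mem_edgeFinset (H : SimpleGraph (Fin r)) (x : Fin r) :
    (H.edgeFinset.filter fun e => x ∈ e).card = deg H x := by
  rw [← SimpleGraph.incidenceFinset_eq_filter, SimpleGraph.card_incidenceFinset_eq_degree,
    ← SimpleGraph.card_neighborFinset_eq_degree, SimpleGraph.neighborFinset_eq_filter]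
  rfl

lemma sum_pairSum (E : Finset (Sym2 (Fin r))) :
    ∑ e ∈ E, pairSum t e = ∑ x, t x * (E.filter fun e => x ∈ e).card := by
  simp only [pairSum]
  rw [Finset.sum_comm]
  refine Finset.sum_congr rfl fun x _ => ?_
  rw [← Finset.sum_filter, Finset.sum_const, nsmul_eq_mul, mul_comm]

lemma card_filter_allPairs (x : Fin r) :
    (((allPairs r).filter fun e => x ∈ e).card : ℝ) = r - 1 := by
  have h : deg (⊤ : SimpleGraph (Fin r)) x = r - 1 := by
    have : (Finset.univ.filter fun k => (⊤ : SimpleGraph (Fin r)).Adj x k) =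
        Finset.univ.erase x := by
      ext k
      simp [eq_comm]
    refine (congrArg Finset.card ?_).trans ((congrArg Finset.card this).trans ?_)
    · ext k
      simp only [Finset.mem_filter]
    rw [Finset.card_erase_of_mem (Finset.mem_univ _), Finset.card_univ,
      Fintype.card_fin]
  have h2 := card_filter_mem_edgeFinset (⊤ : SimpleGraph (Fin r)) x
  rw [h] at h2
  have hr : 1 ≤ r := Fin.pos x
  rw [← Nat.cast_one, ← Nat.cast_sub hr, ← h2, allPairs]
  congr 3
  ext e
  simp only [SimpleGraph.mem_edgeFinset]

lemma sum_mul_cdeg (H : SimpleGraph (Fin r)) :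
    ∑ x, t x * cdeg l H x =
      ∑ e ∈ H.edgeFinset, pairSum t e - l * ∑ e ∈ allPairs r, pairSum t e := by
  rw [sum_pairSum, sum_pairSum, Finset.mul_sum, ← Finset.sum_sub_distrib]
  refine Finset.sum_congr rfl fun x _ => ?_
  rw [card_filter_mem_edgeFinset, card_filter_allPairs, cdeg]
  ring

lemma sum_graph_eq_sum_powerset (f : Finset (Sym2 (Fin r)) → ℝ) :
    ∑ H : SimpleGraph (Fin r), f H.edgeFinset = ∑ s ∈ (allPairs r).powerset, f s := by
  refine Finset.sum_bij' (fun H _ => H.edgeFinset)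
    (fun s _ => SimpleGraph.fromEdgeSet (s : Set (Sym2 (Fin r)))) ?_ ?_ ?_ ?_ ?_
  · intro H _
    rw [Finset.mem_powerset, allPairs]
    exact SimpleGraph.edgeFinset_mono le_top
  · intro s _
    exact Finset.mem_univ _
  · intro H _
    simp
  · intro s hs
    rw [Finset.mem_powerset] at hs
    ext e
    have : e ∈ s → ¬ e.IsDiag := fun h => by
      have := hs h
      simpa [allPairs] using this
    simp only [SimpleGraph.mem_edgeFinset, SimpleGraph.edgeSet_fromEdgeSet, Set.mem_sdiff,
      Finset.mem_coe]
    exact ⟨fun h => h.1, fun h => ⟨h, this h⟩⟩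
  · intro H _
    rfl

lemma sum_binWeight_mul_exp :
    ∑ H : SimpleGraph (Fin r), binWeight l H * Real.exp (∑ x, t x * cdeg l H x) =
      ∏ e ∈ allPairs r, ((l * Real.exp (pairSum t e) + (1 - l)) *
        Real.exp (-(l * pairSum t e))) := by
  rw [Finset.prod_mul_distrib, Finset.prod_add, ← Real.exp_sum, Finset.sum_neg_distrib,
    ← Finset.mul_sum, ← sum_graph_eq_sum_powerset, Finset.sum_mul]
  refine Finset.sum_congr rfl fun H _ => ?_
  have hsub : H.edgeFinset ⊆ allPairs r := by
    rw [allPairs]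
    exact SimpleGraph.edgeFinset_mono le_top
  rw [Finset.prod_mul_distrib, Finset.prod_const, Finset.prod_const, ← Real.exp_sum,
    Finset.card_sdiff_of_subset hsub, card_allPairs, sum_mul_cdeg, binWeight, numEdges,
    sub_eq_add_neg (∑ e ∈ H.edgeFinset, pairSum t e), Real.exp_add]
  ring

lemma bernoulli_factor_bounds (hl0 : 0 ≤ l) (hl1 : l ≤ 1) {x : ℝ} (hx : |x| ≤ 1) :
    1 ≤ (l * Real.exp x + (1 - l)) * Real.exp (-(l * x)) ∧
      (l * Real.exp x + (1 - l)) * Real.exp (-(l * x)) ≤ Real.exp (x ^ 2) := by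
  constructor
  · have h1 : Real.exp (l * x) ≤ l * Real.exp x + (1 - l) := by
      have := convexOn_exp.2 (Set.mem_univ x) (Set.mem_univ 0) hl0 (sub_nonneg.2 hl1) (by ring)
      simpa using this
    calc (1 : ℝ) = Real.exp (l * x) * Real.exp (-(l * x)) := by rw [← Real.exp_add]; simp
      _ ≤ _ := by gcongr
  · have h1 := (abs_le.1 (Real.abs_exp_sub_one_sub_id_le hx)).2
    have h2 : l * Real.exp x + (1 - l) ≤ Real.exp (l * (x + x ^ 2)) := by
      refine le_trans ?_ (Real.add_one_le_exp _)
      nlinarith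
    calc _ ≤ Real.exp (l * (x + x ^ 2)) * Real.exp (-(l * x)) := by gcongr
      _ = Real.exp (l * x ^ 2) := by rw [← Real.exp_add]; ring_nf
      _ ≤ _ := by
        rw [Real.exp_le_exp]
        nlinarith [sq_nonneg x]

lemma one_le_sum_binWeight_mul_exp (hl0 : 0 ≤ l) (hl1 : l ≤ 1)
    (ht : ∀ e ∈ allPairs r, |pairSum t e| ≤ 1) :
    1 ≤ ∑ H : SimpleGraph (Fin r), binWeight l H * Real.exp (∑ x, t x * cdeg l H x) := by
  rw [sum_binWeight_mul_exp]
  refine (Finset.prod_const_one (s := allPairs r)).symm.trans_le ?_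
  exact Finset.prod_le_prod (fun _ _ => zero_le_one)
    fun e he => (bernoulli_factor_bounds hl0 hl1 (ht e he)).1

lemma sum_binWeight_mul_exp_le (hl0 : 0 ≤ l) (hl1 : l ≤ 1)
    (ht : ∀ e ∈ allPairs r, |pairSum t e| ≤ 1) :
    ∑ H : SimpleGraph (Fin r), binWeight l H * Real.exp (∑ x, t x * cdeg l H x) ≤
      Real.exp (∑ e ∈ allPairs r, pairSum t e ^ 2) := by
  rw [sum_binWeight_mul_exp, Real.exp_sum]
  refine Finset.prod_le_prod (fun e he => ?_)
    fun e he => (bernoulli_factor_bounds hl0 hl1 (ht e he)).2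
  exact zero_le_one.trans (bernoulli_factor_bounds hl0 hl1 (ht e he)).1

lemma abs_pairSum_le {τ : ℝ} (ht : ∀ x, |t x| ≤ τ) {e : Sym2 (Fin r)} (he : e ∈ allPairs r) :
    |pairSum t e| ≤ 2 * τ := by
  refine (Finset.abs_sum_le_sum_abs _ _).trans ?_
  calc ∑ x, |if x ∈ e then t x else 0| ≤ ∑ x, if x ∈ e then τ else 0 := by
        refine Finset.sum_le_sum fun x _ => ?_
        split_ifs
        · exact ht x
        · simp
    _ = 2 * τ := by
        rw [← Finset.sum_filter, Finset.sum_const, nsmul_eq_mul]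
        have hd : ¬ e.IsDiag := by simpa [allPairs] using he
        have : (Finset.univ.filter fun x => x ∈ e) = e.toFinset := by
          ext x; simp
        rw [this, Sym2.card_toFinset_of_not_isDiag e hd]
        norm_num

lemma pairSum_add_single (y : Fin r) (c : ℝ) (e : Sym2 (Fin r)) :
    pairSum (fun x => t x + if x = y then c else 0) e =
      pairSum t e + if y ∈ e then c else 0 := by
  have : (if y ∈ e then c else 0) = ∑ x, if x = y then (if x ∈ e then c else 0) else 0 := by
    simp
  rw [pairSum, pairSum, this, ← Finset.sum_add_distrib]
  refine Finset.sum_congr rfl fun x _ => ?_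
  split_ifs <;> simp

lemma sum_sq_pairSum_le {τ : ℝ} (ht : ∀ x, |t x| ≤ τ) :
    ∑ e ∈ allPairs r, pairSum t e ^ 2 ≤ 2 * (r * τ) ^ 2 := by
  calc _ ≤ ∑ e ∈ allPairs r, (2 * τ) ^ 2 := by
        refine Finset.sum_le_sum fun e he => ?_
        rw [← sq_abs]
        exact pow_le_pow_left₀ (abs_nonneg _) (abs_pairSum_le ht he) 2
    _ = (r.choose 2 : ℝ) * (4 * τ ^ 2) := by
        rw [Finset.sum_const, card_allPairs, nsmul_eq_mul]; ring
    _ ≤ (r ^ 2 / 2) * (4 * τ ^ 2) := by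
        gcongr
        have := Nat.choose_le_pow_div (α := ℝ) 2 r
        simpa using this
    _ = _ := by ring

/-- Second moment of a centred degree under the tilted binomial weights. -/
lemma sum_binWeight_mul_exp_mul_sq_le (hl0 : 0 < l) (hl1 : l < 1) {τ : ℝ}
    (hτ1 : τ ≤ 1 / 4) (ht : ∀ x, |t x| ≤ τ) (y : Fin r) :
    ∑ H : SimpleGraph (Fin r),
        binWeight l H * Real.exp (∑ x, t x * cdeg l H x) * cdeg l H y ^ 2 ≤
      16 * r * Real.exp (4 * (r * τ) ^ 2 + 1) := by
  have hr : 1 ≤ r := Fin.pos y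
  have hr' : (1 : ℝ) ≤ r := by exact_mod_cast hr
  have hw : ∀ c : ℝ, |c| ≤ 1 / (2 * √r) →
      ∑ H : SimpleGraph (Fin r), binWeight l H *
        Real.exp (∑ x, (t x + if x = y then c else 0) * cdeg l H x) ≤
      Real.exp (4 * (r * τ) ^ 2 + 1) := by
    intro c hc
    have hs : 1 ≤ √(r : ℝ) := Real.one_le_sqrt.2 hr'
    have hc1 : |c| ≤ 1 / 2 := hc.trans (by
      rw [div_le_div_iff₀ (by positivity) (by norm_num)]; linarith)
    have hc2 : c ^ 2 ≤ 1 / (4 * r) := by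
      rw [← sq_abs]
      refine (pow_le_pow_left₀ (abs_nonneg c) hc 2).trans (le_of_eq ?_)
      rw [div_pow, mul_pow, Real.sq_sqrt (by positivity)]
      norm_num
    refine (sum_binWeight_mul_exp_le hl0.le hl1.le ?_).trans ?_
    · intro e he
      rw [pairSum_add_single]
      refine (abs_add_le _ _).trans ?_
      have h1 := abs_pairSum_le ht he
      have h2 : |if y ∈ e then c else 0| ≤ 1 / 2 := by
        split_ifs
        · exact hc1
        · simp
      linarith
    · rw [Real.exp_le_exp]
      calc ∑ e ∈ allPairs r, pairSum (fun x => t x + if x = y then c else 0) e ^ 2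
          ≤ ∑ e ∈ allPairs r, (2 * pairSum t e ^ 2 + if y ∈ e then 1 / (2 * (r : ℝ)) else 0) := by
            refine Finset.sum_le_sum fun e _ => ?_
            rw [pairSum_add_single]
            split_ifs
            · have : 1 / (2 * (r : ℝ)) = 2 * (1 / (4 * r)) := by field_simp; norm_num
              nlinarith [sq_nonneg (pairSum t e - c)]
            · nlinarith [sq_nonneg (pairSum t e)]
        _ ≤ 2 * (2 * (r * τ) ^ 2) + (r - 1) * (1 / (2 * (r : ℝ))) := by
            rw [Finset.sum_add_distrib, ← Finset.mul_sum, ← Finset.sum_filter, Finset.sum_const,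
              nsmul_eq_mul, card_filter_allPairs]
            have := sum_sq_pairSum_le ht
            linarith
        _ ≤ _ := by
            have : ((r : ℝ) - 1) * (1 / (2 * (r : ℝ))) ≤ 1 := by
              rw [mul_one_div, div_le_one (by positivity)]
              linarith
            linarith
  set c := 1 / (2 * √(r : ℝ)) with hc
  have hc0 : 0 < c := by
    have : 0 < √(r : ℝ) := Real.sqrt_pos.2 (by linarith)
    positivity
  have hcsq : c ^ 2 = 1 / (4 * r) := by
    rw [hc, div_pow, mul_pow, Real.sq_sqrt (by positivity)]
    norm_num
  have hsplit : ∀ (c' : ℝ) (H : SimpleGraph (Fin r)),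
      Real.exp (∑ x, (t x + if x = y then c' else 0) * cdeg l H x) =
      Real.exp (∑ x, t x * cdeg l H x) * Real.exp (c' * cdeg l H y) := by
    intro c' H
    rw [← Real.exp_add]
    congr 1
    simp [add_mul, Finset.sum_add_distrib]
  have hpt : ∀ H : SimpleGraph (Fin r),
      binWeight l H * Real.exp (∑ x, t x * cdeg l H x) * cdeg l H y ^ 2 ≤
      8 * r * (binWeight l H * Real.exp (∑ x, (t x + if x = y then c else 0) * cdeg l H x) +
        binWeight l H * Real.exp (∑ x, (t x + if x = y then -c else 0) * cdeg l H x)) := by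
    intro H
    have hb := (binWeight_pos (H := H) hl0 hl1).le
    rw [hsplit, hsplit]
    have h1 : (c * cdeg l H y) ^ 2 ≤
        2 * (Real.exp (c * cdeg l H y) + Real.exp (-c * cdeg l H y)) := by
      rw [neg_mul]
      have h2 := Real.quadratic_le_exp_of_nonneg (abs_nonneg (c * cdeg l H y))
      rw [sq_abs] at h2
      have h3 := abs_nonneg (c * cdeg l H y)
      have h4 := Real.exp_pos (c * cdeg l H y)
      have h5 := Real.exp_pos (-(c * cdeg l H y))
      rcases abs_cases (c * cdeg l H y) with h | h
      · rw [h.1] at h2 h3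
        linarith
      · rw [h.1] at h2 h3
        linarith
    have h3 : cdeg l H y ^ 2 = 4 * r * (c * cdeg l H y) ^ 2 := by
      rw [mul_pow, hcsq]; field_simp
    rw [h3]
    have h4 : 0 ≤ binWeight l H * Real.exp (∑ x, t x * cdeg l H x) := by positivity
    calc _ ≤ binWeight l H * Real.exp (∑ x, t x * cdeg l H x) *
        (4 * r * (2 * (Real.exp (c * cdeg l H y) + Real.exp (-c * cdeg l H y)))) := by gcongr
      _ = _ := by ring
  refine (Finset.sum_le_sum fun H _ => hpt H).trans ?_
  rw [← Finset.mul_sum, Finset.sum_add_distrib]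
  have h1 := hw c (abs_of_pos hc0).le
  have h2 := hw (-c) (by rw [abs_neg]; exact (abs_of_pos hc0).le)
  have : 16 * (r : ℝ) * Real.exp (4 * (r * τ) ^ 2 + 1) =
    8 * r * (Real.exp (4 * (r * τ) ^ 2 + 1) + Real.exp (4 * (r * τ) ^ 2 + 1)) := by ring
  rw [this]
  gcongr

end mgf

section total

variable {r : ℕ} {l κ τ σ : ℝ} {e : Fin r → ℝ}

lemma sum_approxWeight_bounds (hl0 : 0 < l) (hl1 : l < 1) (hκ : 0 < κ)
    (hτ1 : τ ≤ 1 / 4) (he : ∀ x, |e x / κ| ≤ τ) (h1 : (r * τ) ^ 2 ≤ σ) (h2 : (r : ℝ) ^ 2 / κ ≤ σ)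
    (hσ : σ ≤ 1 / 100) :
    ∑ H, approxWeight l κ e H ≤ Real.exp (48 * σ) ∧
      Real.exp (-(48 * σ)) ≤ ∑ H, approxWeight l κ e H := by
  have hσ0 : 0 ≤ σ := (sq_nonneg _).trans h1
  have hpair : ∀ p ∈ allPairs r, |pairSum (fun x => e x / κ) p| ≤ 1 := fun p hp =>
    (abs_pairSum_le he hp).trans (by linarith)
  have hsplit : ∀ H : SimpleGraph (Fin r), approxWeight l κ e H =
      binWeight l H * Real.exp (∑ x, e x / κ * cdeg l H x) *
        Real.exp (-(∑ x, cdeg l H x ^ 2) / (2 * κ)) := by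
    intro H
    rw [approxWeight, mul_assoc, ← Real.exp_add]
    congr 2
    rw [← Finset.sum_neg_distrib, Finset.sum_div, ← Finset.sum_add_distrib]
    refine Finset.sum_congr rfl fun x _ => ?_
    field_simp
    ring
  constructor
  · calc ∑ H, approxWeight l κ e H
        ≤ ∑ H : SimpleGraph (Fin r), binWeight l H * Real.exp (∑ x, e x / κ * cdeg l H x) := by
          refine Finset.sum_le_sum fun H _ => ?_
          rw [hsplit]
          refine mul_le_of_le_one_right (mul_pos (binWeight_pos hl0 hl1) (Real.exp_pos _)).le ?_
          rw [Real.exp_le_one_iff, neg_div, neg_nonpos]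
          positivity
      _ ≤ Real.exp (∑ p ∈ allPairs r, pairSum (fun x => e x / κ) p ^ 2) :=
          sum_binWeight_mul_exp_le hl0.le hl1.le hpair
      _ ≤ _ := by
          rw [Real.exp_le_exp]
          have := sum_sq_pairSum_le he
          linarith
  · have hlow : ∑ H : SimpleGraph (Fin r), (binWeight l H * Real.exp (∑ x, e x / κ * cdeg l H x) -
        1 / (2 * κ) * ∑ y, binWeight l H * Real.exp (∑ x, e x / κ * cdeg l H x) *
          cdeg l H y ^ 2) ≤ ∑ H, approxWeight l κ e H := by
      refine Finset.sum_le_sum fun H _ => ?_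
      rw [hsplit, ← Finset.mul_sum]
      set A := binWeight l H * Real.exp (∑ x, e x / κ * cdeg l H x) with hA
      have hA0 : 0 ≤ A := (mul_pos (binWeight_pos hl0 hl1) (Real.exp_pos _)).le
      set B := ∑ y, cdeg l H y ^ 2
      have := Real.add_one_le_exp (-B / (2 * κ))
      calc A - 1 / (2 * κ) * (A * B) = A * (-B / (2 * κ) + 1) := by ring
        _ ≤ _ := by gcongr
    refine le_trans ?_ hlow
    rw [Finset.sum_sub_distrib, ← Finset.mul_sum, Finset.sum_comm]
    have hA := one_le_sum_binWeight_mul_exp hl0.le hl1.le hpair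
    have hB : ∑ y, ∑ H : SimpleGraph (Fin r), binWeight l H *
        Real.exp (∑ x, e x / κ * cdeg l H x) * cdeg l H y ^ 2 ≤
        ∑ _y : Fin r, 16 * (r : ℝ) * Real.exp (4 * (r * τ) ^ 2 + 1) :=
      Finset.sum_le_sum fun y _ => sum_binWeight_mul_exp_mul_sq_le hl0 hl1 hτ1 he y
    have hexp : Real.exp (4 * (r * τ) ^ 2 + 1) ≤ 3 := by
      have h3 : Real.exp (4 * (r * τ) ^ 2 + 1) ≤ Real.exp (1 / 25 + 1) := by
        rw [Real.exp_le_exp]; linarith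
      refine h3.trans ?_
      rw [Real.exp_add]
      have h4 := Real.exp_one_lt_d9
      have h5 : Real.exp (1 / 25) ≤ 1 / (1 - 1 / 25) :=
        Real.exp_bound_div_one_sub_of_interval (by norm_num) (by norm_num)
      have h6 := Real.exp_pos (1 / 25)
      nlinarith
    have hC : 1 / (2 * κ) * ∑ _y : Fin r, 16 * (r : ℝ) * Real.exp (4 * (r * τ) ^ 2 + 1) ≤
        24 * σ := by
      rw [Finset.sum_const, Finset.card_univ, Fintype.card_fin, nsmul_eq_mul]
      calc _ = 8 * Real.exp (4 * (r * τ) ^ 2 + 1) * ((r : ℝ) ^ 2 / κ) := by field_simp; ring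
        _ ≤ 8 * 3 * σ := by gcongr
        _ = _ := by ring
    have hD := mul_le_mul_of_nonneg_left hB (show 0 ≤ 1 / (2 * κ) by positivity)
    have hE := exp_le_one_add (x := -(24 * σ)) (by
      rw [abs_neg, abs_of_nonneg (by positivity)]; linarith)
    have hF : Real.exp (-(48 * σ)) ≤ Real.exp (-(24 * σ) - 2 * (-(24 * σ)) ^ 2) := by
      rw [Real.exp_le_exp]
      nlinarith
    linarith

end total

section prob

variable {n r : ℕ} {d : Fin n → ℕ} {φ : Fin r ↪ Fin n}

lemma induced_edge_ratio {D δ l θ z ξ : ℝ} (hd : ∀ v, |(d v : ℝ) - D| ≤ δ)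
    (hD : ∑ v, (d v : ℝ) = n * D) (hl : D = l * (n - 1)) (hl0 : 0 < l) (hl1 : l < 1)
    (hrn : 2 * (r : ℝ) ≤ n) {s : ℕ} (hs : 0 < s)
    (hsn' : (s : ℝ) ≤ n) (hκ : 2 * (δ + r) ≤ s) (h0 : 0 ≤ (n : ℝ) - 1 - D - (δ + r))
    (hsn : n * (16 * s + 3 * (δ + r)) < (D - (δ + r)) * (n - 1 - D - (δ + r)))
    (hβ : 2 * (δ + r) * (10 * ((n : ℝ) ^ 2 * (2 * s + 1) / 9 ^ s)) ≤ 1)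
    (hθ : θ = (6 + 28 * (δ + r) ^ 2 / s) / n)
    (hz : (2 * (δ + r) / n + θ) / (l * (1 - l)) ≤ z) (hz2 : z ≤ 1 / 2)
    (hξ : 1 / (l * (1 - l) * n) + θ / (l * (1 - l)) + 2 * z ^ 2 ≤ ξ)
    (H : SimpleGraph (Fin r)) (a b : Fin r) (hab : a ≠ b) (hH : ¬ H.Adj a b) :
    inducedCount d φ (H ⊔ SimpleGraph.edge a b) *
          approxWeight l (l * (1 - l) * n) (fun x => d (φ x) - D) H ≤
        Real.exp ξ * (inducedCount d φ H *
          approxWeight l (l * (1 - l) * n) (fun x => d (φ x) - D) (H ⊔ SimpleGraph.edge a b)) ∧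
      Real.exp (-ξ) * (inducedCount d φ H *
          approxWeight l (l * (1 - l) * n) (fun x => d (φ x) - D) (H ⊔ SimpleGraph.edge a b)) ≤
        inducedCount d φ (H ⊔ SimpleGraph.edge a b) *
          approxWeight l (l * (1 - l) * n) (fun x => d (φ x) - D) H := by
  have key := induced_edge_estimate (φ := φ) hd hD hl hl0.le hl1.le hrn hab hH hs hsn' hκ h0 hsn hβ
  rw [← hθ] at key
  have hm : 0 < 1 - l := by linarith
  have hr1 : (1 : ℝ) ≤ r := by exact_mod_cast Fin.pos a
  have hn : (0 : ℝ) < n := by linarith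
  have hμ : 0 < l * (1 - l) := by positivity
  have hcnt : ∀ K, 0 ≤ inducedCount d φ K := fun K => by rw [inducedCount]; positivity
  have hc : ∀ x, |cdeg l H x| ≤ r := fun x => abs_deg_sub_le H x hl0.le hl1.le
  have hyle : |((d (φ a) : ℝ) - D + (d (φ b) - D) - (deg H a - l * (r - 1)) -
      (deg H b - l * (r - 1))) / n| ≤ 2 * (δ + r) / n := by
    rw [abs_div, abs_of_pos hn]
    gcongr
    have h1 := abs_le.1 (hd (φ a))
    have h2 := abs_le.1 (hd (φ b))
    have h3 := abs_le.1 (abs_deg_sub_le H a hl0.le hl1.le)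
    have h4 := abs_le.1 (abs_deg_sub_le H b hl0.le hl1.le)
    rw [abs_le]
    constructor <;> linarith
  have hW := approxWeight_sup_edge (l := l) (κ := l * (1 - l) * n)
    (e := fun x => (d (φ x) : ℝ) - D) hab hH
  set g := (((d (φ a) : ℝ) - D) + (d (φ b) - D) - cdeg l H a - cdeg l H b - 1) /
    (l * (1 - l) * n) with hg
  have hodds := odds_le (g := g) (ξ := ξ) (z := z) rfl (add_nonneg (hcnt _) (hcnt _)) hl0 hl1 key
    ((div_le_div_of_nonneg_right (by linarith) hμ.le).trans hz) hz2 (by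
      refine le_trans (le_of_eq ?_) hξ
      congr 2
      have : g - ((d (φ a) : ℝ) - D + (d (φ b) - D) - (deg H a - l * (r - 1)) -
          (deg H b - l * (r - 1))) / n / (l * (1 - l)) = -(1 / (l * (1 - l) * n)) := by
        rw [hg, cdeg, cdeg]
        field_simp
        ring
      rw [this, abs_neg, abs_of_pos (by positivity)])
  have hWH := approxWeight_pos (r := r) (κ := l * (1 - l) * n)
    (e := fun x => (d (φ x) : ℝ) - D) (H := H) hl0 hl1
  generalize approxWeight l (l * (1 - l) * n) (fun x => d (φ x) - D)
    (H ⊔ SimpleGraph.edge a b) = Wp at *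
  generalize approxWeight l (l * (1 - l) * n) (fun x => d (φ x) - D) H = W at *
  generalize inducedCount d φ (H ⊔ SimpleGraph.edge a b) = P at *
  generalize inducedCount d φ H = Q at *
  rw [Real.exp_add, Real.exp_add] at hodds
  constructor
  · refine le_of_mul_le_mul_right (?_ : _ * (1 - l) ≤ _ * (1 - l)) hm
    calc P * W * (1 - l) = P * (1 - l) * W := by ring
      _ ≤ Real.exp ξ * Real.exp g * (Q * l) * W :=
        mul_le_mul_of_nonneg_right hodds.1 hWH.le
      _ = Real.exp ξ * Q * (W * l * Real.exp g) := by ring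
      _ = _ := by rw [← hW]; ring
  · refine le_of_mul_le_mul_right (?_ : _ * (1 - l) ≤ _ * (1 - l)) hm
    calc Real.exp (-ξ) * (Q * Wp) * (1 - l) = Real.exp (-ξ) * Q * (Wp * (1 - l)) := by ring
      _ = Real.exp (-ξ) * Real.exp g * (Q * l) * W := by rw [hW]; ring
      _ ≤ P * (1 - l) * W :=
        mul_le_mul_of_nonneg_right hodds.2 hWH.le
      _ = _ := by ring

/-- The probability that the vertices `φ` induce exactly the graph `H`. -/
lemma induced_probability {D δ l θ z ξ τ σ : ℝ} (hd : ∀ v, |(d v : ℝ) - D| ≤ δ)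
    (hD : ∑ v, (d v : ℝ) = n * D) (hl : D = l * (n - 1)) (hl0 : 0 < l) (hl1 : l < 1) (hn : 0 < n)
    (hrn : 2 * (r : ℝ) ≤ n) {s : ℕ} (hs : 0 < s)
    (hsn' : (s : ℝ) ≤ n) (hκ : 2 * (δ + r) ≤ s) (h0 : 0 ≤ (n : ℝ) - 1 - D - (δ + r))
    (hsn : n * (16 * s + 3 * (δ + r)) < (D - (δ + r)) * (n - 1 - D - (δ + r)))
    (hβ : 2 * (δ + r) * (10 * ((n : ℝ) ^ 2 * (2 * s + 1) / 9 ^ s)) ≤ 1)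
    (hθ : θ = (6 + 28 * (δ + r) ^ 2 / s) / n)
    (hz : (2 * (δ + r) / n + θ) / (l * (1 - l)) ≤ z) (hz2 : z ≤ 1 / 2)
    (hξ : 1 / (l * (1 - l) * n) + θ / (l * (1 - l)) + 2 * z ^ 2 ≤ ξ)
    (hτ : δ / (l * (1 - l) * n) ≤ τ) (hτ1 : τ ≤ 1 / 4) (h1 : (r * τ) ^ 2 ≤ σ)
    (h2 : (r : ℝ) ^ 2 / (l * (1 - l) * n) ≤ σ) (hσ : σ ≤ 1 / 100)
    (hne : (degFinset n d).Nonempty) (H : SimpleGraph (Fin r)) :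
    inducedCount d φ H / (degFinset n d).card ≤ Real.exp (r ^ 2 * ξ + 48 * σ) *
        approxWeight l (l * (1 - l) * n) (fun x => d (φ x) - D) H ∧
      Real.exp (-(r ^ 2 * ξ + 48 * σ)) *
        approxWeight l (l * (1 - l) * n) (fun x => d (φ x) - D) H ≤
          inducedCount d φ H / (degFinset n d).card := by
  have hm : 0 < 1 - l := by linarith
  have hn' : (0 : ℝ) < n := by exact_mod_cast hn
  have hμ : 0 < l * (1 - l) * n := by positivity
  have hδ : 0 ≤ δ := (abs_nonneg _).trans (hd ⟨0, hn⟩)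
  have hξ0 : 0 ≤ ξ := by
    refine le_trans ?_ hξ
    rw [hθ]
    positivity
  have hratio := induced_edge_ratio (φ := φ) hd hD hl hl0 hl1 hrn hs hsn' hκ h0 hsn hβ hθ hz hz2 hξ
  set W := approxWeight l (l * (1 - l) * n) (fun x => (d (φ x) : ℝ) - D) with hWdef
  have hW : ∀ K, 0 < W K := fun K => approxWeight_pos hl0 hl1
  have hchain := chain_le hW hratio
  have hM : ∀ K : SimpleGraph (Fin r), (numEdges K : ℝ) * ξ ≤ r.choose 2 * ξ := fun K => by
    gcongr
    exact numEdges_le_choose_two K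
  have hcnt : ∀ K, 0 ≤ inducedCount d φ K := fun K => by rw [inducedCount]; positivity
  have hnorm := normalize_le (N := inducedCount d φ) (α := inducedCount d φ ⊥) (c := W ⊥)
    (β := r.choose 2 * ξ) hW (hW ⊥) (fun K => by
      obtain ⟨h3, h4⟩ := hchain K
      have h5 : 0 ≤ inducedCount d φ ⊥ * W K := mul_nonneg (hcnt _) (hW K).le
      constructor
      · refine h3.trans (mul_le_mul_of_nonneg_right (Real.exp_le_exp.2 (hM K)) h5)
      · refine le_trans (mul_le_mul_of_nonneg_right (Real.exp_le_exp.2 ?_) h5) h4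
        linarith [hM K]) (by
      rw [sum_inducedCount]
      exact_mod_cast hne.card_pos) H
  rw [sum_inducedCount] at hnorm
  obtain ⟨hS1, hS2⟩ := sum_approxWeight_bounds (r := r) (e := fun x => (d (φ x) : ℝ) - D)
    (τ := τ) hl0 hl1 hμ hτ1 (fun x => by
      rw [abs_div, abs_of_pos hμ]
      exact (div_le_div_of_nonneg_right (hd _) hμ.le).trans hτ) h1 h2 hσ
  rw [← hWdef] at hS1 hS2
  have hS : 0 < ∑ K, W K := (Real.exp_pos _).trans_le hS2
  have hr2 : 2 * ((r.choose 2 : ℝ) * ξ) ≤ r ^ 2 * ξ := by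
    have := Nat.choose_le_pow_div (α := ℝ) 2 r
    have h3 : (r.choose 2 : ℝ) ≤ r ^ 2 / 2 := by simpa using this
    nlinarith
  have hWH := hW H
  constructor
  · refine hnorm.1.trans ?_
    rw [Real.exp_add, mul_assoc]
    refine mul_le_mul (Real.exp_le_exp.2 hr2) ?_ (div_nonneg hWH.le hS.le) (Real.exp_pos _).le
    rw [div_le_iff₀ hS]
    calc W H = W H * (Real.exp (48 * σ) * Real.exp (-(48 * σ))) := by
          rw [← Real.exp_add]; simp
      _ ≤ W H * (Real.exp (48 * σ) * ∑ K, W K) := by gcongr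
      _ = _ := by ring
  · refine le_trans ?_ hnorm.2
    rw [neg_add, Real.exp_add, mul_assoc]
    refine mul_le_mul (Real.exp_le_exp.2 (by linarith)) ?_ (by positivity) (Real.exp_pos _).le
    rw [le_div_iff₀ hS]
    calc _ = W H * (Real.exp (-(48 * σ)) * ∑ K, W K) := by ring
      _ ≤ W H * (Real.exp (-(48 * σ)) * Real.exp (48 * σ)) := by gcongr
      _ = W H := by rw [← Real.exp_add]; simp

end prob

section copies

variable {n r : ℕ} {G : SimpleGraph (Fin n)} {H : SimpleGraph (Fin r)}

lemma card_embeddings_same_image {φ₀ : Fin r ↪ Fin n} (h₀ : G.comap φ₀ = H) :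
    (Finset.univ.filter fun φ : Fin r ↪ Fin n =>
      G.comap φ = H ∧ Finset.univ.map φ = Finset.univ.map φ₀).card = autCard H := by
  have hadj : ∀ x y, G.Adj (φ₀ x) (φ₀ y) ↔ H.Adj x y := fun x y => by
    rw [← h₀, SimpleGraph.comap_adj]
  rw [autCard]
  symm
  refine Finset.card_bij (fun π _ => π.toEmbedding.trans φ₀) ?_ ?_ ?_
  · intro π hπ
    rw [Finset.mem_filter] at hπ ⊢
    refine ⟨Finset.mem_univ _, ?_, ?_⟩
    · ext x y
      rw [SimpleGraph.comap_adj]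
      exact (hadj _ _).trans (hπ.2 x y)
    · rw [← Finset.map_map, Finset.map_univ_equiv]
  · intro π _ π' _ h
    ext x
    have := DFunLike.congr_fun h x
    exact congrArg Fin.val (φ₀.injective this)
  · intro φ hφ
    rw [Finset.mem_filter] at hφ
    obtain ⟨_, hφ1, hφ2⟩ := hφ
    have hex : ∀ x, ∃ y, φ₀ y = φ x := fun x => by
      have : φ x ∈ Finset.univ.map φ₀ := by rw [← hφ2]; simp
      simpa using this
    choose f hf using hex
    have hinj : Function.Injective f := fun x y h => φ.injective (by rw [← hf, ← hf, h])
    refine ⟨Equiv.ofBijective f (Finite.injective_iff_bijective.1 hinj), ?_, ?_⟩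
    · rw [Finset.mem_filter]
      refine ⟨Finset.mem_univ _, fun x y => ?_⟩
      rw [← hadj]
      simp only [Equiv.ofBijective_apply, hf]
      rw [← SimpleGraph.comap_adj, hφ1]
    · ext x
      simp [hf]

lemma isCopy_iff {S : Finset (Fin n)} :
    (S.card = r ∧ Nonempty ((G.induce (S : Set (Fin n))) ≃g H)) ↔
      ∃ φ₀ : Fin r ↪ Fin n, G.comap φ₀ = H ∧ Finset.univ.map φ₀ = S := by
  constructor
  · rintro ⟨_, ⟨ψ⟩⟩
    refine ⟨ψ.symm.toEquiv.toEmbedding.trans (Function.Embedding.subtype _), ?_, ?_⟩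
    · ext x y
      exact ψ.symm.map_rel_iff
    · rw [← Finset.map_map, Finset.map_univ_equiv]
      ext v
      simp
  · rintro ⟨φ₀, h1, rfl⟩
    refine ⟨by simp, ⟨SimpleGraph.Iso.symm ⟨Equiv.ofBijective (fun x => ⟨φ₀ x, by simp⟩) ⟨?_, ?_⟩,
      ?_⟩⟩⟩
    · intro x y h
      exact φ₀.injective (congrArg Subtype.val h)
    · rintro ⟨v, hv⟩
      obtain ⟨x, rfl⟩ : ∃ x, φ₀ x = v := by simpa using hv
      exact ⟨x, rfl⟩
    · intro x y
      rw [← h1]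
      rfl

lemma indCount_mul_autCard :
    indCount H G * autCard H =
      (Finset.univ.filter fun φ : Fin r ↪ Fin n => G.comap φ = H).card := by
  have h := Finset.card_eq_sum_card_fiberwise
    (s := Finset.univ.filter fun φ : Fin r ↪ Fin n => G.comap φ = H)
    (f := fun φ => Finset.univ.map φ)
    (t := Finset.univ.filter fun S : Finset (Fin n) =>
      S.card = r ∧ Nonempty ((G.induce (S : Set (Fin n))) ≃g H)) (fun φ hφ => by
        rw [Finset.mem_coe, Finset.mem_filter] at hφ ⊢
        exact ⟨Finset.mem_univ _, isCopy_iff.2 ⟨φ, hφ.2, rfl⟩⟩)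
  rw [h, indCount, ← smul_eq_mul, ← Finset.sum_const]
  refine Finset.sum_congr rfl fun S hS => ?_
  rw [Finset.mem_filter] at hS
  obtain ⟨φ₀, h1, rfl⟩ := isCopy_iff.1 hS.2
  rw [Finset.filter_filter, card_embeddings_same_image h1]

lemma autCard_pos : 0 < autCard H :=
  Finset.card_pos.2 ⟨1, by simp⟩

lemma expInd_eq_sum (d : Fin n → ℕ) :
    expInd n d H = (∑ φ : Fin r ↪ Fin n, inducedCount d φ H / (degFinset n d).card) /
      autCard H := by
  have ha : (autCard H : ℝ) ≠ 0 := by exact_mod_cast (autCard_pos (H := H)).ne'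
  have h : (∑ G ∈ degFinset n d, (indCount H G : ℝ)) * autCard H =
      ∑ φ : Fin r ↪ Fin n, inducedCount d φ H := by
    rw [Finset.sum_mul]
    have h1 : ∀ G, (indCount H G : ℝ) * autCard H =
        ∑ φ : Fin r ↪ Fin n, if G.comap φ = H then 1 else 0 := fun G => by
      rw [← Nat.cast_mul, indCount_mul_autCard, Finset.card_filter]
      push_cast
      rfl
    rw [Finset.sum_congr rfl fun G _ => h1 G, Finset.sum_comm]
    refine Finset.sum_congr rfl fun φ _ => ?_
    rw [inducedCount, Finset.card_filter]
    push_cast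
    rfl
  rw [← Finset.sum_div, ← h, expInd]
  field_simp

end copies

section average

variable {V : Type*} [Fintype V]

lemma sum_embedding_succ {r : ℕ} (f : Fin (r + 1) → V → ℝ) :
    ∑ φ : Fin (r + 1) ↪ V, ∏ x, f x (φ x) =
      ∑ ψ : Fin r ↪ V, (∑ v ∈ (Finset.univ.map ψ)ᶜ, f 0 v) * ∏ x, f x.succ (ψ x) := by
  rw [← (Equiv.embeddingFinSucc r V).symm.sum_comp, Fintype.sum_sigma]
  refine Finset.sum_congr rfl fun ψ _ => ?_
  rw [Finset.sum_mul]
  have h : ∀ v, v ∈ (Finset.univ.map ψ)ᶜ ↔ v ∉ Set.range ψ := fun v => by simp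
  rw [Finset.sum_subtype _ h]
  refine Fintype.sum_congr _ _ fun v => ?_
  rw [Fin.prod_univ_succ]
  simp

lemma card_compl_map {r : ℕ} (ψ : Fin r ↪ V) :
    ((Finset.univ.map ψ)ᶜ).card = Fintype.card V - r := by
  rw [Finset.card_compl, Finset.card_map, Finset.card_univ, Fintype.card_fin]

lemma card_embedding_succ (r : ℕ) :
    Fintype.card (Fin (r + 1) ↪ V) = (Fintype.card V - r) * Fintype.card (Fin r ↪ V) := by
  rw [Fintype.card_embedding_eq, Fintype.card_embedding_eq, Fintype.card_fin, Fintype.card_fin,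
    Nat.descFactorial_succ]

lemma sum_embedding_prod_le {r k : ℕ} (hk : r ≤ k) {f : Fin r → V → ℝ} {c : Fin r → ℝ}
    (hf : ∀ x v, 0 ≤ f x v) (hc : ∀ x, 0 ≤ c x)
    (h : ∀ x, ∀ U : Finset V, Fintype.card V - k ≤ U.card → ∑ v ∈ U, f x v ≤ c x * U.card) :
    ∑ φ : Fin r ↪ V, ∏ x, f x (φ x) ≤ (∏ x, c x) * Fintype.card (Fin r ↪ V) := by
  induction r with
  | zero => simp
  | succ r ih =>
    have ih' := ih (by omega) (f := fun x => f x.succ) (c := fun x => c x.succ)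
      (fun x => hf _) (fun x => hc _) (fun x => h _)
    rw [sum_embedding_succ, card_embedding_succ, Fin.prod_univ_succ]
    have h0 := hc 0
    calc _ ≤ ∑ ψ : Fin r ↪ V, (c 0 * (Fintype.card V - r : ℕ)) * ∏ x, f x.succ (ψ x) := by
          refine Finset.sum_le_sum fun ψ _ => mul_le_mul_of_nonneg_right ?_
            (Finset.prod_nonneg fun x _ => hf _ _)
          refine (h 0 _ ?_).trans_eq ?_
          · rw [card_compl_map]; omega
          · rw [card_compl_map]
      _ = (c 0 * (Fintype.card V - r : ℕ)) * ∑ ψ : Fin r ↪ V, ∏ x, f x.succ (ψ x) := by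
          rw [Finset.mul_sum]
      _ ≤ (c 0 * (Fintype.card V - r : ℕ)) * ((∏ x : Fin r, c x.succ) *
            Fintype.card (Fin r ↪ V)) := by gcongr
      _ = _ := by push_cast; ring

lemma le_sum_embedding_prod {r k : ℕ} (hk : r ≤ k) {f : Fin r → V → ℝ} {c : Fin r → ℝ}
    (hf : ∀ x v, 0 ≤ f x v) (hc : ∀ x, 0 ≤ c x)
    (h : ∀ x, ∀ U : Finset V, Fintype.card V - k ≤ U.card → c x * U.card ≤ ∑ v ∈ U, f x v) :
    (∏ x, c x) * Fintype.card (Fin r ↪ V) ≤ ∑ φ : Fin r ↪ V, ∏ x, f x (φ x) := by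
  induction r with
  | zero => simp
  | succ r ih =>
    have ih' := ih (by omega) (f := fun x => f x.succ) (c := fun x => c x.succ)
      (fun x => hf _) (fun x => hc _) (fun x => h _)
    rw [sum_embedding_succ, card_embedding_succ, Fin.prod_univ_succ]
    have h0 := hc 0
    calc _ = (c 0 * (Fintype.card V - r : ℕ)) * ((∏ x : Fin r, c x.succ) *
            Fintype.card (Fin r ↪ V)) := by push_cast; ring
      _ ≤ (c 0 * (Fintype.card V - r : ℕ)) * ∑ ψ : Fin r ↪ V, ∏ x, f x.succ (ψ x) := by gcongr
      _ = ∑ ψ : Fin r ↪ V, (c 0 * (Fintype.card V - r : ℕ)) * ∏ x, f x.succ (ψ x) := by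
          rw [Finset.mul_sum]
      _ ≤ _ := by
          refine Finset.sum_le_sum fun ψ _ => mul_le_mul_of_nonneg_right ?_
            (Finset.prod_nonneg fun x _ => hf _ _)
          refine le_trans (le_of_eq ?_) (h 0 _ ?_)
          · rw [card_compl_map]
          · rw [card_compl_map]; omega

lemma abs_exp_sub_quadratic_le {x : ℝ} (hx : |x| ≤ 1) :
    |Real.exp x - (1 + x + x ^ 2 / 2)| ≤ |x| ^ 3 := by
  have h := Real.exp_bound hx (n := 3) (by norm_num)
  have h2 : ∑ m ∈ Finset.range 3, x ^ m / (m.factorial : ℝ) = 1 + x + x ^ 2 / 2 := by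
    simp [Finset.sum_range_succ, Nat.factorial]
  rw [h2] at h
  refine h.trans ?_
  have : (Nat.succ 3 : ℝ) / ((Nat.factorial 3 : ℕ) * ((3 : ℕ) : ℝ)) ≤ 1 := by
    norm_num [Nat.factorial]
  exact mul_le_of_le_one_right (by positivity) this

lemma exists_eq_one_add_mul (A w : ℝ) {c : ℝ} (hc : c ≠ 0) : ∃ η, A = (1 + (w + η)) * c :=
  ⟨A / c - 1 - w, by field_simp; ring⟩

lemma exp_sub_le_one_add {w a q η : ℝ} (hw : 0 ≤ w) (hwa : w ≤ a ^ 2) (ha : 0 ≤ a)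
    (ha1 : a ≤ 1 / 2) (haq : a ^ 3 ≤ q) (hq : q ≤ 1 / 4) (hη : |η| ≤ q) :
    Real.exp (w / 2 - 4 * q) ≤ 1 + (w / 2 + η) := by
  have hη' := abs_le.1 hη
  have hq0 : 0 ≤ q := (abs_nonneg _).trans hη
  have ha2 : a ^ 2 ≤ 1 / 4 := by nlinarith
  refine le_trans (Real.exp_le_exp.2 ?_) (exp_le_one_add ?_)
  · have h1 : (w / 2 + η) ^ 2 ≤ w ^ 2 / 2 + 2 * η ^ 2 := by nlinarith [sq_nonneg (w / 2 - η)]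
    have h2 : w ^ 2 ≤ q := by
      calc w ^ 2 ≤ (a ^ 2) ^ 2 := by gcongr
        _ = a * a ^ 3 := by ring
        _ ≤ 1 * a ^ 3 := by gcongr; linarith
        _ ≤ q := by linarith
    have h3 : η ^ 2 ≤ q / 4 := by
      have : η ^ 2 ≤ q ^ 2 := sq_le_sq' hη'.1 hη'.2
      nlinarith
    linarith
  · rw [abs_le]
    constructor <;> linarith

/-- Exponential moment of a bounded centred function over a large subset. -/
lemma sum_exp_mul_bounds {e : V → ℝ} {δ R t q : ℝ} {k : ℕ} (he : ∀ v, |e v| ≤ δ)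
    (h0 : ∑ v, e v = 0) (hR : ∑ v, e v ^ 2 = Fintype.card V * R) (hk : 2 * k ≤ Fintype.card V)
    (hV : 0 < Fintype.card V) (hδt : δ * |t| ≤ 1 / 2)
    (hq : 4 * (k * (δ * |t|) / Fintype.card V) + (δ * |t|) ^ 3 ≤ q) (hq1 : q ≤ 1 / 4)
    {U : Finset V} (hU : Fintype.card V - k ≤ U.card) :
    ∑ v ∈ U, Real.exp (e v * t) ≤ Real.exp (R * t ^ 2 / 2 + 4 * q) * U.card ∧
      Real.exp (R * t ^ 2 / 2 - 4 * q) * U.card ≤ ∑ v ∈ U, Real.exp (e v * t) := by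
  obtain ⟨v0⟩ := Fintype.card_pos_iff.1 hV
  have hδ : 0 ≤ δ := (abs_nonneg _).trans (he v0)
  set n := Fintype.card V with hn
  have hn' : (0 : ℝ) < n := by exact_mod_cast hV
  have hk' : 2 * (k : ℝ) ≤ n := by exact_mod_cast hk
  have hUr : (n : ℝ) - k ≤ U.card := by
    have : n ≤ U.card + k := by omega
    have : (n : ℝ) ≤ U.card + k := by exact_mod_cast this
    linarith
  have hUc : (Uᶜ.card : ℝ) ≤ k := by
    have := Finset.card_compl_add_card U
    have : Uᶜ.card ≤ k := by omega
    exact_mod_cast this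
  have hUcc : (Uᶜ.card : ℝ) + U.card = n := by exact_mod_cast Finset.card_compl_add_card U
  have hU0 : (0 : ℝ) < U.card := by linarith
  set a := δ * |t| with ha
  have ha0 : 0 ≤ a := by positivity
  have het : ∀ v, |e v * t| ≤ a := fun v => by
    rw [abs_mul]; exact mul_le_mul_of_nonneg_right (he v) (abs_nonneg t)
  have hsq : ∀ v, e v ^ 2 ≤ δ ^ 2 := fun v => sq_le_sq' (abs_le.1 (he v)).1 (abs_le.1 (he v)).2
  have hR0 : 0 ≤ R := by
    have : 0 ≤ n * R := by rw [← hR]; positivity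
    exact nonneg_of_mul_nonneg_right this hn'
  have hRδ : R ≤ δ ^ 2 := by
    have : n * R ≤ n * δ ^ 2 := by
      rw [← hR]
      refine (Finset.sum_le_sum fun v _ => hsq v).trans ?_
      simp [hn]
    exact le_of_mul_le_mul_left this hn'
  have hlin : |∑ v ∈ U, e v| ≤ k * δ := by
    have h1 := Finset.sum_add_sum_compl U e
    rw [h0] at h1
    have h2 : ∑ v ∈ U, e v = -∑ v ∈ Uᶜ, e v := by linarith
    rw [h2, abs_neg]
    refine (Finset.abs_sum_le_sum_abs _ _).trans ((Finset.sum_le_sum fun v _ => he v).trans ?_)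
    rw [Finset.sum_const, nsmul_eq_mul]
    gcongr
  have hquad : |∑ v ∈ U, e v ^ 2 - U.card * R| ≤ k * δ ^ 2 := by
    have h1 := Finset.sum_add_sum_compl U fun v => e v ^ 2
    rw [hR, ← hUcc] at h1
    have h2 : ∑ v ∈ U, e v ^ 2 - U.card * R = Uᶜ.card * R - ∑ v ∈ Uᶜ, e v ^ 2 := by linarith
    have h3 : ∑ v ∈ Uᶜ, e v ^ 2 ≤ Uᶜ.card * δ ^ 2 := by
      refine (Finset.sum_le_sum fun v _ => hsq v).trans ?_
      rw [Finset.sum_const, nsmul_eq_mul]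
    have h4 : 0 ≤ ∑ v ∈ Uᶜ, e v ^ 2 := by positivity
    have h5 : (Uᶜ.card : ℝ) * R ≤ k * δ ^ 2 := by gcongr
    have h6 : (Uᶜ.card : ℝ) * δ ^ 2 ≤ k * δ ^ 2 := by gcongr
    have h7 : 0 ≤ (Uᶜ.card : ℝ) * R := by positivity
    rw [h2, abs_le]
    constructor <;> linarith
  have hcub : |∑ v ∈ U, Real.exp (e v * t) - ∑ v ∈ U, (1 + e v * t + (e v * t) ^ 2 / 2)| ≤
      U.card * a ^ 3 := by
    rw [← Finset.sum_sub_distrib]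
    refine (Finset.abs_sum_le_sum_abs _ _).trans ?_
    rw [← nsmul_eq_mul, ← Finset.sum_const]
    refine Finset.sum_le_sum fun v _ => ?_
    refine (abs_exp_sub_quadratic_le ((het v).trans (by linarith))).trans ?_
    exact pow_le_pow_left₀ (abs_nonneg _) (het v) 3
  have hexpand : ∑ v ∈ U, (1 + e v * t + (e v * t) ^ 2 / 2) =
      U.card + t * ∑ v ∈ U, e v + t ^ 2 / 2 * ∑ v ∈ U, e v ^ 2 := by
    rw [Finset.mul_sum, Finset.mul_sum, ← nsmul_one, ← Finset.sum_const, ← Finset.sum_add_distrib,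
      ← Finset.sum_add_distrib]
    refine Finset.sum_congr rfl fun v _ => ?_
    ring
  have ht2 : δ ^ 2 * t ^ 2 ≤ a := by
    have : δ ^ 2 * t ^ 2 = a * a := by rw [ha, ← sq_abs t]; ring
    rw [this]
    nlinarith
  have hA : |t * ∑ v ∈ U, e v| ≤ k * a := by
    rw [abs_mul]
    calc |t| * |∑ v ∈ U, e v| ≤ |t| * (k * δ) := by gcongr
      _ = k * a := by rw [ha]; ring
  have hB : |t ^ 2 / 2 * (∑ v ∈ U, e v ^ 2 - U.card * R)| ≤ k * a := by
    rw [abs_mul, abs_of_nonneg (by positivity)]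
    calc t ^ 2 / 2 * |∑ v ∈ U, e v ^ 2 - U.card * R| ≤ t ^ 2 / 2 * (k * δ ^ 2) := by gcongr
      _ = k / 2 * (δ ^ 2 * t ^ 2) := by ring
      _ ≤ k / 2 * a := by gcongr
      _ ≤ k * a := by
        have : 0 ≤ k * a := by positivity
        linarith
  have hka : 2 * (k * a) ≤ U.card * (4 * (k * a / n)) := by
    rw [mul_div_assoc', mul_div_assoc', le_div_iff₀ hn']
    have : (n : ℝ) ≤ 2 * U.card := by linarith
    have h2 : 0 ≤ k * a := by positivity
    nlinarith
  obtain ⟨η, hη⟩ := exists_eq_one_add_mul (∑ v ∈ U, Real.exp (e v * t)) (R * t ^ 2 / 2) hU0.ne'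
  have hηq : |η| ≤ q := by
    have h1 : η * U.card = (∑ v ∈ U, Real.exp (e v * t) -
        ∑ v ∈ U, (1 + e v * t + (e v * t) ^ 2 / 2)) + t * ∑ v ∈ U, e v +
        t ^ 2 / 2 * (∑ v ∈ U, e v ^ 2 - U.card * R) := by
      rw [hexpand, hη]; ring
    have h2 : |η * U.card| ≤ q * U.card := by
      rw [h1]
      refine (abs_add_three _ _ _).trans ?_
      have h3 : (4 * (k * a / n) + a ^ 3) * U.card ≤ q * U.card := by gcongr
      linarith
    rw [abs_mul, abs_of_pos hU0] at h2
    exact le_of_mul_le_mul_right h2 hU0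
  have hq0 : 0 ≤ q := (abs_nonneg _).trans hηq
  have hη' := abs_le.1 hηq
  have hRt : R * t ^ 2 ≤ a ^ 2 := by
    rw [ha, mul_pow, sq_abs]
    gcongr
  have hRt0 : 0 ≤ R * t ^ 2 := by positivity
  have ha3 : a ^ 3 ≤ q := by
    refine le_trans ?_ hq
    have : 0 ≤ 4 * (k * a / n) := by positivity
    linarith
  rw [hη]
  constructor
  · refine mul_le_mul_of_nonneg_right ?_ hU0.le
    rw [add_comm]
    refine (Real.add_one_le_exp _).trans (Real.exp_le_exp.2 ?_)
    linarith
  · refine mul_le_mul_of_nonneg_right ?_ hU0.le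
    exact exp_sub_le_one_add hRt0 hRt ha0 hδt ha3 hq1 hηq

end average

section assembly

lemma deg_eq_degree {r : ℕ} (H : SimpleGraph (Fin r)) (x : Fin r) : deg H x = H.degree x := by
  rw [deg, ← SimpleGraph.card_neighborFinset_eq_degree]
  congr 1
  ext y
  simp

lemma numEdges_eq_of_sum_deg {r m : ℕ} {H : SimpleGraph (Fin r)} (h : ∑ j, deg H j = 2 * m) :
    numEdges H = m := by
  have h1 := H.sum_degrees_eq_twice_card_edges
  simp only [deg_eq_degree] at h
  rw [numEdges]
  omega

lemma sum_exp_embedding_bounds {V : Type*} [Fintype V] {r : ℕ} {e : V → ℝ} {t : Fin r → ℝ}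
    {δ R Q : ℝ} (he : ∀ v, |e v| ≤ δ) (h0 : ∑ v, e v = 0)
    (hR : ∑ v, e v ^ 2 = Fintype.card V * R) (hr : 2 * r ≤ Fintype.card V)
    (hV : 0 < Fintype.card V) (hδt : ∀ x, δ * |t x| ≤ 1 / 2)
    (hq : ∀ x, 4 * (r * (δ * |t x|) / Fintype.card V) + (δ * |t x|) ^ 3 ≤ 1 / 4)
    (hQ : ∑ x, (4 * (r * (δ * |t x|) / Fintype.card V) + (δ * |t x|) ^ 3) ≤ Q) :
    ∑ φ : Fin r ↪ V, Real.exp (∑ x, e (φ x) * t x) ≤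
        Real.exp (R / 2 * ∑ x, t x ^ 2 + 4 * Q) * Fintype.card (Fin r ↪ V) ∧
      Real.exp (R / 2 * ∑ x, t x ^ 2 - 4 * Q) * Fintype.card (Fin r ↪ V) ≤
        ∑ φ : Fin r ↪ V, Real.exp (∑ x, e (φ x) * t x) := by
  set q : Fin r → ℝ := fun x => 4 * (r * (δ * |t x|) / Fintype.card V) + (δ * |t x|) ^ 3 with hqdef
  have hkey := fun (x : Fin r) (U : Finset V) (hU : Fintype.card V - r ≤ U.card) =>
    sum_exp_mul_bounds he h0 hR hr hV (hδt x) (le_refl (q x)) (hq x) hU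
  simp only [Real.exp_sum]
  have hsum : ∑ x, R * t x ^ 2 / 2 = R / 2 * ∑ x, t x ^ 2 := by
    rw [Finset.mul_sum]
    refine Finset.sum_congr rfl fun x _ => ?_
    ring
  constructor
  · refine (sum_embedding_prod_le le_rfl (f := fun x v => Real.exp (e v * t x))
      (c := fun x => Real.exp (R * t x ^ 2 / 2 + 4 * q x)) (fun _ _ => (Real.exp_pos _).le)
      (fun _ => (Real.exp_pos _).le) fun x U hU => (hkey x U hU).1).trans ?_
    rw [← Real.exp_sum, Finset.sum_add_distrib, hsum, ← Finset.mul_sum]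
    gcongr
  · refine le_trans ?_ (le_sum_embedding_prod le_rfl (f := fun x v => Real.exp (e v * t x))
      (c := fun x => Real.exp (R * t x ^ 2 / 2 - 4 * q x)) (fun _ _ => (Real.exp_pos _).le)
      (fun _ => (Real.exp_pos _).le) fun x U hU => (hkey x U hU).2)
    rw [← Real.exp_sum, Finset.sum_sub_distrib, hsum, ← Finset.mul_sum]
    gcongr

lemma approxWeight_eq {r : ℕ} {l κ : ℝ} {e : Fin r → ℝ} {H : SimpleGraph (Fin r)} :
    approxWeight l κ e H = binWeight l H * Real.exp (-(∑ x, cdeg l H x ^ 2) / (2 * κ)) *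
      Real.exp (∑ x, e x * (cdeg l H x / κ)) := by
  rw [approxWeight, mul_assoc, ← Real.exp_add, neg_div, Finset.sum_div, ← Finset.sum_neg_distrib,
    ← Finset.sum_add_distrib]
  congr 3
  ext x
  ring

lemma card_fin_embedding (n r : ℕ) :
    (Fintype.card (Fin r ↪ Fin n) : ℝ) = (r.factorial : ℝ) * (n.choose r : ℝ) := by
  rw [Fintype.card_embedding_eq, Fintype.card_fin, Fintype.card_fin,
    Nat.descFactorial_eq_factorial_mul_choose]
  push_cast
  ring

/-- Averaging the approximate induced probabilities over all vertex placements. -/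
lemma expInd_bounds_of_induced_bounds {n r : ℕ} {d : Fin n → ℕ} {H : SimpleGraph (Fin r)}
    {D δ l κ R β Q : ℝ} (hn : 0 < n) (hl0 : 0 < l) (hl1 : l < 1)
    (hd : ∀ v, |(d v : ℝ) - D| ≤ δ) (hD : ∑ v, (d v : ℝ) = n * D)
    (hR : ∑ v, ((d v : ℝ) - D) ^ 2 = n * R) (hr : 2 * r ≤ n)
    (hind : ∀ φ : Fin r ↪ Fin n,
      inducedCount d φ H / (degFinset n d).card ≤
          Real.exp β * approxWeight l κ (fun x => d (φ x) - D) H ∧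
        Real.exp (-β) * approxWeight l κ (fun x => d (φ x) - D) H ≤
          inducedCount d φ H / (degFinset n d).card)
    (hδt : ∀ x, δ * |cdeg l H x / κ| ≤ 1 / 2)
    (hq : ∀ x, 4 * (r * (δ * |cdeg l H x / κ|) / n) + (δ * |cdeg l H x / κ|) ^ 3 ≤ 1 / 4)
    (hQ : ∑ x, (4 * (r * (δ * |cdeg l H x / κ|) / n) + (δ * |cdeg l H x / κ|) ^ 3) ≤ Q) :
    let X := (r.factorial : ℝ) / autCard H * n.choose r * binWeight l H *
      Real.exp (-(∑ x, cdeg l H x ^ 2) / (2 * κ) + R / 2 * ∑ x, (cdeg l H x / κ) ^ 2)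
    expInd n d H ≤ X * Real.exp (β + 4 * Q) ∧ X * Real.exp (-(β + 4 * Q)) ≤ expInd n d H := by
  have hcard : Fintype.card (Fin n) = n := Fintype.card_fin n
  have h0 : ∑ v, ((d v : ℝ) - D) = 0 := by
    rw [Finset.sum_sub_distrib, hD]
    simp
  have hB := binWeight_pos (H := H) hl0 hl1
  have hA : (0 : ℝ) < autCard H := by exact_mod_cast autCard_pos
  obtain ⟨hup, hlo⟩ := sum_exp_embedding_bounds (V := Fin n) (r := r) (t := fun x => cdeg l H x / κ)
    (e := fun v => (d v : ℝ) - D) (δ := δ) (R := R) (Q := Q) hd h0 (by rw [hcard]; exact hR)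
    (by rw [hcard]; exact hr) (by rw [hcard]; exact hn) hδt (by rw [hcard]; exact hq)
    (by rw [hcard]; exact hQ)
  rw [card_fin_embedding] at hup hlo
  set S := ∑ φ : Fin r ↪ Fin n, Real.exp (∑ x, ((d (φ x) : ℝ) - D) * (cdeg l H x / κ)) with hS
  set Y := Real.exp (-(∑ x, cdeg l H x ^ 2) / (2 * κ)) with hY
  have hYpos : 0 < Y := Real.exp_pos _
  have hsum : ∑ φ : Fin r ↪ Fin n, approxWeight l κ (fun x => (d (φ x) : ℝ) - D) H =
      binWeight l H * Y * S := by
    rw [hS, Finset.mul_sum]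
    exact Finset.sum_congr rfl fun φ _ => approxWeight_eq
  intro X
  rw [expInd_eq_sum]
  constructor
  · rw [div_le_iff₀ hA]
    calc ∑ φ : Fin r ↪ Fin n, inducedCount d φ H / ((degFinset n d).card : ℝ)
        ≤ ∑ φ : Fin r ↪ Fin n,
            Real.exp β * approxWeight l κ (fun x => (d (φ x) : ℝ) - D) H :=
          Finset.sum_le_sum fun φ _ => (hind φ).1
      _ = Real.exp β * (binWeight l H * Y * S) := by rw [← Finset.mul_sum, hsum]
      _ ≤ Real.exp β * (binWeight l H * Y * (Real.exp (R / 2 * ∑ x, (cdeg l H x / κ) ^ 2 + 4 * Q) *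
            (r.factorial * n.choose r))) := by gcongr
      _ = X * Real.exp (β + 4 * Q) * autCard H := by
        simp only [X, Real.exp_add, ← hY]
        field_simp
  · rw [le_div_iff₀ hA]
    calc X * Real.exp (-(β + 4 * Q)) * autCard H
        = Real.exp (-β) * (binWeight l H * Y *
            (Real.exp (R / 2 * ∑ x, (cdeg l H x / κ) ^ 2 - 4 * Q) *
            (r.factorial * n.choose r))) := by
          simp only [X, Real.exp_add, ← hY, neg_add, sub_eq_add_neg]
          field_simp
      _ ≤ Real.exp (-β) * (binWeight l H * Y * S) := by gcongr
      _ = ∑ φ : Fin r ↪ Fin n,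
            Real.exp (-β) * approxWeight l κ (fun x => (d (φ x) : ℝ) - D) H := by
          rw [← Finset.mul_sum, hsum]
      _ ≤ _ := Finset.sum_le_sum fun φ _ => (hind φ).2

end assembly

section parameters

lemma pow_four_le_nine_pow {n s : ℕ} (hn : 0 < n) (hs : 2 * Real.log n ≤ s) :
    (n : ℝ) ^ 4 ≤ 9 ^ s := by
  have hn' : (0 : ℝ) < n := by exact_mod_cast hn
  have he : Real.exp 2 ≤ 9 := by
    have h := Real.exp_one_lt_d9
    have h2 : Real.exp 2 = Real.exp 1 * Real.exp 1 := by rw [← Real.exp_add]; norm_num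
    have := Real.exp_pos 1
    nlinarith
  calc (n : ℝ) ^ 4 = Real.exp (4 * Real.log n) := by
        rw [mul_comm, Real.exp_mul, Real.exp_log hn']
        norm_cast
    _ ≤ Real.exp (s * 2) := Real.exp_le_exp.2 (by linarith)
    _ = Real.exp 2 ^ s := by rw [Real.exp_nat_mul]
    _ ≤ 9 ^ s := by gcongr

lemma exists_switching_length {n : ℕ} {M : ℝ} (hn : 0 < n) (hM : 512 * Real.log n + 768 ≤ M) :
    ∃ s : ℕ, M ≤ 256 * s ∧ 128 * s ≤ M ∧ (n : ℝ) ^ 4 ≤ 9 ^ s := by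
  have hlog : 0 ≤ Real.log n := Real.log_natCast_nonneg n
  have h1 : (⌊M / 128⌋₊ : ℝ) ≤ M / 128 := Nat.floor_le (by linarith)
  have h2 := Nat.lt_floor_add_one (M / 128)
  refine ⟨⌊M / 128⌋₊, by linarith, by linarith, pow_four_le_nine_pow hn (by linarith)⟩

lemma sq_mul_error_le {r u δ M w σ : ℝ} (hM : 0 < M) (hu : u = δ + r)
    (h1 : (r * (δ / M)) ^ 2 ≤ σ) (h2 : r ^ 2 / M ≤ σ) (hσ : σ ≤ 1 / 100) (hw0 : 0 ≤ w)
    (hw : w ≤ 6 / M + 7168 * (u / M) ^ 2) (hw1 : w ≤ 1 / 100) :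
    r ^ 2 * (1 / M + w + 2 * (2 * (u / M) + w) ^ 2) + 48 * σ ≤ 30000 * σ := by
  have hσ0 : 0 ≤ σ := (sq_nonneg _).trans h1
  have hp : r ^ 2 * (u / M) ^ 2 ≤ 3 * σ := by
    have h3 : (r ^ 2 / M) ^ 2 ≤ σ ^ 2 := pow_le_pow_left₀ (by positivity) h2 2
    have h4 : r ^ 2 * (u / M) ^ 2 = (r * (δ / M) + r ^ 2 / M) ^ 2 := by
      rw [hu]; ring
    rw [h4]
    nlinarith [sq_nonneg (r * (δ / M) - r ^ 2 / M)]
  have hrw : r ^ 2 * w ≤ 21510 * σ := by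
    calc r ^ 2 * w ≤ r ^ 2 * (6 / M + 7168 * (u / M) ^ 2) := by gcongr
      _ = 6 * (r ^ 2 / M) + 7168 * (r ^ 2 * (u / M) ^ 2) := by ring
      _ ≤ 21510 * σ := by linarith
  have hrww : r ^ 2 * w * w ≤ 21510 * σ * (1 / 100) := by gcongr
  have hz : r ^ 2 * (2 * (u / M) + w) ^ 2 ≤ 8 * (r ^ 2 * (u / M) ^ 2) + 2 * (r ^ 2 * w * w) := by
    have := mul_nonneg (sq_nonneg r) (sq_nonneg (2 * (u / M) - w))
    linarith [this, (by ring : r ^ 2 * (2 * (u / M) + w) ^ 2 =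
      8 * (r ^ 2 * (u / M) ^ 2) + 2 * (r ^ 2 * w * w) - r ^ 2 * (2 * (u / M) - w) ^ 2)]
  have e : r ^ 2 * (1 / M + w + 2 * (2 * (u / M) + w) ^ 2) =
    r ^ 2 / M + r ^ 2 * w + 2 * (r ^ 2 * (2 * (u / M) + w) ^ 2) := by ring
  rw [e]
  linarith

set_option maxHeartbeats 800000 in
/-- The induced probability estimate with all auxiliary parameters chosen. -/
lemma induced_probability_of_small {n r : ℕ} {d : Fin n → ℕ} {φ : Fin r ↪ Fin n} {D δ l σ : ℝ}
    (hd : ∀ v, |(d v : ℝ) - D| ≤ δ) (hD : ∑ v, (d v : ℝ) = n * D) (hl : D = l * (n - 1))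
    (hl0 : 0 < l) (hl1 : l < 1) (hn : 3 ≤ n)
    (hM : 512 * Real.log n + 768 ≤ l * (1 - l) * n) (hu : 200000 * (δ + r) ≤ l * (1 - l) * n)
    (h1 : (r * (δ / (l * (1 - l) * n))) ^ 2 ≤ σ) (h2 : (r : ℝ) ^ 2 / (l * (1 - l) * n) ≤ σ)
    (hσ : σ ≤ 1 / 100) (hne : (degFinset n d).Nonempty) (H : SimpleGraph (Fin r)) :
    inducedCount d φ H / (degFinset n d).card ≤
        Real.exp (30000 * σ) * approxWeight l (l * (1 - l) * n) (fun x => d (φ x) - D) H ∧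
      Real.exp (-(30000 * σ)) * approxWeight l (l * (1 - l) * n) (fun x => d (φ x) - D) H ≤
        inducedCount d φ H / (degFinset n d).card := by
  have hn0 : 0 < n := by omega
  have hn' : (3 : ℝ) ≤ n := by exact_mod_cast hn
  have hnpos : (0 : ℝ) < n := by linarith
  have hlog : 0 ≤ Real.log n := Real.log_natCast_nonneg n
  obtain ⟨s, hs1, hs2, hs9⟩ := exists_switching_length hn0 hM
  set μ := l * (1 - l) with hμ
  have hμ0 : 0 < μ := mul_pos hl0 (by linarith)
  have hμl : μ ≤ l := by nlinarith
  have hμl' : μ ≤ 1 - l := by nlinarith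
  have hμ4 : μ ≤ 1 / 4 := by nlinarith [sq_nonneg (l - 1 / 2)]
  have hMn : μ * n ≤ 1 / 4 * n := by gcongr
  set u := δ + r with hudef
  have hδ0 : 0 ≤ δ := (abs_nonneg _).trans (hd ⟨0, hn0⟩)
  have hr0 : (0 : ℝ) ≤ r := r.cast_nonneg
  have hu0 : 0 ≤ u := by positivity
  have hMpos : 0 < μ * n := by positivity
  have hsR : (1 : ℝ) ≤ s := by linarith
  have hspos : (0 : ℝ) < s := by linarith
  have hp : u / (μ * n) ≤ 1 / 200000 := by
    rw [div_le_div_iff₀ hMpos (by norm_num)]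
    linarith
  have hp0 : 0 ≤ u / (μ * n) := by positivity
  set θ : ℝ := (6 + 28 * u ^ 2 / s) / n with hθ
  have hw : θ / μ ≤ 6 / (μ * n) + 7168 * (u / (μ * n)) ^ 2 := by
    have e : θ / μ = 6 / (μ * n) + 28 * u ^ 2 / (s * (μ * n)) := by
      rw [hθ]; field_simp
    have e2 : 7168 * (u / (μ * n)) ^ 2 = 7168 * u ^ 2 / ((μ * n) * (μ * n)) := by
      field_simp
    rw [e, e2]
    refine add_le_add le_rfl ?_
    rw [div_le_div_iff₀ (by positivity) (by positivity)]
    calc 28 * u ^ 2 * (μ * n * (μ * n)) ≤ 28 * u ^ 2 * (256 * s * (μ * n)) := by gcongr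
      _ = 7168 * u ^ 2 * (s * (μ * n)) := by ring
  have hw0 : 0 ≤ θ / μ := by positivity
  have hw1 : θ / μ ≤ 1 / 100 := by
    refine hw.trans ?_
    have h3 : 6 / (μ * n) ≤ 6 / 768 := by gcongr; linarith
    have h4 : (u / (μ * n)) ^ 2 ≤ (1 / 200000) ^ 2 := by gcongr
    norm_num at h3 h4 ⊢
    linarith
  have hz : (2 * u / n + θ) / μ = 2 * (u / (μ * n)) + θ / μ := by
    field_simp
  have hδu : δ / (μ * n) ≤ u / (μ * n) := by gcongr; linarith
  have hru : (r : ℝ) ≤ u := by linarith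
  have hn1 : μ * n * (2 / 3) ≤ μ * (n - 1) := by nlinarith
  have hs9' : 2 * u * (10 * ((n : ℝ) ^ 2 * (2 * s + 1) / 9 ^ s)) ≤ 1 := by
    have h9 : (0 : ℝ) < 9 ^ s := by positivity
    have e : 2 * u * (10 * ((n : ℝ) ^ 2 * (2 * s + 1) / 9 ^ s)) =
        20 * u * (2 * s + 1) * n ^ 2 / 9 ^ s := by ring
    rw [e, div_le_one h9]
    refine le_trans ?_ hs9
    have h3 : 20 * u ≤ n := by linarith
    have h4 : 2 * (s : ℝ) + 1 ≤ n := by linarith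
    calc 20 * u * (2 * s + 1) * n ^ 2 ≤ n * n * n ^ 2 := by gcongr
      _ = (n : ℝ) ^ 4 := by ring
  have hbig : (n : ℝ) * (16 * s + 3 * u) < (D - u) * (n - 1 - D - u) := by
    have e : (D - u) * (n - 1 - D - u) = μ * (n - 1) * (n - 1) - u * (n - 1) + u ^ 2 := by
      rw [hl, hμ]; ring
    have h3 : μ * n * (2 / 3) * (n * (2 / 3)) ≤ μ * (n - 1) * (n - 1) := by
      refine mul_le_mul hn1 (by linarith) (by positivity) ?_
      exact mul_nonneg hμ0.le (by linarith)
    have h4 : u * (n - 1) ≤ u * n := by gcongr; linarith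
    have h5 : (n : ℝ) * (16 * s + 4 * u) < n * (μ * n * (4 / 9)) := by
      gcongr
      linarith
    have h6 := sq_nonneg u
    rw [e]
    linarith
  have h0 : 0 ≤ (n : ℝ) - 1 - D - u := by
    have e : (n : ℝ) - 1 - D = (1 - l) * (n - 1) := by rw [hl]; ring
    have h3 : μ * (n - 1) ≤ (1 - l) * (n - 1) := by
      apply mul_le_mul_of_nonneg_right hμl'
      linarith
    linarith
  have hmain := induced_probability (φ := φ) (z := 2 * (u / (μ * n)) + θ / μ)
    (ξ := 1 / (μ * n) + θ / μ + 2 * (2 * (u / (μ * n)) + θ / μ) ^ 2) (τ := δ / (μ * n))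
    (σ := σ) (s := s) hd hD hl hl0 hl1 hn0 (by linarith) (by exact_mod_cast hspos) (by linarith)
    (by linarith) h0 hbig hs9' hθ hz.le (by linarith) le_rfl le_rfl (by linarith) h1 h2 hσ hne H
  have herr := sq_mul_error_le (r := r) (u := u) (δ := δ) (w := θ / μ) hMpos hudef h1 h2 hσ
    hw0 hw hw1
  have happ : 0 < approxWeight l (μ * n) (fun x => (d (φ x) : ℝ) - D) H :=
    approxWeight_pos hl0 hl1
  constructor
  · refine hmain.1.trans ?_
    gcongr
  · refine le_trans ?_ hmain.2
    gcongr

end parameters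

section conclusion

lemma expInd_bounds_of_small {n r : ℕ} {d : Fin n → ℕ} {D δ l σ R : ℝ}
    (hd : ∀ v, |(d v : ℝ) - D| ≤ δ) (hD : ∑ v, (d v : ℝ) = n * D) (hl : D = l * (n - 1))
    (hR : ∑ v, ((d v : ℝ) - D) ^ 2 = n * R)
    (hl0 : 0 < l) (hl1 : l < 1) (hn : 3 ≤ n)
    (hM : 512 * Real.log n + 768 ≤ l * (1 - l) * n) (hu : 200000 * (δ + r) ≤ l * (1 - l) * n)
    (h1 : (r * (δ / (l * (1 - l) * n))) ^ 2 ≤ σ) (h2 : (r : ℝ) ^ 2 / (l * (1 - l) * n) ≤ σ)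
    (hσ : σ ≤ 1 / 100) (hne : (degFinset n d).Nonempty) (H : SimpleGraph (Fin r))
    (h3 : ∑ x, (δ * |cdeg l H x / (l * (1 - l) * n)|) ^ 3 ≤ σ) :
    let X := (r.factorial : ℝ) / autCard H * n.choose r * binWeight l H *
      Real.exp (-(∑ x, cdeg l H x ^ 2) / (2 * (l * (1 - l) * n)) +
        R / 2 * ∑ x, (cdeg l H x / (l * (1 - l) * n)) ^ 2)
    expInd n d H ≤ X * Real.exp (30020 * σ) ∧ X * Real.exp (-(30020 * σ)) ≤ expInd n d H := by
  have hnpos : (0 : ℝ) < n := by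
    have : (3 : ℝ) ≤ n := by exact_mod_cast hn
    linarith
  have hσ0 : 0 ≤ σ := (sq_nonneg _).trans h1
  set M := l * (1 - l) * n with hMdef
  have hlog : 0 ≤ Real.log n := Real.log_natCast_nonneg n
  have hMpos : 0 < M := by linarith
  have hδ0 : 0 ≤ δ := (abs_nonneg _).trans (hd ⟨0, by omega⟩)
  have hr0 : (0 : ℝ) ≤ r := r.cast_nonneg
  have hMn : M ≤ n := by
    have : l * (1 - l) ≤ 1 := by nlinarith
    calc M ≤ 1 * n := mul_le_mul_of_nonneg_right this hnpos.le
      _ = n := one_mul _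
  have hrδ : r * (δ / M) ≤ 1 / 10 := by
    refine abs_le_of_sq_le_sq' ?_ (by norm_num) |>.2
    linarith
  have ht : ∀ x, |cdeg l H x / M| ≤ r / M := fun x => by
    rw [abs_div, abs_of_pos hMpos]
    gcongr
    exact abs_deg_sub_le H x hl0.le hl1.le
  have hδt : ∀ x, δ * |cdeg l H x / M| ≤ 1 / 10 := fun x => by
    calc δ * |cdeg l H x / M| ≤ δ * (r / M) := by gcongr; exact ht x
      _ = r * (δ / M) := by ring
      _ ≤ 1 / 10 := hrδ
  have hrn : (r : ℝ) / n ≤ 1 / 200000 := by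
    rw [div_le_div_iff₀ hnpos (by norm_num)]
    linarith
  have hlin : ∀ x, r * (δ * |cdeg l H x / M|) / n ≤ 1 / 100 := fun x => by
    calc r * (δ * |cdeg l H x / M|) / n = r / n * (δ * |cdeg l H x / M|) := by ring
      _ ≤ 1 / 200000 * (1 / 10) := by gcongr; exact hδt x
      _ ≤ 1 / 100 := by norm_num
  have hlinsum : ∑ x, 4 * (r * (δ * |cdeg l H x / M|) / n) ≤ 4 * σ := by
    calc ∑ x, 4 * (r * (δ * |cdeg l H x / M|) / n)
        ≤ ∑ _x : Fin r, 4 * (r * (δ * (r / M)) / n) := by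
          gcongr with x _
          exact ht x
      _ = 4 * (r ^ 2 / M) * (r * (δ / n)) := by
          rw [Finset.sum_const, Finset.card_univ, Fintype.card_fin, nsmul_eq_mul]
          ring
      _ ≤ 4 * σ * 1 := by
          have : r * (δ / n) ≤ r * (δ / M) := by gcongr
          gcongr
          linarith
      _ = 4 * σ := mul_one _
  have key := expInd_bounds_of_induced_bounds (n := n) (r := r) (d := d) (H := H) (D := D)
    (δ := δ) (l := l) (κ := M) (R := R) (β := 30000 * σ) (Q := 5 * σ) (by omega) hl0 hl1 hd hD hR
    (by exact_mod_cast (by linarith : (2 : ℝ) * r ≤ n))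
    (fun φ => induced_probability_of_small hd hD hl hl0 hl1 hn hM hu h1 h2 hσ hne H)
    (fun x => (hδt x).trans (by norm_num)) (fun x => ?_) ?_
  · have e : 30000 * σ + 4 * (5 * σ) = 30020 * σ := by ring
    rw [e] at key
    exact key
  · have : (δ * |cdeg l H x / M|) ^ 3 ≤ (1 / 10) ^ 3 :=
      pow_le_pow_left₀ (by positivity) (hδt x) 3
    have := hlin x
    norm_num at *
    linarith
  · rw [Finset.sum_add_distrib]
    linarith

/-- Two-sided exponential bounds give an exact exponential correction. -/
lemma exists_eq_mul_exp {A X β : ℝ} (hX : 0 < X) (h1 : A ≤ X * Real.exp β)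
    (h2 : X * Real.exp (-β) ≤ A) : ∃ E, |E| ≤ β ∧ A = X * Real.exp E := by
  have hA : 0 < A := lt_of_lt_of_le (by positivity) h2
  refine ⟨Real.log (A / X), abs_le.2 ⟨?_, ?_⟩, ?_⟩
  · rw [Real.le_log_iff_exp_le (by positivity), le_div_iff₀ hX]
    linarith
  · rw [Real.log_le_iff_le_exp (by positivity), div_le_iff₀ hX]
    linarith
  · rw [Real.exp_log (by positivity)]
    field_simp

lemma abs_sub_dbar_le_deltaPar {n : ℕ} (d : Fin n → ℕ) (v : Fin n) :
    |(d v : ℝ) - dbar n d| ≤ deltaPar n d :=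
  le_ciSup (f := fun j : Fin n => |(d j : ℝ) - dbar n d|) (Set.finite_range _).bddAbove v

lemma sum_eq_mul_dbar {n : ℕ} (hn : 0 < n) (d : Fin n → ℕ) :
    ∑ v, (d v : ℝ) = n * dbar n d := by
  have : (n : ℝ) ≠ 0 := by positivity
  rw [dbar]
  field_simp

lemma sum_sq_eq_mul_Rpar {n : ℕ} (hn : 0 < n) (d : Fin n → ℕ) :
    ∑ v, ((d v : ℝ) - dbar n d) ^ 2 = n * Rpar n d := by
  have : (n : ℝ) ≠ 0 := by positivity
  rw [Rpar]
  field_simp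

lemma omega_two_eq {n r : ℕ} (d : Fin n → ℕ) (H : SimpleGraph (Fin r)) :
    omega n d H 2 = ∑ x, cdeg (lam n d) H x ^ 2 := rfl

/-- The estimate of the expected number of induced copies, under numerical smallness conditions. -/
lemma exists_expInd_eq {n r m : ℕ} {d : Fin n → ℕ} {H : SimpleGraph (Fin r)} {σ : ℝ}
    (hm : ∑ j, deg H j = 2 * m) (hl0 : 0 < lam n d) (hl1 : lam n d < 1) (hn : 3 ≤ n)
    (hM : 512 * Real.log n + 768 ≤ lam n d * (1 - lam n d) * n)
    (hu : 200000 * (deltaPar n d + r) ≤ lam n d * (1 - lam n d) * n)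
    (h1 : (r * (deltaPar n d / (lam n d * (1 - lam n d) * n))) ^ 2 ≤ σ)
    (h2 : (r : ℝ) ^ 2 / (lam n d * (1 - lam n d) * n) ≤ σ) (hσ : σ ≤ 1 / 100)
    (hne : (degFinset n d).Nonempty)
    (h3 : deltaPar n d ^ 3 / (lam n d ^ 3 * (1 - lam n d) ^ 3 * (n : ℝ) ^ 3) *
      (∑ j : Fin r, |(deg H j : ℝ) - lam n d * ((r : ℝ) - 1)| ^ 3) ≤ σ) :
    ∃ E : ℝ, |E| ≤ 30020 * σ ∧
      expInd n d H =
        ((Nat.factorial r : ℝ) / (autCard H : ℝ)) * (Nat.choose n r : ℝ) *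
          (lam n d) ^ m * (1 - lam n d) ^ (Nat.choose r 2 - m) *
          Real.exp (
            -(omega n d H 2) / (2 * lam n d * (1 - lam n d) * n)
            + Rpar n d * omega n d H 2 /
                (2 * (lam n d) ^ 2 * (1 - lam n d) ^ 2 * (n : ℝ) ^ 2)
            + E) := by
  have hn0 : 0 < n := by omega
  have hn' : (3 : ℝ) ≤ n := by exact_mod_cast hn
  have hl : dbar n d = lam n d * (n - 1) := by
    have : (n : ℝ) - 1 ≠ 0 := by linarith
    rw [lam]
    field_simp
  set l := lam n d with hldef
  have hl1' : 0 < 1 - l := by linarith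
  have hcub : ∑ x, (deltaPar n d * |cdeg l H x / (l * (1 - l) * n)|) ^ 3 ≤ σ := by
    refine le_trans (le_of_eq ?_) h3
    rw [Finset.mul_sum]
    refine Finset.sum_congr rfl fun x _ => ?_
    rw [abs_div, abs_of_pos (by positivity : 0 < l * (1 - l) * n)]
    simp only [cdeg]
    field_simp
  obtain ⟨hup, hlo⟩ := expInd_bounds_of_small (abs_sub_dbar_le_deltaPar d) (sum_eq_mul_dbar hn0 d)
    hl (sum_sq_eq_mul_Rpar hn0 d) hl0 hl1 hn hM hu h1 h2 hσ hne H hcub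
  have hX : 0 < (r.factorial : ℝ) / autCard H * n.choose r * binWeight l H *
      Real.exp (-(∑ x, cdeg l H x ^ 2) / (2 * (l * (1 - l) * n)) +
        Rpar n d / 2 * ∑ x, (cdeg l H x / (l * (1 - l) * n)) ^ 2) := by
    have hA : (0 : ℝ) < autCard H := by exact_mod_cast autCard_pos
    have hB := binWeight_pos (H := H) hl0 hl1
    have hM1 : l * (1 - l) ≤ 1 := by nlinarith
    have hrn : (r : ℝ) ≤ n := by
      have hδ0 := (abs_nonneg _).trans (abs_sub_dbar_le_deltaPar d ⟨0, hn0⟩)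
      have : l * (1 - l) * n ≤ 1 * n := mul_le_mul_of_nonneg_right hM1 (by linarith)
      have hr0 : (0 : ℝ) ≤ r := r.cast_nonneg
      linarith
    have hC : 0 < n.choose r := Nat.choose_pos (by exact_mod_cast hrn)
    positivity
  obtain ⟨E, hE, hEq⟩ := exists_eq_mul_exp hX hup hlo
  refine ⟨E, hE, ?_⟩
  rw [hEq, binWeight, numEdges_eq_of_sum_deg hm, omega_two_eq, ← hldef, Real.exp_add _ E]
  have e1 : -(∑ x, cdeg l H x ^ 2) / (2 * (l * (1 - l) * n)) =
      -(∑ x, cdeg l H x ^ 2) / (2 * l * (1 - l) * n) := by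
    congr 1
    ring
  have e2 : Rpar n d / 2 * ∑ x, (cdeg l H x / (l * (1 - l) * n)) ^ 2 =
      Rpar n d * (∑ x, cdeg l H x ^ 2) / (2 * l ^ 2 * (1 - l) ^ 2 * (n : ℝ) ^ 2) := by
    have : ∑ x, (cdeg l H x / (l * (1 - l) * n)) ^ 2 =
        (∑ x, cdeg l H x ^ 2) / (l * (1 - l) * n) ^ 2 := by
      rw [Finset.sum_div]
      exact Finset.sum_congr rfl fun x _ => div_pow _ _ _
    rw [this]
    field_simp
  rw [e1, e2]
  ring

end conclusion

section asymptotics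

open Filter

lemma eventually_large (a b C₀ : ℝ) (ha : 0 < a) (hb : 0 < b) (hC₀ : 0 < C₀) :
    ∀ᶠ n : ℕ in atTop, 3 ≤ n ∧ C₀ * (n : ℝ) ^ (-b) ≤ 1 / 100 ∧ 1 ≤ Real.log n ∧
      6 * a * Real.log n * (512 * Real.log n + 768) ≤ n ∧
      400000 * C₀ * (n : ℝ) ^ (3 / 4 : ℝ) * (6 * a * Real.log n) ≤ n := by
  have hcast := tendsto_natCast_atTop_atTop (R := ℝ)
  have h2 : ∀ᶠ n : ℕ in atTop, C₀ * (n : ℝ) ^ (-b) ≤ 1 / 100 := by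
    have h := ((tendsto_rpow_neg_atTop hb).comp hcast).const_mul C₀
    rw [mul_zero] at h
    exact h.eventually_le_const (by norm_num)
  have h3 : ∀ᶠ n : ℕ in atTop, 1 ≤ Real.log n :=
    (Real.tendsto_log_atTop.comp hcast).eventually_ge_atTop 1
  have h4 := hcast.eventually
    ((Real.isLittleO_pow_log_id_atTop (n := 2)).bound (c := 1 / (7680 * a)) (by positivity))
  have h5 := hcast.eventually
    ((isLittleO_log_rpow_atTop (r := 1 / 4) (by norm_num)).bound
      (c := 1 / (2400000 * C₀ * a)) (by positivity))
  filter_upwards [eventually_ge_atTop 3, h2, h3, h4, h5] with n hn h2 h3 h4 h5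
  have hn' : (3 : ℝ) ≤ n := by exact_mod_cast hn
  have hn0 : (0 : ℝ) < n := by linarith
  refine ⟨hn, h2, h3, ?_, ?_⟩
  · rw [Real.norm_of_nonneg (by positivity), id, Real.norm_of_nonneg hn0.le, div_mul_eq_mul_div,
      le_div_iff₀ (by positivity)] at h4
    have : 6 * a * Real.log n * (512 * Real.log n + 768) ≤
        6 * a * Real.log n * (1280 * Real.log n) := by
      gcongr
      linarith
    linarith
  · rw [Real.norm_of_nonneg (by linarith), Real.norm_of_nonneg (by positivity), div_mul_eq_mul_div,
      le_div_iff₀ (by positivity)] at h5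
    have h6 : (n : ℝ) ^ (3 / 4 : ℝ) * (n : ℝ) ^ (1 / 4 : ℝ) = n := by
      rw [← Real.rpow_add hn0]
      norm_num
    calc 400000 * C₀ * (n : ℝ) ^ (3 / 4 : ℝ) * (6 * a * Real.log n)
        = (n : ℝ) ^ (3 / 4 : ℝ) * (Real.log n * (2400000 * C₀ * a)) := by ring
      _ ≤ (n : ℝ) ^ (3 / 4 : ℝ) * (1 * (n : ℝ) ^ (1 / 4 : ℝ)) := by gcongr
      _ = n := by rw [one_mul, h6]

/-- Lower bounds on the density and its complement from those on the average degree. -/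
lemma lam_bounds {n : ℕ} {d : Fin n → ℕ} {y : ℝ} (hn : 3 ≤ n) (hy : 0 < y)
    (h : (n : ℝ) / y ≤ min (dbar n d) ((n : ℝ) - dbar n d - 1)) :
    0 < lam n d ∧ lam n d < 1 ∧ (n : ℝ) / (2 * y) ≤ lam n d * (1 - lam n d) * n := by
  have hn' : (3 : ℝ) ≤ n := by exact_mod_cast hn
  have hn1 : 0 < (n : ℝ) - 1 := by linarith
  have h1 := h.trans (min_le_left _ _)
  have h2 := h.trans (min_le_right _ _)
  have hl : dbar n d = lam n d * (n - 1) := by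
    rw [lam]
    field_simp
  set l := lam n d
  have hy' : 0 < 1 / y := by positivity
  have hle : 1 / y * (n - 1) ≤ n / y := by
    rw [div_mul_eq_mul_div, one_mul]
    gcongr
    linarith
  have hl0 : 1 / y ≤ l := le_of_mul_le_mul_right (by linarith) hn1
  have hl1 : 1 / y ≤ 1 - l := by
    refine le_of_mul_le_mul_right ?_ hn1
    have : (1 - l) * (n - 1) = n - dbar n d - 1 := by rw [hl]; ring
    linarith
  refine ⟨by linarith, by linarith, ?_⟩
  have hμ : 1 / y * (1 / 2) ≤ l * (1 - l) := by
    rcases le_total l (1 / 2) with h | h <;> nlinarith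
  calc (n : ℝ) / (2 * y) = 1 / y * (1 / 2) * n := by ring
    _ ≤ l * (1 - l) * n := by gcongr

lemma sq_bounds_of_sq_mul_le {r δ n μ C₀ b : ℝ} (hn : 0 < n) (hμ : 0 < μ) (hμ1 : μ ≤ 1)
    (hC₀ : 0 < C₀) (h : r ^ 2 * (1 + δ ^ 2 / n) ≤ C₀ * μ ^ 2 * n ^ (1 - b)) :
    (r * (δ / (μ * n))) ^ 2 ≤ C₀ * n ^ (-b) ∧ r ^ 2 / (μ * n) ≤ C₀ * n ^ (-b) := by
  have hp : n ^ (1 - b) = n * n ^ (-b) := by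
    rw [sub_eq_add_neg, Real.rpow_add hn, Real.rpow_one]
  have hp0 : 0 < n ^ (-b) := Real.rpow_pos_of_pos hn _
  rw [hp] at h
  have h1 : r ^ 2 * (δ ^ 2 / n) ≤ C₀ * μ ^ 2 * (n * n ^ (-b)) := by nlinarith [sq_nonneg r]
  have h2 : r ^ 2 ≤ C₀ * μ ^ 2 * (n * n ^ (-b)) := by
    have : 0 ≤ r ^ 2 * (δ ^ 2 / n) := by positivity
    linarith
  constructor
  · have e : (r * (δ / (μ * n))) ^ 2 = r ^ 2 * (δ ^ 2 / n) / (μ ^ 2 * n) := by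
      field_simp
    rw [e, div_le_iff₀ (by positivity)]
    linarith
  · rw [div_le_iff₀ (by positivity)]
    calc r ^ 2 ≤ C₀ * (μ * μ) * (n * n ^ (-b)) := by rw [← sq]; exact h2
      _ ≤ C₀ * (1 * μ) * (n * n ^ (-b)) := by gcongr
      _ = C₀ * n ^ (-b) * (μ * n) := by ring

end asymptotics

theorem statement16 (a b C₀ : ℝ) (ha : 0 < a) (hb : 0 < b) (hab : a + b < 1 / 2)
    (hC₀ : 0 < C₀) :
    ∃ ε : ℝ, 0 < ε ∧ ∃ C : ℝ, 0 < C ∧ ∃ N : ℕ, ∀ n : ℕ, N ≤ n →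
      ∀ d : Fin n → ℕ, (degFinset n d).Nonempty →
        deltaPar n d ≤ C₀ * (n : ℝ) ^ ((1 : ℝ) / 2 + ε) →
        min (dbar n d) ((n : ℝ) - dbar n d - 1) ≥ (n : ℝ) / (3 * a * Real.log n) →
        ∀ r : ℕ, (r : ℝ) ≤ C₀ * (n : ℝ) ^ ((1 : ℝ) / 2 + ε) →
          ∀ H : SimpleGraph (Fin r), ∀ m : ℕ,
            (∑ j, deg H j) = 2 * m →
            (deltaPar n d) ^ 3 / ((lam n d) ^ 3 * (1 - lam n d) ^ 3 * (n : ℝ) ^ 3) *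
                (∑ j : Fin r, |(deg H j : ℝ) - lam n d * ((r : ℝ) - 1)| ^ 3) ≤
              C₀ * (n : ℝ) ^ (-b) →
            (r : ℝ) ^ 2 * (1 + (deltaPar n d) ^ 2 / n) ≤
              C₀ * (lam n d) ^ 2 * (1 - lam n d) ^ 2 * (n : ℝ) ^ ((1 : ℝ) - b) →
            ∃ E : ℝ, |E| ≤ C * (n : ℝ) ^ (-b) ∧
              expInd n d H =
                ((Nat.factorial r : ℝ) / (autCard H : ℝ)) * (Nat.choose n r : ℝ) *
                  (lam n d) ^ m * (1 - lam n d) ^ (Nat.choose r 2 - m) *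
                  Real.exp (
                    -(omega n d H 2) / (2 * lam n d * (1 - lam n d) * n)
                    + Rpar n d * omega n d H 2 /
                        (2 * (lam n d) ^ 2 * (1 - lam n d) ^ 2 * (n : ℝ) ^ 2)
                    + E) := by
  obtain ⟨N, hN⟩ := Filter.eventually_atTop.1 (eventually_large a b C₀ ha hb hC₀)
  refine ⟨1 / 4, by norm_num, 30020 * C₀, by positivity, N, ?_⟩
  intro n hn d hne hδ hmin r hr H m hm h3 h4
  obtain ⟨hn3, hσ, hlog, hbig, hbig'⟩ := hN n hn
  have hn' : (0 : ℝ) < n := by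
    have : (3 : ℝ) ≤ n := by exact_mod_cast hn3
    linarith
  have hexp : (1 : ℝ) / 2 + 1 / 4 = 3 / 4 := by norm_num
  rw [hexp] at hδ hr
  obtain ⟨hl0, hl1, hM⟩ := lam_bounds hn3 (by positivity) hmin
  have hM' : ∀ x : ℝ, x * (6 * a * Real.log n) ≤ n → x ≤ lam n d * (1 - lam n d) * n :=
    fun x hx => by
      refine le_trans ?_ hM
      rw [le_div_iff₀ (by positivity)]
      linarith
  have hμ : 0 < lam n d * (1 - lam n d) := mul_pos hl0 (by linarith)
  obtain ⟨h1, h2⟩ := sq_bounds_of_sq_mul_le (r := (r : ℝ)) (δ := deltaPar n d) (C₀ := C₀) (b := b)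
    hn' hμ (by nlinarith) hC₀ (by rw [mul_pow, ← mul_assoc]; exact h4)
  have hu : 200000 * (deltaPar n d + r) ≤ lam n d * (1 - lam n d) * n := by
    have := hM' _ hbig'
    linarith
  have key := exists_expInd_eq hm hl0 hl1 hn3 (hM' _ (by linarith)) hu h1 h2 hσ hne h3
  rwa [← mul_assoc] at key

end Stmt16
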